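/- arXiv:math/0106231 — 5 statements merged into one kernel-verified Lean document; each statement's English description precedes it below -/
import Mathlib

section
/- Let N ≥ 1 be a natural number and p > 1 a real number. If u : ℝ^N → ℝ is a bounded C¹ function that is p-harmonic in ℝ^N, i.e. ∫_{ℝ^N} |∇u(x)|^{p−2} ⟨∇u(x), ∇φ(x)⟩ dx = 0 for every C^∞ compactly supported φ : ℝ^N → ℝ, then u is constant. -/
open MeasureTheory Metric
open scoped RealInnerProductSpace

namespace PLiou

/-- Weak p-harmonicity, tested against `C^1` compactly supported functions. -/
def PH {N : ℕ} (p : ℝ) (u : EuclideanSpace ℝ (Fin N) → ℝ) : Prop :=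
  ∀ φ : EuclideanSpace ℝ (Fin N) → ℝ, ContDiff ℝ 1 φ → HasCompactSupport φ →
    ∫ x, ‖gradient u x‖ ^ (p - 2) * fderiv ℝ φ x (gradient u x) = 0

variable {N : ℕ}

lemma norm_grad (u : EuclideanSpace ℝ (Fin N) → ℝ) (x) :
    ‖gradient u x‖ = ‖fderiv ℝ u x‖ := by
  rw [← toDual_gradient, LinearIsometryEquiv.norm_map]

lemma grad_of {f : EuclideanSpace ℝ (Fin N) → ℝ} {x g : EuclideanSpace ℝ (Fin N)}
    {L : EuclideanSpace ℝ (Fin N) →L[ℝ] ℝ} (h : HasFDerivAt f L x)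
    (hg : ∀ y, ⟪g, y⟫ = L y) : gradient f x = g := by
  refine ext_inner_right ℝ fun y => ?_
  rw [inner_gradient_left, h.fderiv, hg]

lemma cont_grad {u : EuclideanSpace ℝ (Fin N) → ℝ} (hu : ContDiff ℝ 1 u) :
    Continuous (gradient u) := by
  have h := hu.continuous_fderiv (by norm_num)
  have : gradient u = fun x => (InnerProductSpace.toDual ℝ _).symm (fderiv ℝ u x) := rfl
  rw [this]
  exact (LinearIsometryEquiv.continuous _).comp h

lemma cont_A {p : ℝ} (hp : 1 < p) :
    Continuous (fun g : EuclideanSpace ℝ (Fin N) => ‖g‖ ^ (p - 2) • g) := by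
  rw [continuous_iff_continuousAt]
  intro g
  by_cases hg : g = 0
  · subst hg
    rw [ContinuousAt]
    simp only [smul_zero]
    rw [tendsto_zero_iff_norm_tendsto_zero]
    have h1 : ∀ g : EuclideanSpace ℝ (Fin N), ‖‖g‖ ^ (p - 2) • g‖ = ‖g‖ ^ (p - 1) := by
      intro g
      rw [norm_smul, Real.norm_eq_abs, abs_of_nonneg (by positivity)]
      by_cases hg : g = 0
      · subst hg; simp; rw [Real.zero_rpow (by linarith)]
      · have : 0 < ‖g‖ := norm_pos_iff.2 hg
        nth_rewrite 2 [← Real.rpow_one ‖g‖]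
        rw [← Real.rpow_add this]; congr 1; ring
    simp only [h1]
    have : Continuous (fun g : EuclideanSpace ℝ (Fin N) => ‖g‖ ^ (p - 1)) :=
      continuous_norm.rpow_const (fun _ => Or.inr (by linarith))
    have h2 := this.tendsto 0
    simpa [Real.zero_rpow (show p - 1 ≠ 0 by linarith)] using h2
  · refine ContinuousAt.smul (ContinuousAt.rpow_const continuous_norm.continuousAt
      (Or.inl (by simpa using hg))) continuousAt_id

lemma PH_of_smooth {p : ℝ} (hp : 1 < p) {u : EuclideanSpace ℝ (Fin N) → ℝ}
    (hu : ContDiff ℝ 1 u)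
    (hharm : ∀ φ : EuclideanSpace ℝ (Fin N) → ℝ,
      ContDiff ℝ (⊤ : ℕ∞) φ → HasCompactSupport φ →
      ∫ x, ‖gradient u x‖ ^ (p - 2) * ⟪gradient u x, gradient φ x⟫ = 0) : PH p u := by
  intro ψ hψ hcψ
  set A : EuclideanSpace ℝ (Fin N) → EuclideanSpace ℝ (Fin N) :=
    fun x => ‖gradient u x‖ ^ (p - 2) • gradient u x with hA
  have hAc : Continuous A := (cont_A hp).comp (cont_grad hu)
  have hAe : ∀ (φ : EuclideanSpace ℝ (Fin N) → ℝ) x,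
      ‖gradient u x‖ ^ (p - 2) * fderiv ℝ φ x (gradient u x) = fderiv ℝ φ x (A x) := by
    intro φ x; simp [hA]
  simp only [inner_gradient_right, conj_trivial] at hharm
  simp only [hAe] at hharm ⊢
  let B : ℕ → ContDiffBump (0 : EuclideanSpace ℝ (Fin N)) := fun n =>
    ⟨1 / (2 * (n + 1)), 1 / (n + 1), by positivity, by
      rw [div_lt_div_iff_of_pos_left] <;> first | positivity | linarith⟩
  have hBr : Filter.Tendsto (fun n => (B n).rOut) Filter.atTop (nhds 0) :=
    tendsto_one_div_add_atTop_nhds_zero_nat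
  have hB1 : ∀ n, (B n).rOut ≤ 1 := by
    intro n
    show (1 : ℝ) / (n + 1) ≤ 1
    rw [div_le_one (by positivity)]; linarith [(Nat.cast_nonneg n : (0 : ℝ) ≤ n)]
  let ψn : ℕ → EuclideanSpace ℝ (Fin N) → ℝ := fun n =>
    convolution ((B n).normed volume) ψ (ContinuousLinearMap.lsmul ℝ ℝ) volume
  have hfdc : Continuous (fderiv ℝ ψ) := hψ.continuous_fderiv (by norm_num)
  have hfd : ∀ n x, fderiv ℝ (ψn n) x =
      convolution ((B n).normed volume) (fderiv ℝ ψ) (ContinuousLinearMap.lsmul ℝ ℝ) volume x := by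
    intro n x
    have h := HasCompactSupport.hasFDerivAt_convolution_right (μ := volume)
      (f := (B n).normed volume) (ContinuousLinearMap.lsmul ℝ ℝ)
      hcψ (B n).continuous_normed.locallyIntegrable hψ x
    rw [h.fderiv]
    unfold convolution
    congr 1
  obtain ⟨C, hC⟩ := hcψ.fderiv (𝕜 := ℝ) |>.exists_bound_of_continuous hfdc
  obtain ⟨R, hR⟩ := hcψ.isCompact.isBounded.subset_closedBall 0
  have hz : ∀ x, R < ‖x‖ → fderiv ℝ ψ x = 0 := by
    intro x hx
    by_contra h
    have := hR (support_fderiv_subset ℝ h)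
    simp at this; linarith
  have hlim : Filter.Tendsto (fun n => ∫ x, fderiv ℝ (ψn n) x (A x)) Filter.atTop
      (nhds (∫ x, fderiv ℝ ψ x (A x))) := by
    refine tendsto_integral_of_dominated_convergence
      (fun x => (closedBall 0 (R + 1)).indicator (fun x => (C + 2 * C) * ‖A x‖) x) ?_ ?_ ?_ ?_
    · intro n
      refine Continuous.aestronglyMeasurable ?_
      have : ContDiff ℝ 1 (ψn n) := (B n).hasCompactSupport_normed.contDiff_convolution_left _
        ((B n).contDiff_normed (n := 1)) hψ.continuous.locallyIntegrable
      exact (this.continuous_fderiv (by norm_num)).clm_apply hAc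
    · rw [integrable_indicator_iff measurableSet_closedBall]
      exact (Continuous.continuousOn (by fun_prop)).integrableOn_compact (isCompact_closedBall _ _)
    · intro n
      refine Filter.Eventually.of_forall fun x => ?_
      rw [hfd]
      by_cases hx : x ∈ closedBall (0 : EuclideanSpace ℝ (Fin N)) (R + 1)
      · rw [Set.indicator_of_mem hx]
        refine (ContinuousLinearMap.le_opNorm _ _).trans ?_
        gcongr
        have h1 := (B n).dist_normed_convolution_le (μ := volume) (g := fderiv ℝ ψ) (x₀ := x)
          (ε := 2 * C) hfdc.aestronglyMeasurable (by
            intro y _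
            rw [dist_eq_norm]
            refine (norm_sub_le _ _).trans ?_
            linarith [hC x, hC y])
        rw [dist_eq_norm] at h1
        have := norm_le_norm_add_norm_sub' 
          (convolution ((B n).normed volume) (fderiv ℝ ψ) (ContinuousLinearMap.lsmul ℝ ℝ) volume x)
          (fderiv ℝ ψ x)
        linarith [hC x]
      · rw [Set.indicator_of_notMem hx]
        simp at hx
        rw [ContDiffBump.normed_convolution_eq_right, hz x (by linarith)]
        · simp
        · intro y hy
          rw [hz x (by linarith), hz y]
          rw [mem_ball, dist_eq_norm] at hy
          have := hB1 n
          have := norm_sub_norm_le x y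
          rw [norm_sub_rev] at this
          linarith
    · refine Filter.Eventually.of_forall fun x => ?_
      simp only [hfd]
      have := ContDiffBump.convolution_tendsto_right_of_continuous (μ := volume) hBr hfdc x
      exact ((ContinuousLinearMap.apply ℝ ℝ (A x)).continuous.tendsto _).comp this
  have h0 : ∀ n, ∫ x, fderiv ℝ (ψn n) x (A x) = 0 := by
    intro n
    refine hharm _ ?_ ?_
    · exact (B n).hasCompactSupport_normed.contDiff_convolution_left _
        ((B n).contDiff_normed) hψ.continuous.locallyIntegrable
    · exact (B n).hasCompactSupport_normed.convolution _ hcψ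
  simp only [h0] at hlim
  exact tendsto_nhds_unique hlim tendsto_const_nhds |>.symm ▸ rfl

lemma PH_affine {p : ℝ} {u : EuclideanSpace ℝ (Fin N) → ℝ}
    (hu : ContDiff ℝ 1 u) (h : PH p u) (a b : ℝ) {R : ℝ} (hR : 0 < R) :
    PH p (fun x => a * u (R • x) + b) := by
  intro φ hφ hcφ
  have hg : ∀ x, gradient (fun x => a * u (R • x) + b) x = (a * R) • gradient u (R • x) := by
    intro x
    have h1 : HasFDerivAt u (fderiv ℝ u (R • x)) (R • x) :=
      (hu.differentiable (by norm_num) _).hasFDerivAt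
    have h2 : HasFDerivAt (fun x : EuclideanSpace ℝ (Fin N) => R • x)
      (R • ContinuousLinearMap.id ℝ _) x := (hasFDerivAt_id x).const_smul R
    have h3 := ((h1.comp x h2).const_mul a).add_const b
    refine grad_of h3 fun y => ?_
    simp [inner_gradient_left, inner_smul_left]
    ring
  let φ' : EuclideanSpace ℝ (Fin N) → ℝ := fun y => φ (R⁻¹ • y)
  have hφ' : ContDiff ℝ 1 φ' := hφ.comp (contDiff_const_smul _)
  have hcφ' : HasCompactSupport φ' := hcφ.comp_smul (inv_ne_zero hR.ne')
  have hf : ∀ x, fderiv ℝ φ' (R • x) = R⁻¹ • fderiv ℝ φ x := by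
    intro x
    have h1 : HasFDerivAt φ (fderiv ℝ φ x) (R⁻¹ • R • x) := by
      rw [inv_smul_smul₀ hR.ne']
      exact (hφ.differentiable (by norm_num) _).hasFDerivAt
    have h2 : HasFDerivAt (fun x : EuclideanSpace ℝ (Fin N) => R⁻¹ • x)
      (R⁻¹ • ContinuousLinearMap.id ℝ _) (R • x) := (hasFDerivAt_id (R • x)).const_smul R⁻¹
    have h3 := (h1.comp _ h2)
    have h4 : fderiv ℝ φ' (R • x) = _ := HasFDerivAt.fderiv h3
    rw [h4]
    ext y; simp
  have h0 := h φ' hφ' hcφ'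
  have h1 := Measure.integral_comp_smul (volume : Measure (EuclideanSpace ℝ (Fin N)))
    (fun x => ‖gradient u x‖ ^ (p - 2) * fderiv ℝ φ' x (gradient u x)) R
  rw [h0, smul_zero] at h1
  simp only [hg]
  have h2 : ∀ x, ‖(a * R) • gradient u (R • x)‖ ^ (p - 2) *
        fderiv ℝ φ x ((a * R) • gradient u (R • x)) = (|a * R| ^ (p - 2) * (a * R) * R) *
      (‖gradient u (R • x)‖ ^ (p - 2) * fderiv ℝ φ' (R • x) (gradient u (R • x))) := by
    intro x
    rw [hf, norm_smul, Real.mul_rpow (norm_nonneg _) (norm_nonneg _)]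
    simp only [map_smul, smul_eq_mul, _root_.smul_apply, Real.norm_eq_abs]
    field_simp
  simp only [h2]
  rw [integral_const_mul, h1, mul_zero]

lemma young {p a b δ : ℝ} (hp : 1 < p) (ha : 0 ≤ a) (hb : 0 ≤ b) (hδ : 0 < δ) :
    a ^ (p - 1) * b ≤ δ * a ^ p + δ ^ (1 - p) * b ^ p := by
  have hs : ∀ c : ℝ, 0 ≤ c → c ^ (p - 1) * c = c ^ p := by
    intro c hc
    rcases hc.eq_or_lt with rfl | hc
    · rw [mul_zero, Real.zero_rpow (by linarith)]
    · nth_rewrite 2 [← Real.rpow_one c]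
      rw [← Real.rpow_add hc]; congr 1; ring
  have h1 : 0 ≤ δ * a ^ p := by positivity
  have h2 : 0 ≤ δ ^ (1 - p) * b ^ p := by positivity
  rcases le_total b (δ * a) with h | h
  · calc a ^ (p - 1) * b ≤ a ^ (p - 1) * (δ * a) := by gcongr
      _ = δ * a ^ p := by rw [← hs a ha]; ring
      _ ≤ _ := by linarith
  · calc a ^ (p - 1) * b ≤ (b / δ) ^ (p - 1) * b := by
          gcongr
          rw [le_div_iff₀ hδ]; linarith
      _ = δ ^ (1 - p) * b ^ p := by
          rw [Real.div_rpow hb hδ.le, ← hs b hb, show (1 - p) = -(p - 1) by ring,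
            Real.rpow_neg hδ.le]; ring
      _ ≤ _ := by linarith

/-- Constant in the Caccioppoli inequality. -/
noncomputable def cC (p : ℝ) : ℝ := 2 * p / (p - 1) * ((p - 1) / (2 * p)) ^ (1 - p)

lemma cC_pos {p : ℝ} (hp : 1 < p) : 0 < cC p := by
  have : 0 < p - 1 := by linarith
  unfold cC; positivity

lemma cacc {p : ℝ} (hp : 1 < p) {w η : EuclideanSpace ℝ (Fin N) → ℝ}
    (hw : ContDiff ℝ 1 w) (hw1 : ∀ x, 1 ≤ w x) (hph : PH p (fun x => Real.exp (- w x)))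
    (hη : ContDiff ℝ 1 η) (hcη : HasCompactSupport η) (hη0 : ∀ x, 0 ≤ η x) {γ : ℝ} (hγ : 0 ≤ γ) :
    ∫ x, η x ^ p * ‖fderiv ℝ w x‖ ^ p * w x ^ γ ≤ cC p * ∫ x, ‖fderiv ℝ η x‖ ^ p * w x ^ γ := by
  have hp1 : 0 < p - 1 := by linarith
  have hwp : ∀ x, 0 < w x := fun x => by linarith [hw1 x]
  have hηp : ContDiff ℝ 1 (fun x => η x ^ p) := by
    have := hη.rpow_const_of_le (m := 1) (p := p) (by simpa using hp.le)
    simpa using this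
  have hwγ : ContDiff ℝ 1 (fun x => w x ^ γ) := hw.rpow_const_of_ne fun x => (hwp x).ne'
  let φ : EuclideanSpace ℝ (Fin N) → ℝ :=
    fun x => Real.exp ((p - 1) * w x) * w x ^ γ * η x ^ p
  have hφ : ContDiff ℝ 1 φ := ((Real.contDiff_exp.comp (contDiff_const.mul hw)).mul hwγ).mul hηp
  have hcηp : HasCompactSupport (fun x => η x ^ p) :=
    hcη.comp_left (g := fun t : ℝ => t ^ p) (Real.zero_rpow (by linarith))
  have hcφ : HasCompactSupport φ := hcηp.mul_left
  have h0 := hph φ hφ hcφ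
  have hdw : ∀ x, HasFDerivAt w (fderiv ℝ w x) x := fun x =>
    (hw.differentiable (by norm_num) x).hasFDerivAt
  have hdη : ∀ x, HasFDerivAt η (fderiv ℝ η x) x := fun x =>
    (hη.differentiable (by norm_num) x).hasFDerivAt
  have hg : ∀ x, gradient (fun x => Real.exp (- w x)) x = (- Real.exp (- w x)) • gradient w x := by
    intro x
    refine grad_of (hdw x).neg.exp fun y => ?_
    simp [inner_gradient_left, inner_smul_left]
  have hdφ : ∀ x y, fderiv ℝ φ x y = Real.exp ((p - 1) * w x) *
      ((p - 1) * w x ^ γ * η x ^ p * fderiv ℝ w x y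
        + γ * w x ^ (γ - 1) * η x ^ p * fderiv ℝ w x y
        + w x ^ γ * (p * η x ^ (p - 1)) * fderiv ℝ η x y) := by
    intro x y
    have h := (((hdw x).const_mul (p - 1)).exp.mul ((hdw x).rpow_const (p := γ)
      (Or.inl (hwp x).ne'))).mul ((hdη x).rpow_const (p := p) (Or.inr hp.le))
    have h' : fderiv ℝ φ x = _ := h.fderiv
    rw [h']
    simp
    ring
  have hgw : ∀ x, fderiv ℝ w x (gradient w x) = ‖fderiv ℝ w x‖ ^ 2 := by
    intro x
    rw [← inner_gradient_left, real_inner_self_eq_norm_sq, norm_grad]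
  have hpw : ∀ t : ℝ, 0 ≤ t → t ^ (p - 2) * t ^ 2 = t ^ p := by
    intro t ht
    rcases ht.eq_or_lt with rfl | ht
    · rw [Real.zero_rpow (by linarith : p ≠ 0)]; simp
    · rw [← Real.rpow_natCast, ← Real.rpow_add ht]; congr 1; push_cast; ring
  have hpw1 : ∀ t : ℝ, 0 ≤ t → t ^ (p - 2) * t = t ^ (p - 1) := by
    intro t ht
    rcases ht.eq_or_lt with rfl | ht
    · rw [Real.zero_rpow (by linarith : p - 1 ≠ 0)]; simp
    · nth_rewrite 2 [← Real.rpow_one t]; rw [← Real.rpow_add ht]; congr 1; ring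
  set δ : ℝ := (p - 1) / (2 * p) with hδ
  have hδ0 : 0 < δ := by positivity
  have hpt : ∀ x, ‖gradient (fun x => Real.exp (- w x)) x‖ ^ (p - 2) *
      fderiv ℝ φ x (gradient (fun x => Real.exp (- w x)) x) ≤
      (p * δ ^ (1 - p)) * (‖fderiv ℝ η x‖ ^ p * w x ^ γ)
        - ((p - 1) / 2) * (η x ^ p * ‖fderiv ℝ w x‖ ^ p * w x ^ γ) := by
    intro x
    rw [hg, norm_smul, map_smul, hdφ, hgw, norm_grad, norm_neg, Real.norm_eq_abs, Real.abs_exp,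
      Real.mul_rpow (Real.exp_pos _).le (norm_nonneg _), ← Real.exp_mul, smul_eq_mul]
    set D := ‖fderiv ℝ w x‖ with hD
    have hD0 : 0 ≤ D := norm_nonneg _
    set T := fderiv ℝ η x (gradient w x) with hT
    have hT' : - T ≤ ‖fderiv ℝ η x‖ * D := by
      have h := (fderiv ℝ η x).le_opNorm (gradient w x)
      rw [norm_grad, ← hT, Real.norm_eq_abs] at h
      exact (neg_le_abs _).trans h
    have he : Real.exp (- w x * (p - 2)) * Real.exp (- w x) * Real.exp ((p - 1) * w x) = 1 := by
      rw [← Real.exp_add, ← Real.exp_add, Real.exp_eq_one_iff]; ring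
    have e1 : Real.exp (-w x * (p - 2)) * D ^ (p - 2) * (-Real.exp (-w x) *
        (Real.exp ((p - 1) * w x) * ((p - 1) * w x ^ γ * η x ^ p * D ^ 2
        + γ * w x ^ (γ - 1) * η x ^ p * D ^ 2 + w x ^ γ * (p * η x ^ (p - 1)) * T))) =
      - ((p - 1) * w x ^ γ * η x ^ p * (D ^ (p - 2) * D ^ 2)
        + γ * w x ^ (γ - 1) * η x ^ p * (D ^ (p - 2) * D ^ 2)
        + w x ^ γ * (p * η x ^ (p - 1)) * D ^ (p - 2) * T) := by
      linear_combination (- ((p - 1) * w x ^ γ * η x ^ p * (D ^ (p - 2) * D ^ 2)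
        + γ * w x ^ (γ - 1) * η x ^ p * (D ^ (p - 2) * D ^ 2)
        + w x ^ γ * (p * η x ^ (p - 1)) * D ^ (p - 2) * T)) * he
    rw [e1, hpw D hD0]
    have hw0 := hwp x
    have hηx := hη0 x
    have i1 : 0 ≤ γ * w x ^ (γ - 1) * η x ^ p * D ^ p := by positivity
    have i2 : w x ^ γ * (p * η x ^ (p - 1)) * D ^ (p - 2) * (-T) ≤
        w x ^ γ * (p * η x ^ (p - 1)) * D ^ (p - 2) * (‖fderiv ℝ η x‖ * D) := by gcongr
    have i3 : w x ^ γ * (p * η x ^ (p - 1)) * D ^ (p - 2) * (‖fderiv ℝ η x‖ * D) =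
        p * w x ^ γ * ((η x * D) ^ (p - 1) * ‖fderiv ℝ η x‖) := by
      rw [Real.mul_rpow hηx hD0, ← hpw1 D hD0]; ring
    have i4 := young hp (mul_nonneg hηx hD0) (norm_nonneg (fderiv ℝ η x)) hδ0
    have i5 : p * w x ^ γ * ((η x * D) ^ (p - 1) * ‖fderiv ℝ η x‖) ≤ p * w x ^ γ *
      (δ * (η x * D) ^ p + δ ^ (1 - p) * ‖fderiv ℝ η x‖ ^ p) := by gcongr
    rw [Real.mul_rpow hηx hD0 (z := p)] at i5
    have i6 : p * δ = (p - 1) / 2 := by rw [hδ]; field_simp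
    have i7 : p * w x ^ γ *
      (δ * (η x ^ p * D ^ p) + δ ^ (1 - p) * ‖fderiv ℝ η x‖ ^ p) =
      (p - 1) / 2 * (η x ^ p * D ^ p * w x ^ γ) +
      p * δ ^ (1 - p) * (‖fderiv ℝ η x‖ ^ p * w x ^ γ) := by rw [← i6]; ring
    linarith
  have hcw : Continuous (fun x => ‖fderiv ℝ w x‖ ^ p) :=
    ((hw.continuous_fderiv (by norm_num)).norm).rpow_const fun _ => Or.inr (by linarith)
  have hcη' : Continuous (fun x => ‖fderiv ℝ η x‖ ^ p) :=
    ((hη.continuous_fderiv (by norm_num)).norm).rpow_const fun _ => Or.inr (by linarith)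
  have int1 : Integrable (fun x => η x ^ p * ‖fderiv ℝ w x‖ ^ p * w x ^ γ) :=
    ((hηp.continuous.mul hcw).mul hwγ.continuous).integrable_of_hasCompactSupport
      (hcηp.mul_right.mul_right)
  have int2 : Integrable (fun x => ‖fderiv ℝ η x‖ ^ p * w x ^ γ) := by
    refine (hcη'.mul hwγ.continuous).integrable_of_hasCompactSupport (HasCompactSupport.mul_right ?_)
    exact (hcη.fderiv (𝕜 := ℝ)).comp_left (g := fun L => ‖L‖ ^ p) (by
      simp [Real.zero_rpow (by linarith : p ≠ 0)])
  have int0 : Integrable (fun x => ‖gradient (fun x => Real.exp (- w x)) x‖ ^ (p - 2) *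
      fderiv ℝ φ x (gradient (fun x => Real.exp (- w x)) x)) := by
    have hv : ContDiff ℝ 1 (fun x => Real.exp (- w x)) := Real.contDiff_exp.comp hw.neg
    have : (fun x => ‖gradient (fun x => Real.exp (- w x)) x‖ ^ (p - 2) *
      fderiv ℝ φ x (gradient (fun x => Real.exp (- w x)) x)) = fun x => fderiv ℝ φ x
        (‖gradient (fun x => Real.exp (- w x)) x‖ ^ (p - 2) •
          gradient (fun x => Real.exp (- w x)) x) := by
      ext x; simp
    rw [this]
    refine Continuous.integrable_of_hasCompactSupport ?_ ?_
    · exact (hφ.continuous_fderiv (by norm_num)).clm_apply ((cont_A hp).comp (cont_grad hv))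
    · refine (hcφ.fderiv (𝕜 := ℝ)).mono ?_
      intro x hx h
      apply hx
      simp only [h]; rfl
  have hI := integral_mono int0 ((int2.const_mul (p * δ ^ (1 - p))).sub
    (int1.const_mul ((p - 1) / 2))) hpt
  simp only [Pi.sub_apply] at hI
  rw [h0, integral_sub (int2.const_mul _) (int1.const_mul _), integral_const_mul,
    integral_const_mul] at hI
  have : cC p = 2 / (p - 1) * (p * δ ^ (1 - p)) := by unfold cC; rw [hδ]; ring
  rw [this]
  have e2 : ∫ x, η x ^ p * ‖fderiv ℝ w x‖ ^ p * w x ^ γ =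
    2 / (p - 1) * ((p - 1) / 2 * ∫ x, η x ^ p * ‖fderiv ℝ w x‖ ^ p * w x ^ γ) := by
    field_simp
  rw [e2, mul_assoc]
  exact mul_le_mul_of_nonneg_left (by linarith) (by positivity)

lemma cutoff : ∃ K : ℝ, 1 ≤ K ∧ ∀ r R : ℝ, 0 < r → r < R →
    ∃ η : EuclideanSpace ℝ (Fin N) → ℝ, ContDiff ℝ 1 η ∧ HasCompactSupport η ∧
      (∀ x, 0 ≤ η x) ∧ (∀ x, η x ≤ 1) ∧ (∀ x ∈ closedBall 0 r, η x = 1) ∧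
      (∀ x, x ∉ closedBall (0 : EuclideanSpace ℝ (Fin N)) R → η x = 0) ∧
      (∀ x, x ∉ closedBall (0 : EuclideanSpace ℝ (Fin N)) R → fderiv ℝ η x = 0) ∧
      ∀ x, ‖fderiv ℝ η x‖ ≤ K / (R - r) := by
  let h := Real.smoothTransition
  have hsm : ContDiff ℝ 1 h := Real.smoothTransition.contDiff (n := 1)
  have hdc : Continuous (deriv h) := hsm.continuous_deriv (by norm_num)
  obtain ⟨K0, hK0⟩ := (isCompact_Icc (a := (0 : ℝ)) (b := 1)).exists_bound_of_continuousOn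
    hdc.continuousOn
  have hK0' : 0 ≤ K0 := (norm_nonneg _).trans (hK0 0 (by simp))
  have hK : ∀ t, 0 ≤ t → ‖deriv h t‖ ≤ K0 := by
    intro t ht
    rcases le_or_gt t 1 with h1 | h1
    · exact hK0 t ⟨ht, h1⟩
    · have : h =ᶠ[nhds t] fun _ => 1 := by
        filter_upwards [lt_mem_nhds h1] with s hs
        exact Real.smoothTransition.one_of_one_le hs.le
      rw [this.deriv_eq]; simpa using hK0'
  refine ⟨2 * K0 + 1, by linarith, fun r R hr hrR => ?_⟩
  have hR : 0 < R := hr.trans hrR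
  have hd : 0 < R ^ 2 - r ^ 2 := by nlinarith
  let q : EuclideanSpace ℝ (Fin N) → ℝ := fun x => (R ^ 2 - ‖x‖ ^ 2) / (R ^ 2 - r ^ 2)
  have hq : ContDiff ℝ 1 q := (contDiff_const.sub (contDiff_norm_sq ℝ)).div_const _
  have hz : ∀ x, x ∉ closedBall (0 : EuclideanSpace ℝ (Fin N)) R → h (q x) = 0 := by
    intro x hx
    simp at hx
    apply Real.smoothTransition.zero_of_nonpos
    apply div_nonpos_of_nonpos_of_nonneg _ hd.le
    nlinarith
  have hcs : HasCompactSupport (fun x => h (q x)) :=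
    HasCompactSupport.intro (isCompact_closedBall 0 R) hz
  have hz' : ∀ x, x ∉ closedBall (0 : EuclideanSpace ℝ (Fin N)) R →
      fderiv ℝ (fun x => h (q x)) x = 0 := by
    intro x hx
    have : (fun x => h (q x)) =ᶠ[nhds x] fun _ => 0 := by
      filter_upwards [isClosed_closedBall.isOpen_compl.mem_nhds hx] with y hy
      exact hz y hy
    rw [this.fderiv_eq]; simp
  refine ⟨fun x => h (q x), hsm.comp hq, hcs, fun x => Real.smoothTransition.nonneg _,
    fun x => Real.smoothTransition.le_one _, ?_, hz, hz', ?_⟩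
  · intro x hx
    simp at hx
    apply Real.smoothTransition.one_of_one_le
    rw [one_le_div hd]
    nlinarith [norm_nonneg x]
  · intro x
    by_cases hx : x ∈ closedBall (0 : EuclideanSpace ℝ (Fin N)) R
    · simp at hx
      have hqx : 0 ≤ q x := div_nonneg (by nlinarith [norm_nonneg x]) hd.le
      have h1 : HasFDerivAt q ((R ^ 2 - r ^ 2)⁻¹ •
          (-(2 • innerSL ℝ x) : EuclideanSpace ℝ (Fin N) →L[ℝ] ℝ)) x := by
        have := ((hasStrictFDerivAt_norm_sq x).hasFDerivAt.const_sub (R ^ 2)).mul_const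
          (R ^ 2 - r ^ 2)⁻¹
        exact this
      have h2 : HasFDerivAt (fun x => h (q x)) (deriv h (q x) • ((R ^ 2 - r ^ 2)⁻¹ •
          (-(2 • innerSL ℝ x) : EuclideanSpace ℝ (Fin N) →L[ℝ] ℝ))) x :=
        ((hsm.differentiable (by norm_num) (q x)).hasDerivAt).comp_hasFDerivAt x h1
      rw [h2.fderiv, norm_smul, norm_smul, norm_neg]
      have h3 : ‖(2 • innerSL ℝ x : EuclideanSpace ℝ (Fin N) →L[ℝ] ℝ)‖ ≤ 2 * R := by
        refine (norm_nsmul_le).trans ?_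
        rw [innerSL_apply_norm]
        push_cast
        linarith
      rw [Real.norm_of_nonneg (inv_nonneg.2 hd.le)]
      calc ‖deriv h (q x)‖ * ((R ^ 2 - r ^ 2)⁻¹ * _) ≤ K0 * ((R ^ 2 - r ^ 2)⁻¹ * (2 * R)) := by
            gcongr
            exact hK _ hqx
        _ = K0 * (2 * R) / ((R - r) * (R + r)) := by
            rw [show R ^ 2 - r ^ 2 = (R - r) * (R + r) by ring]; field_simp
        _ ≤ (2 * K0 + 1) / (R - r) := by
            have : 0 < R - r := by linarith
            rw [div_le_div_iff₀ (by positivity) this]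
            have : K0 * (2 * R) ≤ (2 * K0 + 1) * (R + r) := by nlinarith
            nlinarith
    · rw [hz' x hx, norm_zero]
      have : 0 < R - r := by linarith
      positivity

/-- The logarithmic transform of a positive p-harmonic function bounded by `1/e`. -/
def Good (p : ℝ) (w : EuclideanSpace ℝ (Fin N) → ℝ) : Prop :=
  ContDiff ℝ 1 w ∧ (∀ x, 1 ≤ w x) ∧ PH p (fun x => Real.exp (- w x))

lemma sob_real {κ : ℝ} (hκ : Real.HolderConjugate (N : ℝ) κ) :
    ∃ S : ℝ, 0 ≤ S ∧ ∀ F : EuclideanSpace ℝ (Fin N) → ℝ, ContDiff ℝ 1 F → HasCompactSupport F →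
      ∫ x, ‖F x‖ ^ κ ≤ S * (∫ x, ‖fderiv ℝ F x‖) ^ κ := by
  have hκ0 : 0 < κ := hκ.symm.pos
  refine ⟨lintegralPowLePowLIntegralFDerivConst
    (volume : Measure (EuclideanSpace ℝ (Fin N))) κ, NNReal.coe_nonneg _, fun F hF hcF => ?_⟩
  have h := lintegral_pow_le_pow_lintegral_fderiv
    (volume : Measure (EuclideanSpace ℝ (Fin N))) hF hcF (p := κ) (by simpa using hκ)
  have hi : Integrable (fderiv ℝ F) :=
    (hF.continuous_fderiv (by norm_num)).integrable_of_hasCompactSupport (hcF.fderiv (𝕜 := ℝ))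
  rw [← ofReal_integral_norm_eq_lintegral_enorm hi] at h
  have h1 : ∫⁻ x, ‖F x‖ₑ ^ κ = ENNReal.ofReal (∫ x, ‖F x‖ ^ κ) := by
    rw [ofReal_integral_eq_lintegral_ofReal]
    · congr 1; ext x
      rw [← ENNReal.ofReal_rpow_of_nonneg (norm_nonneg _) hκ0.le, ofReal_norm_eq_enorm]
    · refine Continuous.integrable_of_hasCompactSupport
        (hF.continuous.norm.rpow_const fun _ => Or.inr hκ0.le) ?_
      exact hcF.comp_left (g := fun t => ‖t‖ ^ κ) (by simp [Real.zero_rpow hκ0.ne'])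
    · exact Filter.Eventually.of_forall fun x => by positivity
  have hnn : 0 ≤ ∫ x, ‖fderiv ℝ F x‖ := integral_nonneg fun x => norm_nonneg _
  rw [h1, ENNReal.ofReal_rpow_of_nonneg hnn hκ0.le, ← ENNReal.ofReal_coe_nnreal,
    ← ENNReal.ofReal_mul (NNReal.coe_nonneg _)] at h
  exact (ENNReal.ofReal_le_ofReal_iff (by positivity)).1 h

lemma sob_step {p κ : ℝ} (hp : 1 < p) (hκ : Real.HolderConjugate (N : ℝ) κ) :
    ∃ C : ℝ, 1 ≤ C ∧ ∀ w : EuclideanSpace ℝ (Fin N) → ℝ, Good p w → ∀ s r R : ℝ, 1 ≤ s → 0 < r →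
      r < R → R - r ≤ 1 →
      ∫ x in closedBall 0 r, w x ^ (s * κ) ≤
        (C * (s * (1 / (R - r)) ^ p * ∫ x in closedBall 0 R, w x ^ s)) ^ κ := by
  have hκ0 : 0 < κ := hκ.symm.pos
  have hκ1 : 1 < κ := hκ.symm.lt
  obtain ⟨S, hS, hsob⟩ := sob_real hκ
  obtain ⟨K, hK, hcut⟩ := cutoff (N := N)
  have hcC := cC_pos hp
  refine ⟨(S + 1) * ((p + 1 + cC p) * K ^ p), ?_, ?_⟩
  · have : 1 ≤ K ^ p := Real.one_le_rpow hK (by linarith)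
    have h2 : 1 ≤ (p + 1 + cC p) * K ^ p := by nlinarith
    nlinarith
  intro w ⟨hw, hw1, hph⟩ s r R hs hr hrR hR1
  obtain ⟨η, hη, hcη, hη0, hη1, hηr, hηR, hηR', hηK⟩ := hcut r R hr hrR
  have hd : 0 < R - r := by linarith
  have hwp : ∀ x, 0 < w x := fun x => by linarith [hw1 x]
  have hp0 : 0 < p := by linarith
  set Λ := K / (R - r) with hΛ
  have hΛ1 : 1 ≤ Λ := by rw [hΛ, one_le_div hd]; linarith
  have hΛp : Λ ≤ Λ ^ p := by
    nth_rewrite 1 [← Real.rpow_one Λ]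
    exact Real.rpow_le_rpow_of_exponent_le hΛ1 hp.le
  have hΛp' : Λ ^ p = K ^ p * (1 / (R - r)) ^ p := by
    rw [← Real.mul_rpow (by linarith) (by positivity)]; congr 1; rw [hΛ]; ring
  have hηp : ContDiff ℝ 1 (fun x => η x ^ p) := by
    have := hη.rpow_const_of_le (m := 1) (p := p) (by simpa using hp.le)
    simpa using this
  have hws : ContDiff ℝ 1 (fun x => w x ^ s) := hw.rpow_const_of_ne fun x => (hwp x).ne'
  have hcηp : HasCompactSupport (fun x => η x ^ p) :=
    hcη.comp_left (g := fun t : ℝ => t ^ p) (Real.zero_rpow (by linarith))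
  let F : EuclideanSpace ℝ (Fin N) → ℝ := fun x => η x ^ p * w x ^ s
  have hF : ContDiff ℝ 1 F := hηp.mul hws
  have hcF : HasCompactSupport F := hcηp.mul_right
  set J := ∫ x in closedBall (0 : EuclideanSpace ℝ (Fin N)) R, w x ^ s with hJ
  have hJ0 : 0 ≤ J := integral_nonneg fun x => by have := hwp x; positivity
  have hwint : IntegrableOn (fun x => w x ^ s) (closedBall 0 R) :=
    hws.continuous.continuousOn.integrableOn_compact (isCompact_closedBall _ _)
  have hcw : Continuous (fun x => ‖fderiv ℝ w x‖ ^ p) :=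
    ((hw.continuous_fderiv (by norm_num)).norm).rpow_const fun _ => Or.inr (by linarith)
  have int1 : Integrable (fun x => η x ^ p * ‖fderiv ℝ w x‖ ^ p * w x ^ s) :=
    ((hηp.continuous.mul hcw).mul hws.continuous).integrable_of_hasCompactSupport
      (hcηp.mul_right.mul_right)
  have int2 : Integrable ((closedBall 0 R).indicator (fun x => w x ^ s)) :=
    (integrable_indicator_iff measurableSet_closedBall).2 hwint
  have hJi : ∫ x, (closedBall 0 R).indicator (fun x => w x ^ s) x = J :=
    integral_indicator measurableSet_closedBall
  have hcacc := cacc hp hw hw1 hph hη hcη hη0 (γ := s) (by linarith)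
  have hb1 : ∫ x, ‖fderiv ℝ η x‖ ^ p * w x ^ s ≤ Λ ^ p * J := by
    rw [← hJi, ← integral_const_mul]
    refine integral_mono_of_nonneg (Filter.Eventually.of_forall fun x => ?_)
      (int2.const_mul _) (Filter.Eventually.of_forall fun x => ?_)
    · have := hwp x
      show 0 ≤ ‖fderiv ℝ η x‖ ^ p * w x ^ s
      positivity
    · by_cases hx : x ∈ closedBall (0 : EuclideanSpace ℝ (Fin N)) R
      · simp only [Set.indicator_of_mem hx]
        have := hwp x
        gcongr
        exact hηK x
      · simp [Set.indicator_of_notMem hx, hηR' x hx, Real.zero_rpow hp0.ne']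
  have hb2 : ∫ x, ‖fderiv ℝ F x‖ ≤ s * ((p * Λ + 1) * J + cC p * (Λ ^ p * J)) := by
    have hmono : ∫ x, ‖fderiv ℝ F x‖ ≤ ∫ x, s * ((p * Λ + 1) *
        (closedBall 0 R).indicator (fun x => w x ^ s) x
        + η x ^ p * ‖fderiv ℝ w x‖ ^ p * w x ^ s) := by
      refine integral_mono_of_nonneg (Filter.Eventually.of_forall fun x => norm_nonneg _)
        (((int2.const_mul _).add int1).const_mul s) (Filter.Eventually.of_forall fun x => ?_)
      have h1 := ((hη.differentiable (by norm_num) x).hasFDerivAt.rpow_const (p := p)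
        (Or.inr hp.le)).mul ((hw.differentiable (by norm_num) x).hasFDerivAt.rpow_const (p := s)
        (Or.inl (hwp x).ne'))
      have h2 : fderiv ℝ F x = _ := h1.fderiv
      simp only
      have hwx := hwp x
      have hηx := hη0 x
      by_cases hx : x ∈ closedBall (0 : EuclideanSpace ℝ (Fin N)) R
      · rw [Set.indicator_of_mem hx, h2]
        refine (norm_add_le _ _).trans ?_
        rw [norm_smul, norm_smul, norm_smul, norm_smul, Real.norm_of_nonneg (by positivity),
          Real.norm_of_nonneg (by positivity), Real.norm_of_nonneg (by positivity),
          Real.norm_of_nonneg (by positivity)]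
        have a1 : η x ^ (p - 1) ≤ 1 := Real.rpow_le_one hηx (hη1 x) (by linarith)
        have a2 : η x ^ p ≤ 1 := Real.rpow_le_one hηx (hη1 x) (by linarith)
        have a3 : w x ^ (s - 1) ≤ w x ^ s :=
          Real.rpow_le_rpow_of_exponent_le (hw1 x) (by linarith)
        have a4 : ‖fderiv ℝ w x‖ ≤ 1 + ‖fderiv ℝ w x‖ ^ p := by
          rcases le_total ‖fderiv ℝ w x‖ 1 with h | h
          · have : 0 ≤ ‖fderiv ℝ w x‖ ^ p := by positivity
            linarith
          · have := Real.rpow_le_rpow_of_exponent_le h hp.le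
            rw [Real.rpow_one] at this
            linarith
        calc η x ^ p * (s * w x ^ (s - 1) * ‖fderiv ℝ w x‖) +
              w x ^ s * (p * η x ^ (p - 1) * ‖fderiv ℝ η x‖)
            ≤ η x ^ p * (s * w x ^ s * (1 + ‖fderiv ℝ w x‖ ^ p)) +
              w x ^ s * (p * 1 * Λ) := by
              gcongr
              exact hηK x
          _ = s * w x ^ s * η x ^ p + s * (η x ^ p * ‖fderiv ℝ w x‖ ^ p * w x ^ s) +
              1 * (w x ^ s * (p * 1 * Λ)) := by ring
          _ ≤ s * w x ^ s * 1 + s * (η x ^ p * ‖fderiv ℝ w x‖ ^ p * w x ^ s) +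
              s * (w x ^ s * (p * 1 * Λ)) := by gcongr
          _ = _ := by ring
      · rw [Set.indicator_of_notMem hx, h2, hηR x hx, hηR' x hx]
        simp [Real.zero_rpow hp0.ne']
    refine hmono.trans ?_
    rw [integral_const_mul, integral_add (int2.const_mul _) int1, integral_const_mul, hJi]
    gcongr
    refine hcacc.trans ?_
    gcongr
  have hb3 : ∫ x, ‖fderiv ℝ F x‖ ≤ ((p + 1 + cC p) * K ^ p) * (s * (1 / (R - r)) ^ p * J) := by
    refine hb2.trans ?_
    calc s * ((p * Λ + 1) * J + cC p * (Λ ^ p * J)) ≤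
        s * ((p * Λ ^ p + Λ ^ p) * J + cC p * (Λ ^ p * J)) := by
          gcongr
          linarith
      _ = _ := by rw [hΛp']; ring
  have hnn : 0 ≤ ∫ x, ‖fderiv ℝ F x‖ := integral_nonneg fun x => norm_nonneg _
  have hb4 : ∫ x in closedBall 0 r, w x ^ (s * κ) ≤ ∫ x, ‖F x‖ ^ κ := by
    have e : ∫ x in closedBall 0 r, w x ^ (s * κ) =
        ∫ x in closedBall (0 : EuclideanSpace ℝ (Fin N)) r, ‖F x‖ ^ κ := by
      refine setIntegral_congr_fun measurableSet_closedBall fun x hx => ?_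
      have := hwp x
      simp only [F, hηr x hx, Real.one_rpow, one_mul]
      rw [Real.norm_of_nonneg (by positivity), ← Real.rpow_mul this.le]
    rw [e]
    refine setIntegral_le_integral ?_ (Filter.Eventually.of_forall fun x => by positivity)
    refine Continuous.integrable_of_hasCompactSupport
        (hF.continuous.norm.rpow_const fun _ => Or.inr hκ0.le) ?_
    exact hcF.comp_left (g := fun t => ‖t‖ ^ κ) (by simp [Real.zero_rpow hκ0.ne'])
  refine hb4.trans ((hsob F hF hcF).trans ?_)
  have hSκ : S ≤ (S + 1) ^ κ := by
    have := Real.rpow_le_rpow_of_exponent_le (show (1 : ℝ) ≤ S + 1 by linarith) hκ1.le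
    rw [Real.rpow_one] at this
    linarith
  rw [mul_assoc (S + 1), Real.mul_rpow (by linarith) (by positivity)]
  gcongr

lemma seq_iter {κ C0 C1 b : ℝ} (hκ : 1 < κ) (hC1 : 1 ≤ C1) (hb : 1 ≤ b) :
    ∃ L : ℝ, 1 ≤ L ∧ ∀ I : ℕ → ℝ, (∀ k, 0 ≤ I k) → I 0 ≤ C0 →
      (∀ k, I (k + 1) ≤ (C1 * (b ^ k * I k)) ^ κ) → ∀ k, I k ≤ L ^ (κ ^ k) := by
  have hκ1 : 0 < κ - 1 := by linarith
  have hC10 : 0 < C1 := by linarith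
  have hb0 : 0 < b := by linarith
  set c : ℝ := κ / (κ - 1) with hc
  have hc0 : 0 < c := by positivity
  have hcκ : (1 - c) * κ = -c := by rw [hc]; field_simp; ring
  set X : ℝ := C1 ^ κ * b ^ c with hX
  have hX1 : 1 ≤ X := one_le_mul_of_one_le_of_one_le (Real.one_le_rpow hC1 (by linarith))
    (Real.one_le_rpow hb hc0.le)
  have hX0 : 0 < X := by linarith
  set θ : ℝ := X ^ (-(1 / (κ - 1))) with hθ
  have hθ0 : 0 < θ := by positivity
  have hθ1 : θ ≤ 1 := Real.rpow_le_one_of_one_le_of_nonpos hX1 (by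
    have : 0 < 1 / (κ - 1) := by positivity
    linarith)
  have hθX : θ ^ (κ - 1) = X⁻¹ := by
    rw [hθ, ← Real.rpow_mul hX0.le, show -(1 / (κ - 1)) * (κ - 1) = -1 by field_simp,
      Real.rpow_neg_one]
  have hkey : (C1 * θ) ^ κ = θ * b ^ (-c) := by
    have h1 : θ ^ κ = θ ^ (κ - 1) * θ := by
      nth_rewrite 3 [← Real.rpow_one θ]
      rw [← Real.rpow_add hθ0]; congr 1; ring
    rw [Real.mul_rpow hC10.le hθ0.le, h1, hθX, hX, Real.rpow_neg hb0.le]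
    field_simp
  refine ⟨max C0 1 / θ, ?_, fun I hI h0 hstep => ?_⟩
  · rw [one_le_div hθ0]; exact hθ1.trans (le_max_right _ _)
  set L := max C0 1 / θ with hL
  have hL0 : 0 < L := by have : 0 < max C0 1 := lt_max_of_lt_right one_pos
                         positivity
  have main : ∀ k, I k ≤ L ^ (κ ^ k) * θ * b ^ (-(c * k)) := by
    intro k
    induction k with
    | zero =>
      simp only [pow_zero, Real.rpow_one, Nat.cast_zero, mul_zero, neg_zero, Real.rpow_zero, mul_one]
      rw [hL, div_mul_cancel₀ _ hθ0.ne']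
      exact h0.trans (le_max_left _ _)
    | succ k ih =>
      refine (hstep k).trans ?_
      have e0 : b ^ k * b ^ (-(c * k)) = b ^ ((1 - c) * k) := by
        rw [← Real.rpow_natCast, ← Real.rpow_add hb0]; congr 1; ring
      have e1 : C1 * (b ^ k * (L ^ (κ ^ k) * θ * b ^ (-(c * k)))) =
          L ^ (κ ^ k) * (C1 * θ) * b ^ ((1 - c) * k) := by rw [← e0]; ring
      have hIk := hI k
      calc (C1 * (b ^ k * I k)) ^ κ ≤ (C1 * (b ^ k * (L ^ (κ ^ k) * θ * b ^ (-(c * k))))) ^ κ := by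
            gcongr
        _ = L ^ (κ ^ (k + 1)) * ((C1 * θ) ^ κ) * b ^ (-(c * k)) := by
            rw [e1, Real.mul_rpow (by positivity) (by positivity),
              Real.mul_rpow (by positivity) (by positivity), ← Real.rpow_mul hL0.le,
              ← Real.rpow_mul hb0.le, ← pow_succ]
            congr 2
            rw [mul_right_comm, hcκ]; ring
        _ = _ := by
            rw [hkey, mul_assoc, mul_assoc, mul_assoc, ← Real.rpow_add hb0]
            congr 3
            push_cast; ring
  intro k
  refine (main k).trans ?_
  have : b ^ (-(c * k)) ≤ 1 := Real.rpow_le_one_of_one_le_of_nonpos hb (by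
    have : 0 ≤ c * k := by positivity
    linarith)
  calc L ^ (κ ^ k) * θ * b ^ (-(c * k)) ≤ L ^ (κ ^ k) * 1 * 1 := by gcongr
    _ = _ := by ring

lemma moser {p : ℝ} (hp : 1 < p) (hN : 2 ≤ N) (C0 : ℝ) :
    ∃ L : ℝ, ∀ w : EuclideanSpace ℝ (Fin N) → ℝ, Good p w →
      ∫ x in closedBall 0 1, w x ≤ C0 → ∀ x ∈ ball (0 : EuclideanSpace ℝ (Fin N)) (1 / 2),
        w x ≤ L := by
  have hN' : (2 : ℝ) ≤ N := by exact_mod_cast hN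
  set κ : ℝ := Real.conjExponent N with hκd
  have hκ : Real.HolderConjugate (N : ℝ) κ := Real.HolderConjugate.conjExponent (by linarith)
  have hκ1 : 1 < κ := hκ.symm.lt
  have hκ2 : κ ≤ 2 := by
    rw [hκd, Real.conjExponent, div_le_iff₀ (by linarith)]; linarith
  obtain ⟨C, hC, hstep⟩ := sob_step hp hκ
  have h4p : (1 : ℝ) ≤ 4 ^ p := Real.one_le_rpow (by norm_num) (by linarith)
  have h2p : (1 : ℝ) ≤ 2 ^ p := Real.one_le_rpow (by norm_num) (by linarith)
  obtain ⟨L, hL1, hL⟩ := seq_iter (κ := κ) (C0 := C0) (C1 := C * 4 ^ p) (b := 2 * 2 ^ p) hκ1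
    (one_le_mul_of_one_le_of_one_le hC h4p) (by linarith)
  refine ⟨L, fun w hgood h0 x0 hx0 => ?_⟩
  have hwp : ∀ x, 0 < w x := fun x => by linarith [hgood.2.1 x]
  have hwc : Continuous w := hgood.1.continuous
  let r : ℕ → ℝ := fun k => 1 / 2 + (1 / 2) ^ (k + 1)
  have hr : ∀ k, 1 / 2 ≤ r k := fun k => by
    have : (0 : ℝ) < (1 / 2) ^ (k + 1) := by positivity
    simp only [r]; linarith
  have hrd : ∀ k, r k - r (k + 1) = (1 / 2) ^ (k + 2) := fun k => by simp only [r]; ring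
  let I : ℕ → ℝ := fun k => ∫ x in closedBall 0 (r k), w x ^ (κ ^ k)
  have hI0 : ∀ k, 0 ≤ I k := fun k => integral_nonneg fun x => by have := hwp x; positivity
  have hIL := hL I hI0 (by simp only [I, r]; norm_num; exact h0) (by
    intro k
    have hd : 0 < r k - r (k + 1) := by rw [hrd]; positivity
    have h1 := hstep w hgood (κ ^ k) (r (k + 1)) (r k) (one_le_pow₀ hκ1.le)
      (by linarith [hr (k + 1)]) (by linarith) (by
        rw [hrd]; exact pow_le_one₀ (by norm_num) (by norm_num))
    have e1 : I (k + 1) = ∫ x in closedBall 0 (r (k + 1)), w x ^ (κ ^ k * κ) := by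
      simp only [I, pow_succ]
    rw [e1]
    refine h1.trans ?_
    have e2 : (1 / (r k - r (k + 1))) ^ p = 4 ^ p * (2 ^ p) ^ k := by
      rw [hrd, one_div, ← inv_pow, pow_add, Real.mul_rpow (by positivity) (by positivity), mul_comm]
      norm_num
      rw [← Real.rpow_natCast, ← Real.rpow_natCast, ← Real.rpow_mul (by norm_num),
        ← Real.rpow_mul (by norm_num), mul_comm]
      exact Or.inl rfl
    have hIk := hI0 k
    refine Real.rpow_le_rpow ?_ ?_ (by linarith)
    · have : 0 ≤ ∫ x in closedBall (0 : EuclideanSpace ℝ (Fin N)) (r k), w x ^ (κ ^ k) := hIk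
      positivity
    · rw [e2]
      change C * (κ ^ k * (4 ^ p * (2 ^ p) ^ k) * I k) ≤ _
      calc C * (κ ^ k * (4 ^ p * (2 ^ p) ^ k) * I k) ≤ C * (2 ^ k * (4 ^ p * (2 ^ p) ^ k) * I k) := by
            gcongr
        _ = _ := by rw [mul_pow]; ring)
  by_contra hcon
  push Not at hcon
  obtain ⟨L', hLL', hL'w⟩ := exists_between hcon
  have hL0 : 0 < L := by linarith
  set U : Set (EuclideanSpace ℝ (Fin N)) := ball 0 (1 / 2) ∩ {x | L' < w x} with hU
  have hUo : IsOpen U := isOpen_ball.inter (isOpen_lt continuous_const hwc)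
  have hUpos : 0 < volume U := hUo.measure_pos volume ⟨x0, hx0, hL'w⟩
  have hUfin : volume U ≠ ⊤ :=
    ((measure_mono Set.inter_subset_left).trans_lt measure_ball_lt_top).ne
  set m := volume.real U with hm
  have hm0 : 0 < m := ENNReal.toReal_pos hUpos.ne' hUfin
  have hmk : ∀ k, m * L' ^ (κ ^ k) ≤ L ^ (κ ^ k) := by
    intro k
    refine le_trans ?_ (hIL k)
    have hcont : Continuous (fun x => w x ^ (κ ^ k)) :=
      hwc.rpow_const fun x => Or.inl (hwp x).ne'
    have hIntg : IntegrableOn (fun x => w x ^ (κ ^ k)) (closedBall 0 (r k)) :=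
      hcont.continuousOn.integrableOn_compact (isCompact_closedBall _ _)
    have hsub : U ⊆ closedBall 0 (r k) := fun x hx =>
      ball_subset_closedBall (ball_subset_ball (hr k) hx.1)
    calc m * L' ^ (κ ^ k) = ∫ x in U, L' ^ (κ ^ k) := by
          rw [setIntegral_const, smul_eq_mul]
      _ ≤ ∫ x in U, w x ^ (κ ^ k) := by
          refine setIntegral_mono_on (integrableOn_const hUfin) (hIntg.mono_set hsub)
            hUo.measurableSet fun x hx => ?_
          exact Real.rpow_le_rpow (by linarith) (le_of_lt hx.2) (by positivity)
      _ ≤ I k := setIntegral_mono_set hIntg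
          (Filter.Eventually.of_forall fun x => by
            have := hwp x
            show 0 ≤ w x ^ (κ ^ k)
            positivity) hsub.eventuallyLE
  have hq : 1 < L' / L := by rwa [one_lt_div hL0]
  have hmk' : ∀ k, (L' / L) ^ (κ ^ k) ≤ 1 / m := by
    intro k
    rw [Real.div_rpow (by linarith) hL0.le, div_le_div_iff₀ (by positivity) hm0]
    linarith [hmk k]
  have ht : Filter.Tendsto (fun k : ℕ => (L' / L) ^ (κ ^ k)) Filter.atTop Filter.atTop :=
    (tendsto_rpow_atTop_of_base_gt_one _ hq).comp (tendsto_pow_atTop_atTop_of_one_lt hκ1)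
  obtain ⟨k, hk⟩ := (ht.eventually_gt_atTop (1 / m)).exists
  exact absurd (hmk' k) (not_le.2 hk)

lemma ftc_le {w : EuclideanSpace ℝ (Fin N) → ℝ} (hw : ContDiff ℝ 1 w)
    (x h : EuclideanSpace ℝ (Fin N)) :
    ‖w (x + h) - w x‖ₑ ≤ ∫⁻ t in Set.Ioc (0 : ℝ) 1, ‖fderiv ℝ w (x + t • h)‖ₑ * ‖h‖ₑ := by
  have hd : ∀ t : ℝ, HasDerivAt (fun t : ℝ => w (x + t • h)) (fderiv ℝ w (x + t • h) h) t := by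
    intro t
    have h1 : HasDerivAt (fun t : ℝ => x + t • h) h t := by
      simpa using ((hasDerivAt_id t).smul_const h).const_add x
    exact ((hw.differentiable one_ne_zero _).hasFDerivAt).comp_hasDerivAt t h1
  have hc : Continuous (fun t : ℝ => fderiv ℝ w (x + t • h) h) := by
    have := hw.continuous_fderiv one_ne_zero
    fun_prop
  have hi := intervalIntegral.integral_eq_sub_of_hasDerivAt (a := 0) (b := 1)
    (fun t _ => hd t) (hc.intervalIntegrable _ _)
  simp only [one_smul, zero_smul, add_zero] at hi
  rw [← hi, intervalIntegral.integral_of_le zero_le_one]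
  refine (enorm_integral_le_lintegral_enorm _).trans (lintegral_mono fun t => ?_)
  exact ContinuousLinearMap.le_opENorm _ _

lemma shift_le {w : EuclideanSpace ℝ (Fin N) → ℝ} (hw : ContDiff ℝ 1 w)
    (h : EuclideanSpace ℝ (Fin N)) (hh : ‖h‖ ≤ 2) :
    ∫⁻ x in closedBall 0 1, ‖w (x + h) - w x‖ₑ ≤
      2 * ∫⁻ x in closedBall 0 3, ‖fderiv ℝ w x‖ₑ := by
  have hcf := hw.continuous_fderiv one_ne_zero
  have hhe : ‖h‖ₑ ≤ 2 := by
    rw [← ofReal_norm]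
    exact ENNReal.ofReal_le_of_le_toReal (by simpa using hh)
  calc ∫⁻ x in closedBall 0 1, ‖w (x + h) - w x‖ₑ
      ≤ ∫⁻ x in closedBall 0 1, ∫⁻ t in Set.Ioc (0 : ℝ) 1,
          ‖fderiv ℝ w (x + t • h)‖ₑ * ‖h‖ₑ := lintegral_mono fun x => ftc_le hw x h
    _ = ∫⁻ t in Set.Ioc (0 : ℝ) 1, ∫⁻ x in closedBall 0 1,
          ‖fderiv ℝ w (x + t • h)‖ₑ * ‖h‖ₑ := by
        rw [lintegral_lintegral_swap]
        refine Measurable.aemeasurable ?_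
        refine Measurable.mul_const ?_ _
        refine Continuous.measurable ?_
        fun_prop
    _ ≤ ∫⁻ t in Set.Ioc (0 : ℝ) 1, 2 * ∫⁻ x in closedBall 0 3, ‖fderiv ℝ w x‖ₑ := by
        refine setLIntegral_mono measurable_const fun t ht => ?_
        rw [lintegral_mul_const _ (by fun_prop), mul_comm]
        refine mul_le_mul' hhe ?_
        rw [← lintegral_indicator measurableSet_closedBall,
          ← lintegral_indicator measurableSet_closedBall,
          ← lintegral_add_right_eq_self
            ((closedBall (0 : EuclideanSpace ℝ (Fin N)) 3).indicator fun x => ‖fderiv ℝ w x‖ₑ) (t • h)]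
        refine lintegral_mono fun x => ?_
        by_cases hx : x ∈ closedBall (0 : EuclideanSpace ℝ (Fin N)) 1
        · have hx3 : x + t • h ∈ closedBall (0 : EuclideanSpace ℝ (Fin N)) 3 := by
            rw [mem_closedBall_zero_iff] at hx ⊢
            refine (norm_add_le _ _).trans ?_
            rw [norm_smul, Real.norm_of_nonneg ht.1.le]
            nlinarith [ht.1, ht.2, norm_nonneg h]
          simp only [Set.indicator_of_mem hx, Set.indicator_of_mem hx3]
          exact le_rfl
        · simp [Set.indicator_of_notMem hx]
    _ = _ := by simp

lemma double_le {w : EuclideanSpace ℝ (Fin N) → ℝ} (hw : ContDiff ℝ 1 w) :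
    ∫⁻ x in closedBall 0 1, ∫⁻ y in closedBall 0 1, ‖w y - w x‖ₑ ≤
      2 * (∫⁻ x in closedBall 0 3, ‖fderiv ℝ w x‖ₑ) *
        volume (closedBall (0 : EuclideanSpace ℝ (Fin N)) 2) := by
  have hwc := hw.continuous
  calc ∫⁻ x in closedBall 0 1, ∫⁻ y in closedBall 0 1, ‖w y - w x‖ₑ
      ≤ ∫⁻ x in closedBall 0 1, ∫⁻ h in closedBall 0 2, ‖w (x + h) - w x‖ₑ := by
        refine setLIntegral_mono' measurableSet_closedBall fun x hx => ?_
        rw [← lintegral_indicator measurableSet_closedBall,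
          ← lintegral_indicator measurableSet_closedBall,
          ← lintegral_add_left_eq_self _ x]
        refine lintegral_mono fun y => ?_
        by_cases hy : x + y ∈ closedBall (0 : EuclideanSpace ℝ (Fin N)) 1
        · have hy2 : y ∈ closedBall (0 : EuclideanSpace ℝ (Fin N)) 2 := by
            rw [mem_closedBall_zero_iff] at hx hy ⊢
            have := norm_sub_le (x + y) x
            rw [add_sub_cancel_left] at this
            linarith
          simp only [Set.indicator_of_mem hy, Set.indicator_of_mem hy2]
          exact le_rfl
        · simp [Set.indicator_of_notMem hy]
    _ = ∫⁻ h in closedBall 0 2, ∫⁻ x in closedBall 0 1, ‖w (x + h) - w x‖ₑ := by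
        rw [lintegral_lintegral_swap]
        refine Measurable.aemeasurable (Continuous.measurable ?_)
        fun_prop
    _ ≤ ∫⁻ h in closedBall (0 : EuclideanSpace ℝ (Fin N)) 2,
          2 * ∫⁻ x in closedBall 0 3, ‖fderiv ℝ w x‖ₑ := by
        refine setLIntegral_mono measurable_const fun h hh => shift_le hw h ?_
        simpa using hh
    _ = _ := by simp

lemma grad_bound {p : ℝ} (hp : 1 < p) : ∃ C1 : ℝ, ∀ w : EuclideanSpace ℝ (Fin N) → ℝ, Good p w →
    ∫⁻ x in closedBall 0 3, ‖fderiv ℝ w x‖ₑ ≤ ENNReal.ofReal C1 := by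
  obtain ⟨K, hK1, hK⟩ := cutoff (N := N)
  obtain ⟨η, hη, hcη, hη0, hη1, hηr, hηR, hηR', hηd⟩ := hK 3 4 (by norm_num) (by norm_num)
  refine ⟨volume.real (closedBall (0 : EuclideanSpace ℝ (Fin N)) 3) +
    cC p * ∫ x, ‖fderiv ℝ η x‖ ^ p, fun w ⟨hw, hw1, hph⟩ => ?_⟩
  have hca := cacc hp hw hw1 hph hη hcη hη0 (le_refl (0 : ℝ))
  simp only [Real.rpow_zero, mul_one] at hca
  have hcf := hw.continuous_fderiv one_ne_zero
  have hp0 : 0 ≤ p := by linarith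
  have hηc := hη.continuous
  have hcn : Continuous fun x => ‖fderiv ℝ w x‖ ^ p :=
    hcf.norm.rpow_const fun x => Or.inr hp0
  have hIntg : Integrable fun x => η x ^ p * ‖fderiv ℝ w x‖ ^ p := by
    refine Continuous.integrable_of_hasCompactSupport ?_ ?_
    · exact (hηc.rpow_const fun x => Or.inr hp0).mul hcn
    · refine hcη.mono ?_
      intro x hx hx0
      apply hx
      simp only at hx0 ⊢
      rw [hx0, Real.zero_rpow (by linarith), zero_mul]
  have hK3 : IsCompact (closedBall (0 : EuclideanSpace ℝ (Fin N)) 3) := isCompact_closedBall _ _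
  have i1 : IntegrableOn (fun x => ‖fderiv ℝ w x‖) (closedBall 0 3) :=
    hcf.norm.continuousOn.integrableOn_compact hK3
  have i2 : IntegrableOn (fun x => ‖fderiv ℝ w x‖ ^ p) (closedBall 0 3) :=
    hcn.continuousOn.integrableOn_compact hK3
  have i3 : IntegrableOn (fun _ : EuclideanSpace ℝ (Fin N) => (1 : ℝ)) (closedBall 0 3) :=
    continuous_const.continuousOn.integrableOn_compact hK3
  have h1 : ∫ x in closedBall 0 3, ‖fderiv ℝ w x‖ ≤
      volume.real (closedBall (0 : EuclideanSpace ℝ (Fin N)) 3) +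
        cC p * ∫ x, ‖fderiv ℝ η x‖ ^ p := by
    calc ∫ x in closedBall 0 3, ‖fderiv ℝ w x‖
        ≤ ∫ x in closedBall 0 3, ((1 : ℝ) + ‖fderiv ℝ w x‖ ^ p) := by
          refine integral_mono i1 (i3.add i2) fun x => ?_
          simp only
          have h0 := norm_nonneg (fderiv ℝ w x)
          rcases le_total ‖fderiv ℝ w x‖ 1 with h | h
          · have := Real.rpow_nonneg h0 p
            linarith
          · have := Real.rpow_le_rpow_of_exponent_le h hp.le
            rw [Real.rpow_one] at this
            linarith
      _ = volume.real (closedBall (0 : EuclideanSpace ℝ (Fin N)) 3) +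
          ∫ x in closedBall 0 3, ‖fderiv ℝ w x‖ ^ p := by
          rw [integral_add i3 i2]; simp
      _ ≤ _ := by
          gcongr
          refine le_trans ?_ hca
          calc ∫ x in closedBall 0 3, ‖fderiv ℝ w x‖ ^ p
              = ∫ x in closedBall 0 3, η x ^ p * ‖fderiv ℝ w x‖ ^ p := by
                refine setIntegral_congr_fun measurableSet_closedBall fun x hx => ?_
                simp [hηr x hx]
            _ ≤ _ := setIntegral_le_integral hIntg (Filter.Eventually.of_forall fun x => by
                have := Real.rpow_nonneg (hη0 x) p
                have := Real.rpow_nonneg (norm_nonneg (fderiv ℝ w x)) p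
                simp only [Pi.zero_apply]
                positivity)
  refine le_trans (le_of_eq ?_) (ENNReal.ofReal_le_ofReal h1)
  rw [ofReal_integral_eq_lintegral_ofReal i1 (Filter.Eventually.of_forall fun x => norm_nonneg _)]
  simp only [ofReal_norm]

lemma poincare {p : ℝ} (hp : 1 < p) : ∃ C0 : ℝ, ∀ w : EuclideanSpace ℝ (Fin N) → ℝ, Good p w →
    volume (closedBall (0 : EuclideanSpace ℝ (Fin N)) 1) ≤
      2 * volume (closedBall (0 : EuclideanSpace ℝ (Fin N)) 1 ∩ {x | w x ≤ 2}) →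
    ∫ x in closedBall 0 1, w x ≤ C0 := by
  obtain ⟨C1, hC1⟩ := grad_bound (N := N) hp
  set V := volume (closedBall (0 : EuclideanSpace ℝ (Fin N)) 1) with hV
  set V2 := volume (closedBall (0 : EuclideanSpace ℝ (Fin N)) 2) with hV2
  have hVf : V ≠ ⊤ := measure_closedBall_lt_top.ne
  have hV2f : V2 ≠ ⊤ := measure_closedBall_lt_top.ne
  have hV0 : V ≠ 0 := (measure_closedBall_pos volume _ one_pos).ne'
  refine ⟨(2 * (2 * ENNReal.ofReal C1 * V2 + 2 * V * V) / V).toReal, fun w hG hE => ?_⟩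
  have hg := hC1 w hG
  obtain ⟨hw, hw1, -⟩ := hG
  have hwc := hw.continuous
  set E := closedBall (0 : EuclideanSpace ℝ (Fin N)) 1 ∩ {x | w x ≤ 2} with hEdef
  have hEm : MeasurableSet E :=
    measurableSet_closedBall.inter (isClosed_le hwc continuous_const).measurableSet
  set I := ∫⁻ x in closedBall 0 1, ENNReal.ofReal (w x) with hI
  have hEI : volume E * I ≤ 2 * ENNReal.ofReal C1 * V2 + 2 * V * V := by
    calc volume E * I = ∫⁻ x in E, I := by simp [mul_comm]
      _ ≤ ∫⁻ x in E, ((∫⁻ y in closedBall 0 1, ‖w y - w x‖ₑ) + 2 * V) := by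
          refine setLIntegral_mono' hEm fun x hx => ?_
          have : (2 : ENNReal) * V =
              ∫⁻ y in closedBall (0 : EuclideanSpace ℝ (Fin N)) 1, 2 := by simp [hV]
          rw [this, ← lintegral_add_right _ measurable_const]
          refine lintegral_mono fun y => ?_
          have h2 : w x ≤ 2 := hx.2
          calc ENNReal.ofReal (w y) ≤ ENNReal.ofReal (‖w y - w x‖ + 2) := by
                apply ENNReal.ofReal_le_ofReal
                have := le_abs_self (w y - w x)
                rw [Real.norm_eq_abs]; linarith
            _ = _ := by
                rw [ENNReal.ofReal_add (norm_nonneg _) (by norm_num), ofReal_norm]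
                simp
      _ ≤ ∫⁻ x in closedBall 0 1, ((∫⁻ y in closedBall 0 1, ‖w y - w x‖ₑ) + 2 * V) :=
          lintegral_mono_set Set.inter_subset_left
      _ = (∫⁻ x in closedBall 0 1, ∫⁻ y in closedBall 0 1, ‖w y - w x‖ₑ) + 2 * V * V := by
          rw [lintegral_add_right _ measurable_const]; simp [hV]
      _ ≤ _ := by
          gcongr
          refine (double_le hw).trans ?_
          gcongr
  have hfin : 2 * (2 * ENNReal.ofReal C1 * V2 + 2 * V * V) / V ≠ ⊤ := by
    refine ENNReal.div_ne_top ?_ hV0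
    finiteness
  have hIle : I ≤ 2 * (2 * ENNReal.ofReal C1 * V2 + 2 * V * V) / V := by
    rw [ENNReal.le_div_iff_mul_le (Or.inl hV0) (Or.inl hVf)]
    calc I * V ≤ I * (2 * volume E) := by gcongr
      _ = 2 * (volume E * I) := by ring
      _ ≤ _ := by gcongr
  rw [integral_eq_lintegral_of_nonneg_ae
    (Filter.Eventually.of_forall fun x => zero_le_one.trans (hw1 x))
    hwc.aestronglyMeasurable]
  exact ENNReal.toReal_mono hfin hIle

lemma good_log {p : ℝ} {v : EuclideanSpace ℝ (Fin N) → ℝ} (hv : ContDiff ℝ 1 v) (hph : PH p v)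
    (h0 : ∀ x, 0 < v x) (h1 : ∀ x, v x ≤ 1) : Good p (fun x => 1 - Real.log (v x)) := by
  refine ⟨contDiff_const.sub (hv.log fun x => (h0 x).ne'), fun x => ?_, ?_⟩
  · have := Real.log_nonpos (h0 x).le (h1 x)
    linarith
  · have h := PH_affine hv hph (Real.exp (-1)) 0 one_pos
    have he : (fun x => Real.exp (-(1 - Real.log (v x)))) =
        fun x => Real.exp (-1) * v ((1 : ℝ) • x) + 0 := by
      funext x
      rw [one_smul, add_zero, show -(1 - Real.log (v x)) = -1 + Real.log (v x) by ring,
        Real.exp_add, Real.exp_log (h0 x)]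
    rw [he]; exact h

lemma key {p : ℝ} (hp : 1 < p) (hN : 2 ≤ N) : ∃ δ : ℝ, 0 < δ ∧
    ∀ v : EuclideanSpace ℝ (Fin N) → ℝ, ContDiff ℝ 1 v → PH p v → (∀ x, 0 ≤ v x) →
      (∀ x, v x ≤ 1) →
      volume (closedBall (0 : EuclideanSpace ℝ (Fin N)) 1) ≤
        2 * volume (closedBall (0 : EuclideanSpace ℝ (Fin N)) 1 ∩ {x | 1 / 2 ≤ v x}) →
      ∀ x ∈ ball (0 : EuclideanSpace ℝ (Fin N)) (1 / 2), δ ≤ v x := by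
  obtain ⟨C0, hC0⟩ := poincare (N := N) hp
  obtain ⟨L, hL⟩ := moser (N := N) hp hN C0
  refine ⟨Real.exp (1 - L), Real.exp_pos _, fun v hv hph h0 h1 hE x hx => ?_⟩
  refine le_of_forall_pos_le_add fun ε hε => ?_
  have h1ε : 0 < 1 + ε := by linarith
  set V : EuclideanSpace ℝ (Fin N) → ℝ := fun x => (1 / (1 + ε)) * v ((1 : ℝ) • x) + ε / (1 + ε)
    with hV
  have hVe : ∀ x, V x = (v x + ε) / (1 + ε) := by
    intro x; simp only [hV, one_smul]; ring
  have hVc : ContDiff ℝ 1 V := by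
    have : V = fun x => (v x + ε) / (1 + ε) := funext hVe
    rw [this]
    exact (hv.add contDiff_const).div_const _
  have hVp : PH p V := PH_affine hv hph _ _ one_pos
  have hV0 : ∀ x, 0 < V x := by
    intro x; rw [hVe]; have := h0 x; positivity
  have hV1 : ∀ x, V x ≤ 1 := by
    intro x; rw [hVe, div_le_one h1ε]; have := h1 x; linarith
  have hG := good_log hVc hVp hV0 hV1
  have hlog : -1 ≤ Real.log (1 / 2) := by
    rw [Real.log_div one_ne_zero two_ne_zero, Real.log_one]
    have := Real.log_two_lt_d9
    linarith
  have hw := hL _ hG (hC0 _ hG (hE.trans (by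
    refine mul_le_mul_right (measure_mono (Set.inter_subset_inter_right _ fun y hy => ?_)) _
    change 1 - Real.log (V y) ≤ 2
    have hy2 : 1 / 2 ≤ V y := by
      rw [hVe, le_div_iff₀ h1ε]
      have : 1 / 2 ≤ v y := hy
      linarith
    have := Real.log_le_log (by norm_num) hy2
    linarith))) x hx
  have h2 : Real.exp (1 - L) ≤ V x := by
    rw [← Real.le_log_iff_exp_le (hV0 x)]
    linarith
  rw [hVe, le_div_iff₀ h1ε] at h2
  have := Real.exp_pos (1 - L)
  nlinarith

lemma main_ge2 {p : ℝ} (hp : 1 < p) (hN : 2 ≤ N) {u : EuclideanSpace ℝ (Fin N) → ℝ}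
    (hu : ContDiff ℝ 1 u) (hbd : ∃ M : ℝ, ∀ x, |u x| ≤ M) (hph : PH p u) :
    ∃ c : ℝ, ∀ x, u x = c := by
  obtain ⟨M, hM⟩ := hbd
  obtain ⟨δ, hδ, hkey⟩ := key (N := N) hp hN
  have hba : BddAbove (Set.range u) := ⟨M, by rintro _ ⟨x, rfl⟩; exact (abs_le.1 (hM x)).2⟩
  have hbb : BddBelow (Set.range u) := ⟨-M, by rintro _ ⟨x, rfl⟩; exact (abs_le.1 (hM x)).1⟩
  set S := ⨆ x, u x with hS
  set m := ⨅ x, u x with hm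
  have hle : ∀ x, u x ≤ S := fun x => le_ciSup hba x
  have hge : ∀ x, m ≤ u x := fun x => ciInf_le hbb x
  rcases (le_trans (hge 0) (hle 0)).eq_or_lt with heq | hlt
  · exact ⟨S, fun x => le_antisymm (hle x) (heq ▸ hge x)⟩
  exfalso
  set d := S - m with hd
  have hd0 : 0 < d := by linarith
  have hδd : 0 < δ * d := by positivity
  obtain ⟨x0, hx0⟩ := exists_lt_of_lt_ciSup (f := u) (show S - δ * d < S by linarith)
  obtain ⟨y0, hy0⟩ := exists_lt_of_ciInf_lt (f := u) (show m < m + δ * d by linarith)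
  set R : ℝ := 2 * (‖x0‖ + ‖y0‖) + 1 with hR
  have hR0 : 0 < R := by positivity
  have hin : ∀ z : EuclideanSpace ℝ (Fin N), 2 * ‖z‖ < R →
      R⁻¹ • z ∈ ball (0 : EuclideanSpace ℝ (Fin N)) (1 / 2) := by
    intro z hz
    rw [mem_ball_zero_iff, norm_smul, Real.norm_of_nonneg (by positivity), inv_mul_lt_iff₀ hR0]
    linarith
  have hback : ∀ z : EuclideanSpace ℝ (Fin N), R • (R⁻¹ • z) = z := fun z =>
    smul_inv_smul₀ hR0.ne' z
  set v1 : EuclideanSpace ℝ (Fin N) → ℝ := fun x => (-1 / d) * u (R • x) + S / d with hv1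
  set v2 : EuclideanSpace ℝ (Fin N) → ℝ := fun x => (1 / d) * u (R • x) + (-m / d) with hv2
  have e1 : ∀ x, v1 x = (S - u (R • x)) / d := fun x => by simp only [hv1]; ring
  have e2 : ∀ x, v2 x = (u (R • x) - m) / d := fun x => by simp only [hv2]; ring
  have hc : ContDiff ℝ 1 fun x => u (R • x) := hu.comp (contDiff_const_smul R)
  have c1 : ContDiff ℝ 1 v1 := (contDiff_const.mul hc).add contDiff_const
  have c2 : ContDiff ℝ 1 v2 := (contDiff_const.mul hc).add contDiff_const
  have p1 : PH p v1 := PH_affine hu hph _ _ hR0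
  have p2 : PH p v2 := PH_affine hu hph _ _ hR0
  have hcov : closedBall (0 : EuclideanSpace ℝ (Fin N)) 1 ⊆
      (closedBall (0 : EuclideanSpace ℝ (Fin N)) 1 ∩ {x | 1 / 2 ≤ v1 x}) ∪
      (closedBall (0 : EuclideanSpace ℝ (Fin N)) 1 ∩ {x | 1 / 2 ≤ v2 x}) := by
    intro x hx
    have hsum : v1 x + v2 x = 1 := by
      rw [e1, e2, ← add_div, div_eq_one_iff_eq hd0.ne']; rw [hd]; ring
    rcases le_total (1 / 2) (v1 x) with h | h
    · exact Or.inl ⟨hx, h⟩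
    · refine Or.inr ⟨hx, ?_⟩
      change 1 / 2 ≤ v2 x
      linarith
  have hmeas := (measure_mono (μ := volume) hcov).trans (measure_union_le _ _)
  rcases le_total
    (volume (closedBall (0 : EuclideanSpace ℝ (Fin N)) 1 ∩ {x | 1 / 2 ≤ v1 x}))
    (volume (closedBall (0 : EuclideanSpace ℝ (Fin N)) 1 ∩ {x | 1 / 2 ≤ v2 x})) with h | h
  · have h2 := hkey v2 c2 p2 (fun x => by rw [e2]; have := hge (R • x); apply div_nonneg <;> linarith)
      (fun x => by rw [e2, div_le_one hd0]; have := hle (R • x); linarith)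
      (hmeas.trans (by rw [two_mul]; gcongr)) (R⁻¹ • y0)
      (hin y0 (by have := norm_nonneg x0; linarith))
    rw [e2, hback, le_div_iff₀ hd0] at h2
    linarith
  · have h2 := hkey v1 c1 p1 (fun x => by rw [e1]; have := hle (R • x); apply div_nonneg <;> linarith)
      (fun x => by rw [e1, div_le_one hd0]; have := hge (R • x); linarith)
      (hmeas.trans (by rw [two_mul]; gcongr)) (R⁻¹ • x0)
      (hin x0 (by have := norm_nonneg y0; linarith))
    rw [e1, hback, le_div_iff₀ hd0] at h2
    linarith

lemma good_one {p : ℝ} (hp : 1 < p) {w : EuclideanSpace ℝ (Fin 1) → ℝ} (hG : Good p w)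
    (x0 : EuclideanSpace ℝ (Fin 1)) : fderiv ℝ w x0 = 0 := by
  by_contra hne
  obtain ⟨hw, hw1, hph⟩ := hG
  obtain ⟨K, hK1, hK⟩ := cutoff (N := 1)
  have hcf := hw.continuous_fderiv one_ne_zero
  have hp0 : 0 ≤ p := by linarith
  have hcn : Continuous fun x => ‖fderiv ℝ w x‖ ^ p :=
    hcf.norm.rpow_const fun x => Or.inr hp0
  have hcont : ∀ η : EuclideanSpace ℝ (Fin 1) → ℝ, ContDiff ℝ 1 η →
      Continuous fun x => η x ^ p * ‖fderiv ℝ w x‖ ^ p := fun η hη =>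
    (hη.continuous.rpow_const fun x => Or.inr hp0).mul hcn
  have hsupp : ∀ η : EuclideanSpace ℝ (Fin 1) → ℝ, HasCompactSupport η →
      HasCompactSupport fun x => η x ^ p * ‖fderiv ℝ w x‖ ^ p := by
    intro η hcη
    refine hcη.mono ?_
    intro x hx hx0
    apply hx
    simp only at hx0 ⊢
    rw [hx0, Real.zero_rpow (by linarith), zero_mul]
  set r0 : ℝ := ‖x0‖ + 1 with hr0
  have hr0p : 0 < r0 := by positivity
  obtain ⟨η0, a1, a2, a3, a4, a5, a6, -, -⟩ := hK r0 (2 * r0) hr0p (by linarith)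
  set q := ∫ x, η0 x ^ p * ‖fderiv ℝ w x‖ ^ p with hq
  have hq0 : 0 < q := by
    refine Continuous.integral_pos_of_hasCompactSupport_nonneg_nonzero (x := x0) (hcont _ a1)
      (hsupp _ a2) ?_ ?_
    · intro x
      exact mul_nonneg (Real.rpow_nonneg (a3 x) _) (Real.rpow_nonneg (norm_nonneg _) _)
    · rw [a5 x0 (by simp [hr0]), Real.one_rpow, one_mul]
      exact (Real.rpow_pos_of_pos (norm_pos_iff.2 hne) _).ne'
  set V := volume.real (ball (0 : EuclideanSpace ℝ (Fin 1)) 1) with hV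
  have hbound : ∀ r, 2 * r0 ≤ r → q ≤ cC p * (K ^ p * 2 * V) * r ^ (-(p - 1)) := by
    intro r hr
    have hrp : 0 < r := by linarith
    obtain ⟨η, b1, b2, b3, b4, b5, b6, b7, b8⟩ := hK r (2 * r) hrp (by linarith)
    have hca := cacc hp hw hw1 hph b1 b2 b3 (le_refl (0 : ℝ))
    simp only [Real.rpow_zero, mul_one] at hca
    have hq1 : q ≤ ∫ x, η x ^ p * ‖fderiv ℝ w x‖ ^ p := by
      refine integral_mono ((hcont _ a1).integrable_of_hasCompactSupport (hsupp _ a2))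
        ((hcont _ b1).integrable_of_hasCompactSupport (hsupp _ b2)) fun x => ?_
      refine mul_le_mul_of_nonneg_right ?_ (Real.rpow_nonneg (norm_nonneg _) _)
      refine Real.rpow_le_rpow (a3 x) ?_ hp0
      by_cases hx : x ∈ closedBall (0 : EuclideanSpace ℝ (Fin 1)) (2 * r0)
      · rw [b5 x (closedBall_subset_closedBall hr hx)]; exact a4 x
      · rw [a6 x hx]; exact b3 x
    have hvol : volume.real (closedBall (0 : EuclideanSpace ℝ (Fin 1)) (2 * r)) = 2 * r * V := by
      rw [hV, measureReal_def, measureReal_def, Measure.addHaar_closedBall _ _ (by positivity)]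
      rw [ENNReal.toReal_mul, ENNReal.toReal_ofReal (by positivity)]
      simp
    have hd : ∫ x, ‖fderiv ℝ η x‖ ^ p ≤ (K / r) ^ p * (2 * r * V) := by
      rw [← setIntegral_eq_integral_of_forall_compl_eq_zero
        (s := closedBall (0 : EuclideanSpace ℝ (Fin 1)) (2 * r))
        (fun x hx => by rw [b7 x hx, norm_zero, Real.zero_rpow (by linarith)])]
      calc ∫ x in closedBall (0 : EuclideanSpace ℝ (Fin 1)) (2 * r), ‖fderiv ℝ η x‖ ^ p
          ≤ ∫ x in closedBall (0 : EuclideanSpace ℝ (Fin 1)) (2 * r), (K / r) ^ p := by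
            refine integral_mono ?_ ?_ fun x => ?_
            · exact (((b1.continuous_fderiv one_ne_zero).norm.rpow_const
                fun x => Or.inr hp0).continuousOn).integrableOn_compact (isCompact_closedBall _ _)
            · exact continuous_const.continuousOn.integrableOn_compact (isCompact_closedBall _ _)
            · refine Real.rpow_le_rpow (norm_nonneg _) ?_ hp0
              have := b8 x
              rwa [show 2 * r - r = r by ring] at this
        _ = _ := by rw [setIntegral_const, hvol, smul_eq_mul, mul_comm]
    refine hq1.trans (hca.trans ((mul_le_mul_of_nonneg_left hd (cC_pos hp).le).trans
      (le_of_eq ?_)))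
    rw [Real.div_rpow (by linarith) hrp.le, Real.rpow_neg hrp.le, Real.rpow_sub_one hrp.ne']
    have : r ^ p ≠ 0 := (Real.rpow_pos_of_pos hrp p).ne'
    field_simp
  have ht : Filter.Tendsto (fun r : ℝ => cC p * (K ^ p * 2 * V) * r ^ (-(p - 1)))
      Filter.atTop (nhds (cC p * (K ^ p * 2 * V) * 0)) :=
    (tendsto_rpow_neg_atTop (by linarith)).const_mul _
  have := ge_of_tendsto ht (Filter.eventually_atTop.2 ⟨2 * r0, hbound⟩)
  linarith

lemma main_one {p : ℝ} (hp : 1 < p) {u : EuclideanSpace ℝ (Fin 1) → ℝ}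
    (hu : ContDiff ℝ 1 u) (hbd : ∃ M : ℝ, ∀ x, |u x| ≤ M) (hph : PH p u) :
    ∃ c : ℝ, ∀ x, u x = c := by
  obtain ⟨M, hM⟩ := hbd
  have hM0 : 0 ≤ M := (abs_nonneg _).trans (hM 0)
  have hD : 0 < 2 * M + 1 := by linarith
  set V : EuclideanSpace ℝ (Fin 1) → ℝ :=
    fun x => (1 / (2 * M + 1)) * u ((1 : ℝ) • x) + (M + 1) / (2 * M + 1) with hV
  have hVe : ∀ x, V x = (u x + M + 1) / (2 * M + 1) := by
    intro x; simp only [hV, one_smul]; ring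
  have hVc : ContDiff ℝ 1 V := by
    have : V = fun x => (u x + M + 1) / (2 * M + 1) := funext hVe
    rw [this]
    exact ((hu.add contDiff_const).add contDiff_const).div_const _
  have hVp : PH p V := PH_affine hu hph _ _ one_pos
  have hV0 : ∀ x, 0 < V x := by
    intro x; rw [hVe]; have := (abs_le.1 (hM x)).1
    apply div_pos <;> linarith
  have hV1 : ∀ x, V x ≤ 1 := by
    intro x; rw [hVe, div_le_one hD]; have := (abs_le.1 (hM x)).2; linarith
  have hG := good_log hVc hVp hV0 hV1
  have hc := is_const_of_fderiv_eq_zero (hG.1.differentiable one_ne_zero) (good_one hp hG)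
  refine ⟨u 0, fun x => ?_⟩
  have h1 := hc x 0
  have h2 : Real.log (V x) = Real.log (V 0) := by linarith
  have h3 := Real.log_injOn_pos (hV0 x) (hV0 0) h2
  rw [hVe, hVe, div_left_inj' hD.ne'] at h3
  linarith

end PLiou

/-- Bounded C¹ p-harmonic functions on ℝ^N are constant. -/
theorem bounded_p_harmonic_is_constant
    (N : ℕ) (hN : 1 ≤ N) (p : ℝ) (hp : 1 < p)
    (u : EuclideanSpace ℝ (Fin N) → ℝ)
    (hu : ContDiff ℝ 1 u)
    (hbd : ∃ M : ℝ, ∀ x, |u x| ≤ M)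
    (hharm : ∀ φ : EuclideanSpace ℝ (Fin N) → ℝ,
      ContDiff ℝ (⊤ : ℕ∞) φ → HasCompactSupport φ →
      ∫ x, ‖gradient u x‖ ^ (p - 2) * ⟪gradient u x, gradient φ x⟫ = 0) :
    ∃ c : ℝ, ∀ x, u x = c := by
  have hph := PLiou.PH_of_smooth hp hu hharm
  rcases hN.eq_or_lt with h | h
  · subst h
    exact PLiou.main_one hp hu hbd hph
  · exact PLiou.main_ge2 hp h hu hbd hph
end

section
/- Let N ≥ 1 and p > 1. There exists a constant C > 0, depending only on N and p, such that the following holds: for every C^∞ function u : ℝ^N → ℝ with ∇u(x) ≠ 0 for all x, satisfying div(|∇u|^{p−2}∇u) = 0 pointwise in ℝ^N, and for every real λ ≥ 1 and all R > 0, σ > 0, one has ∫_{B(0,R)} |∇(|∇u|^{(p+λ)/2})(x)|² dx ≤ (C/σ²) ∫_{B(0,R+σ)} |∇u(x)|^{p+λ} dx. -/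
open MeasureTheory Metric
open scoped RealInnerProductSpace

abbrev EN (N : ℕ) := EuclideanSpace ℝ (Fin N)

/-- trace computation -/
lemma trace_calc {N : ℕ} (H A B : EN N →L[ℝ] EN N) (G h ζ : EN N)
    (hs : ∀ a b, ⟪H a, b⟫ = ⟪a, H b⟫) (hh : H G = h) (a1 a2 b1 b2 b3 : ℝ)
    (hA : ∀ v, A v = a1 • H v + (a2 * ⟪h, v⟫) • G)
    (hB : ∀ v, B v = b1 • H v + (b2 * ⟪h, v⟫) • G + (b3 * ⟪ζ, v⟫) • G) :
    ∑ k : Fin N, ∑ i : Fin N, ⟪A (EuclideanSpace.single k 1), EuclideanSpace.single i 1⟫ *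
      ⟪B (EuclideanSpace.single i 1), EuclideanSpace.single k 1⟫
    = a1 * b1 * (∑ k : Fin N, ‖H (EuclideanSpace.single k 1)‖ ^ 2)
      + (a1 * b2 + a2 * b1) * ‖h‖ ^ 2 + a2 * b2 * ⟪G, h⟫ ^ 2
      + a1 * b3 * ⟪h, ζ⟫ + a2 * b3 * ⟪G, h⟫ * ⟪G, ζ⟫ := by
  set e : OrthonormalBasis (Fin N) ℝ (EN N) := EuclideanSpace.basisFun (Fin N) ℝ with he
  have hek : ∀ k, EuclideanSpace.single k (1:ℝ) = e k := by intro k; simp [he]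
  simp only [hek]
  have P : ∀ a b : EN N, ∑ k, ⟪a, e k⟫ * ⟪b, e k⟫ = ⟪a, b⟫ := by
    intro a b
    rw [← e.sum_inner_mul_inner a b]
    refine Finset.sum_congr rfl fun k _ => ?_
    rw [real_inner_comm b (e k)]
  have h1 : ∀ k, ∑ i, ⟪A (e k), e i⟫ * ⟪B (e i), e k⟫
      = ⟪A (e k), b1 • H (e k) + (b2 * ⟪G, e k⟫) • h + (b3 * ⟪G, e k⟫) • ζ⟫ := by
    intro k
    rw [← P]
    refine Finset.sum_congr rfl fun i _ => ?_
    rw [hB]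
    congr 1
    simp only [inner_add_left, real_inner_smul_left]
    rw [hs (e i) (e k), real_inner_comm (H (e k)) (e i)]
    ring
  simp only [h1]
  simp only [hA]
  have h2 : ∀ k, ⟪a1 • H (e k) + (a2 * ⟪h, e k⟫) • G,
      b1 • H (e k) + (b2 * ⟪G, e k⟫) • h + (b3 * ⟪G, e k⟫) • ζ⟫ 
      = a1 * b1 * ‖H (e k)‖ ^ 2 + a1 * b2 * (⟪H h, e k⟫ * ⟪G, e k⟫)
        + a1 * b3 * (⟪H ζ, e k⟫ * ⟪G, e k⟫) + a2 * b1 * (⟪h, e k⟫ * ⟪h, e k⟫)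
        + a2 * b2 * ⟪G, h⟫ * (⟪h, e k⟫ * ⟪G, e k⟫) 
        + a2 * b3 * ⟪G, ζ⟫ * (⟪h, e k⟫ * ⟪G, e k⟫) := by
    intro k
    have e1 : ⟪G, H (e k)⟫ = ⟪h, e k⟫ := by rw [← hs, hh]
    have e2 : ⟪H (e k), h⟫ = ⟪H h, e k⟫ := by rw [hs, real_inner_comm]
    have e3 : ⟪H (e k), ζ⟫ = ⟪H ζ, e k⟫ := by rw [hs, real_inner_comm]
    simp only [inner_add_left, real_inner_smul_left, inner_add_right, real_inner_smul_right, e1, e2, e3,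
      real_inner_self_eq_norm_sq]
    ring
  simp only [h2, Finset.sum_add_distrib, ← Finset.mul_sum, P]
  have e4 : ⟪H h, G⟫ = ‖h‖ ^ 2 := by rw [hs, hh, real_inner_self_eq_norm_sq]
  have e5 : ⟪H ζ, G⟫ = ⟪h, ζ⟫ := by rw [hs, hh, real_inner_comm]
  rw [e4, e5, real_inner_self_eq_norm_sq, real_inner_comm G h]
  ring

lemma hs_bound {N : ℕ} (H : EN N →L[ℝ] EN N) (G h : EN N)
    (hs : ∀ a b, ⟪H a, b⟫ = ⟪a, H b⟫) (hh : H G = h) :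
    ‖h‖ ^ 2 ≤ (∑ k : Fin N, ‖H (EuclideanSpace.single k 1)‖ ^ 2) * ‖G‖ ^ 2 := by
  set e : OrthonormalBasis (Fin N) ℝ (EN N) := EuclideanSpace.basisFun (Fin N) ℝ with he
  have hek : ∀ k, EuclideanSpace.single k (1:ℝ) = e k := by intro k; simp [he]
  simp only [hek]
  rw [← e.sum_sq_norm_inner_right h, Finset.sum_mul]
  refine Finset.sum_le_sum fun k _ => ?_
  rw [← hh, ← hs, ← mul_pow]
  gcongr
  exact norm_inner_le_norm _ _

/-- the algebraic inequality -/
lemma alg_ineq (p lam w S b x y η z n c M : ℝ) (hc : c = min 1 (p-1)) (hM : M = 1 + |p-2|)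
    (hp : 1 < p) (hl : 1 ≤ lam) (hw : 0 < w) (hS : n ^ 2 ≤ S * w ^ 2)
    (hη : 0 ≤ η) (hn : 0 ≤ n)
    (hb : |b| ≤ w * n) (hx : |x| ≤ n * z) (hy : |y| ≤ w * z) :
    c * (1 + lam) / 2 * (η ^ 2 * (n ^ 2 / w ^ 2)) - 2 * M ^ 2 / (c * (1 + lam)) * (w ^ 2 * z ^ 2)
     ≤ η ^ 2 * (S + (lam + (p - 2)) * (n ^ 2 / w ^ 2) + (p - 2) * lam * (b ^ 2 / w ^ 4))
       + 2 * η * (x + (p - 2) * (b * y / w ^ 2)) := by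
  have hc0 : 0 < c := by rw [hc]; exact lt_min one_pos (by linarith)
  have hX : 0 < c * (1 + lam) := by positivity
  set X := c * (1 + lam) with hXd
  set a := n / w with ha
  have ha0 : 0 ≤ a := by positivity
  have hna : n = a * w := by rw [ha]; field_simp
  have e1 : n ^ 2 / w ^ 2 = a ^ 2 := by rw [ha]; ring
  set β := b / w ^ 2 with hβ
  have e2 : b ^ 2 / w ^ 4 = β ^ 2 := by rw [hβ]; field_simp
  have e3 : b * y / w ^ 2 = β * y := by rw [hβ]; ring
  have hβa : |β| ≤ a := by
    rw [hβ, abs_div, abs_of_pos (by positivity : 0 < w ^ 2), div_le_iff₀ (by positivity)]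
    calc |b| ≤ w * n := hb
      _ = a * w ^ 2 := by rw [hna]; ring
  have hβ2 : β ^ 2 ≤ a ^ 2 := by rw [← sq_abs β]; gcongr
  have hSa : a ^ 2 ≤ S := by
    rw [← e1, div_le_iff₀ (by positivity)]; exact hS
  have main : X * a ^ 2 ≤ S + (lam + (p - 2)) * a ^ 2 + (p - 2) * lam * β ^ 2 := by
    rcases le_total 2 p with h | h
    · have : c = 1 := by rw [hc]; exact min_eq_left (by linarith)
      have t : 0 ≤ (p - 2) * lam * β ^ 2 := by
        have : 0 ≤ p - 2 := by linarith
        positivity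
      have t2 : 0 ≤ (p - 2) * a ^ 2 := by
        have : 0 ≤ p - 2 := by linarith
        positivity
      rw [hXd, this]; nlinarith
    · have : c = p - 1 := by rw [hc]; exact min_eq_right (by linarith)
      have t : 0 ≤ (2 - p) * lam * (a ^ 2 - β ^ 2) := by
        have : 0 ≤ 2 - p := by linarith
        have : 0 ≤ a ^ 2 - β ^ 2 := by linarith
        positivity
      rw [hXd, this]; nlinarith
  have cross : |x + (p - 2) * (β * y)| ≤ M * (a * (w * z)) := by
    calc |x + (p - 2) * (β * y)| ≤ |x| + |(p - 2) * (β * y)| := abs_add_le _ _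
      _ = |x| + |p - 2| * (|β| * |y|) := by rw [abs_mul, abs_mul]
      _ ≤ n * z + |p - 2| * (a * (w * z)) := by gcongr
      _ = M * (a * (w * z)) := by rw [hM, hna]; ring
  have young : 2 * η * (M * (a * (w * z))) ≤ X / 2 * (η ^ 2 * a ^ 2) + 2 * M ^ 2 / X * (w ^ 2 * z ^ 2) := by
    have : 0 ≤ (1 / (2 * X)) * (X * η * a - 2 * M * (w * z)) ^ 2 := by positivity
    have e : (1 / (2 * X)) * (X * η * a - 2 * M * (w * z)) ^ 2 
      = X / 2 * (η ^ 2 * a ^ 2) + 2 * M ^ 2 / X * (w ^ 2 * z ^ 2) - 2 * η * (M * (a * (w * z))) := by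
      field_simp; ring
    linarith
  have l1 := (abs_le.1 cross).1
  have l2 : 2 * η * (-(M * (a * (w * z)))) ≤ 2 * η * (x + (p - 2) * (β * y)) := by gcongr
  have l3 : η ^ 2 * (X * a ^ 2) ≤ η ^ 2 * (S + (lam + (p - 2)) * a ^ 2 + (p - 2) * lam * β ^ 2) := by gcongr
  rw [e1, e2, e3]
  nlinarith

lemma cutoff_bound : ∃ K : ℝ, 0 < K ∧ ∀ t, |deriv Real.smoothTransition t| ≤ K := by
  have hc : Continuous (deriv Real.smoothTransition) :=
    (Real.smoothTransition.contDiff (n := 1)).continuous_deriv le_rfl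
  obtain ⟨K, hK⟩ := isCompact_Icc.exists_bound_of_continuousOn (s := Set.Icc (0:ℝ) 1) hc.continuousOn
  refine ⟨|K| + 1, by positivity, fun t => ?_⟩
  by_cases ht : t ∈ Set.Icc (0:ℝ) 1
  · have := hK t ht
    rw [Real.norm_eq_abs] at this
    linarith [le_abs_self K]
  · have : deriv Real.smoothTransition t = 0 := by
      rw [Set.mem_Icc, not_and_or, not_le, not_le] at ht
      rcases ht with h | h
      · have : Real.smoothTransition =ᶠ[nhds t] fun _ => 0 := by
          filter_upwards [Iio_mem_nhds h] with s hs
          exact Real.smoothTransition.zero_of_nonpos (le_of_lt hs)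
        rw [this.deriv_eq]; simp
      · have : Real.smoothTransition =ᶠ[nhds t] fun _ => 1 := by
          filter_upwards [Ioi_mem_nhds h] with s hs
          exact Real.smoothTransition.one_of_one_le (le_of_lt hs)
        rw [this.deriv_eq]; simp
    rw [this]; simp; positivity

lemma inner_fderiv {N : ℕ} {Φ : EN N → EN N} {x : EN N} (h : DifferentiableAt ℝ Φ x) (v e : EN N) :
    fderiv ℝ (fun y => ⟪Φ y, e⟫) x v = ⟪fderiv ℝ Φ x v, e⟫ := by
  have := fderiv_inner_apply ℝ h (differentiableAt_const e) v
  simpa using this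

lemma ibp_zero {N : ℕ} (V Φ : EN N → EN N) (hV : ContDiff ℝ 2 V) (hΦ : ContDiff ℝ 1 Φ)
    (hc : HasCompactSupport Φ)
    (hdiv : ∀ x, ∑ i : Fin N, ⟪fderiv ℝ V x (EuclideanSpace.single i 1),
      EuclideanSpace.single i 1⟫ = 0) :
    Integrable (fun x => ∑ k : Fin N, ∑ i : Fin N,
      ⟪fderiv ℝ V x (EuclideanSpace.single k 1), EuclideanSpace.single i 1⟫ *
      ⟪fderiv ℝ Φ x (EuclideanSpace.single i 1), EuclideanSpace.single k 1⟫) ∧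
    ∫ x, ∑ k : Fin N, ∑ i : Fin N,
      ⟪fderiv ℝ V x (EuclideanSpace.single k 1), EuclideanSpace.single i 1⟫ *
      ⟪fderiv ℝ Φ x (EuclideanSpace.single i 1), EuclideanSpace.single k 1⟫ = 0 := by
  set e : Fin N → EN N := fun i => EuclideanSpace.single i 1 with he
  change (∀ x, ∑ i : Fin N, ⟪fderiv ℝ V x (e i), e i⟫ = 0) at hdiv
  change Integrable (fun x => ∑ k, ∑ i, ⟪fderiv ℝ V x (e k), e i⟫ * ⟪fderiv ℝ Φ x (e i), e k⟫) ∧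
    ∫ x, ∑ k, ∑ i, ⟪fderiv ℝ V x (e k), e i⟫ * ⟪fderiv ℝ Φ x (e i), e k⟫ = 0
  have hDV : ContDiff ℝ 1 (fderiv ℝ V) := hV.fderiv_right (by norm_num)
  have hDVk : ∀ k, ContDiff ℝ 1 (fun y => fderiv ℝ V y (e k)) := fun k =>
    hDV.clm_apply contDiff_const
  have hf : ∀ k i, ContDiff ℝ 1 (fun y => ⟪fderiv ℝ V y (e k), e i⟫) := fun k i =>
    (hDVk k).inner ℝ contDiff_const
  have hg : ∀ k, ContDiff ℝ 1 (fun y => ⟪Φ y, e k⟫) := fun k => hΦ.inner ℝ contDiff_const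
  have hgc : ∀ k, HasCompactSupport (fun y => ⟪Φ y, e k⟫) := fun k =>
    hc.comp_left (g := fun z => ⟪z, e k⟫) (by simp)
  have hgd : ∀ k i x, fderiv ℝ (fun y => ⟪Φ y, e k⟫) x (e i) = ⟪fderiv ℝ Φ x (e i), e k⟫ :=
    fun k i x => inner_fderiv (hΦ.differentiable (by norm_num) x) _ _
  have hgdc : ∀ k i, HasCompactSupport (fun x => ⟪fderiv ℝ Φ x (e i), e k⟫) := by
    intro k i
    simp only [← hgd]
    exact (hgc k).fderiv_apply ℝ (e i)
  have hgdcont : ∀ k i, Continuous (fun x => ⟪fderiv ℝ Φ x (e i), e k⟫) := by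
    intro k i
    have := (hΦ.continuous_fderiv (by norm_num))
    fun_prop
  have hfdcont : ∀ k i, Continuous (fun x => fderiv ℝ (fun y => ⟪fderiv ℝ V y (e k), e i⟫) x (e i)) := by
    intro k i
    have := ((hf k i).continuous_fderiv (by norm_num))
    fun_prop
  have I1 : ∀ k i, Integrable (fun x => ⟪fderiv ℝ V x (e k), e i⟫ * ⟪fderiv ℝ Φ x (e i), e k⟫) :=
    fun k i => ((hf k i).continuous.mul (hgdcont k i)).integrable_of_hasCompactSupport
      (hgdc k i).mul_left
  have I2 : ∀ k i, Integrable (fun x => fderiv ℝ (fun y => ⟪fderiv ℝ V y (e k), e i⟫) x (e i)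
      * ⟪Φ x, e k⟫) :=
    fun k i => ((hfdcont k i).mul (hg k).continuous).integrable_of_hasCompactSupport
      (hgc k).mul_left
  have I3 : ∀ k i, Integrable (fun x => ⟪fderiv ℝ V x (e k), e i⟫ * ⟪Φ x, e k⟫) :=
    fun k i => ((hf k i).continuous.mul (hg k).continuous).integrable_of_hasCompactSupport
      (hgc k).mul_left
  refine ⟨integrable_finsetSum _ fun k _ => integrable_finsetSum _ fun i _ => I1 k i, ?_⟩
  rw [integral_finsetSum _ fun k _ => integrable_finsetSum _ fun i _ => I1 k i]
  refine Finset.sum_eq_zero fun k _ => ?_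
  rw [integral_finsetSum _ fun i _ => I1 k i]
  have step : ∀ i, ∫ x, ⟪fderiv ℝ V x (e k), e i⟫ * ⟪fderiv ℝ Φ x (e i), e k⟫ =
      - ∫ x, fderiv ℝ (fun y => ⟪fderiv ℝ V y (e k), e i⟫) x (e i) * ⟪Φ x, e k⟫ := by
    intro i
    have := integral_mul_fderiv_eq_neg_fderiv_mul_of_integrable (μ := volume) (v := e i)
      (f := fun y => ⟪fderiv ℝ V y (e k), e i⟫) (g := fun y => ⟪Φ y, e k⟫)
      (I2 k i) (by simpa only [hgd] using I1 k i) (I3 k i)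
      (fun x _ => (hf k i).differentiable (by norm_num) x)
      (fun x _ => (hg k).differentiable (by norm_num) x)
    simpa only [hgd] using this
  simp only [step]
  rw [Finset.sum_neg_distrib, ← integral_finsetSum _ fun i _ => I2 k i, neg_eq_zero]
  have z : ∀ x, ∑ i, fderiv ℝ (fun y => ⟪fderiv ℝ V y (e k), e i⟫) x (e i) * ⟪Φ x, e k⟫ = 0 := by
    intro x
    rw [← Finset.sum_mul]
    have key : ∀ i, fderiv ℝ (fun y => ⟪fderiv ℝ V y (e k), e i⟫) x (e i)
        = fderiv ℝ (fun y => ⟪fderiv ℝ V y (e i), e i⟫) x (e k) := by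
      intro i
      have hd : DifferentiableAt ℝ (fderiv ℝ V) x := hDV.differentiable (by norm_num) x
      rw [inner_fderiv ((hDVk k).differentiable (by norm_num) x),
        inner_fderiv ((hDVk i).differentiable (by norm_num) x)]
      have a : ∀ j v, fderiv ℝ (fun y => fderiv ℝ V y (e j)) x v = fderiv ℝ (fderiv ℝ V) x v (e j) := by
        intro j v
        rw [fderiv_clm_apply hd (differentiableAt_const _)]
        simp
      rw [a, a]
      have := (hV.contDiffAt (x := x)).isSymmSndFDerivAt (by simp)
      rw [this.eq]
    simp only [key]
    have : ∑ i, fderiv ℝ (fun y => ⟪fderiv ℝ V y (e i), e i⟫) x (e k)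
        = fderiv ℝ (fun y => ∑ i, ⟪fderiv ℝ V y (e i), e i⟫) x (e k) := by
      rw [fderiv_fun_sum fun i _ => (hf i i).differentiable (by norm_num) x]
      simp
    rw [this]
    simp [hdiv]
  simp only [z]
  simp

/-- derivative of `w^q` for `w = ‖G‖` -/
lemma norm_rpow_hasFDeriv {N : ℕ} (G : EN N → EN N) (x : EN N) (hG : DifferentiableAt ℝ G x)
    (hx : G x ≠ 0) (q : ℝ) :
    HasFDerivAt (fun y => ‖G y‖ ^ q)
      ((q * ‖G x‖ ^ (q - 2)) • ((innerSL ℝ (G x)).comp (fderiv ℝ G x))) x := by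
  have h1 : HasFDerivAt (fun y => ‖G y‖ ^ 2) (2 • (innerSL ℝ (G x)).comp (fderiv ℝ G x)) x :=
    hG.hasFDerivAt.norm_sq
  have hpos : 0 < ‖G x‖ := norm_pos_iff.2 hx
  have h2 := h1.rpow_const (p := q / 2) (Or.inl (by positivity))
  have e1 : (fun y => (‖G y‖ ^ 2) ^ (q / 2)) = fun y => ‖G y‖ ^ q := by
    funext y
    rw [← Real.rpow_natCast, ← Real.rpow_mul (norm_nonneg _)]
    congr 1; push_cast; ring
  rw [e1] at h2
  refine h2.congr_fderiv ?_
  have e2 : (‖G x‖ ^ 2) ^ (q / 2 - 1) = ‖G x‖ ^ (q - 2) := by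
    rw [← Real.rpow_natCast, ← Real.rpow_mul (norm_nonneg _)]
    congr 1; push_cast; ring
  rw [e2, ← Nat.cast_smul_eq_nsmul ℝ, smul_smul]
  congr 1; push_cast; ring

/-- existence of cutoff -/
lemma cutoff_exists (N : ℕ) {K : ℝ} (hK : 0 < K) (hKb : ∀ t, |deriv Real.smoothTransition t| ≤ K)
    (R σ : ℝ) (hR : 0 < R) (hσ : 0 < σ) :
    ∃ η : EN N → ℝ, ContDiff ℝ (⊤ : ℕ∞) η ∧ HasCompactSupport η ∧ (∀ x, 0 ≤ η x) ∧
      (∀ x ∈ ball (0 : EN N) R, η x = 1) ∧ (∀ x, x ∉ ball (0 : EN N) (R + σ) → gradient η x = 0)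
      ∧ ∀ x, ‖gradient η x‖ ≤ 2 * K / σ := by
  set L : ℝ := σ * (2 * R + σ) with hL
  have hL0 : 0 < L := by positivity
  set q : EN N → ℝ := fun x => ((R + σ) ^ 2 - ‖x‖ ^ 2) / L with hq
  have hqs : ContDiff ℝ (⊤ : ℕ∞) q := (contDiff_const.sub (contDiff_norm_sq ℝ)).div_const _
  have hηs : ContDiff ℝ (⊤ : ℕ∞) (fun x => Real.smoothTransition (q x)) :=
    Real.smoothTransition.contDiff.comp hqs
  have hqn : ∀ x, x ∉ ball (0 : EN N) (R + σ) → q x ≤ 0 := by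
    intro x hx
    rw [mem_ball_zero_iff, not_lt] at hx
    apply div_nonpos_of_nonpos_of_nonneg _ hL0.le
    have : (R + σ) ^ 2 ≤ ‖x‖ ^ 2 := by gcongr
    linarith
  have hgz : ∀ x, x ∉ ball (0 : EN N) (R + σ) →
      gradient (fun x => Real.smoothTransition (q x)) x = 0 := by
    intro x hx
    have : IsLocalMin (fun x => Real.smoothTransition (q x)) x := by
      refine Filter.Eventually.of_forall fun y => ?_
      simp only
      rw [Real.smoothTransition.zero_of_nonpos (hqn x hx)]
      exact Real.smoothTransition.nonneg _
    simp [gradient, this.fderiv_eq_zero]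
  refine ⟨fun x => Real.smoothTransition (q x), hηs, ?_, fun x => Real.smoothTransition.nonneg _,
    ?_, hgz, ?_⟩
  · refine HasCompactSupport.of_support_subset_isCompact (isCompact_closedBall (0 : EN N) (R + σ)) ?_
    intro x hx
    by_contra hx'
    exact hx (Real.smoothTransition.zero_of_nonpos (hqn x fun h => hx' (ball_subset_closedBall h)))
  · intro x hx
    rw [mem_ball_zero_iff] at hx
    apply Real.smoothTransition.one_of_one_le
    rw [hq, le_div_iff₀ hL0, hL]
    have : ‖x‖ ^ 2 ≤ R ^ 2 := by gcongr
    nlinarith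
  · intro x
    by_cases hx : x ∈ ball (0 : EN N) (R + σ)
    · rw [mem_ball_zero_iff] at hx
      have hqd : HasFDerivAt q ((-(2 / L)) • innerSL ℝ x) x := by
        have h1 : HasFDerivAt (fun y : EN N => ‖y‖ ^ 2) (2 • (innerSL ℝ x)) x := by
          simpa using (hasFDerivAt_id x).norm_sq
        have h2 := (h1.const_sub ((R + σ) ^ 2)).mul_const (L⁻¹)
        refine (h2.congr_fderiv ?_)
        ext v
        simp
        ring
      have hd : HasDerivAt Real.smoothTransition (deriv Real.smoothTransition (q x)) (q x) :=
        ((Real.smoothTransition.contDiff (n := 1)).differentiable (by norm_num) _).hasDerivAt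
      have h3 := hd.comp_hasFDerivAt x hqd
      have h4 : fderiv ℝ (fun x => Real.smoothTransition (q x)) x = _ := h3.fderiv
      rw [gradient, LinearIsometryEquiv.norm_map, h4, norm_smul, norm_smul, innerSL_apply_norm,
        Real.norm_eq_abs, Real.norm_eq_abs, abs_neg, abs_of_pos (by positivity : 0 < 2 / L)]
      have : 2 / L * ‖x‖ ≤ 2 / σ := by
        rw [hL, div_mul_eq_mul_div, div_le_div_iff₀ (by positivity) hσ]
        nlinarith [mul_pos hσ hR, mul_pos hσ (sub_pos.2 hx), mul_pos hσ hσ]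
      calc _ ≤ K * (2 / σ) := by gcongr; exact hKb _
        _ = 2 * K / σ := by ring
    · rw [hgz x hx]; simp; positivity

lemma gradient_contDiff {N : ℕ} {u : EN N → ℝ} (hu : ContDiff ℝ (⊤ : ℕ∞) u) :
    ContDiff ℝ (⊤ : ℕ∞) (gradient u) := by
  have h : ContDiff ℝ (⊤ : ℕ∞) (fderiv ℝ u) := hu.fderiv_right (by norm_num)
  exact ((InnerProductSpace.toDual ℝ (EN N)).symm.toContinuousLinearEquiv.contDiff).comp h

lemma inner_gradient {N : ℕ} {f : EN N → ℝ} (x v : EN N) :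
    ⟪gradient f x, v⟫ = fderiv ℝ f x v := by
  rw [← InnerProductSpace.toDual_apply_apply (𝕜 := ℝ), toDual_gradient]

lemma hessian_symm {N : ℕ} {u : EN N → ℝ} (hu : ContDiff ℝ (⊤ : ℕ∞) u) (x a b : EN N) :
    ⟪fderiv ℝ (gradient u) x a, b⟫ = ⟪a, fderiv ℝ (gradient u) x b⟫ := by
  have hG : DifferentiableAt ℝ (gradient u) x := (gradient_contDiff hu).differentiable (by simp) x
  have h : ContDiff ℝ (⊤ : ℕ∞) (fderiv ℝ u) := hu.fderiv_right (by norm_num)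
  have hd : DifferentiableAt ℝ (fderiv ℝ u) x := h.differentiable (by simp) x
  have key : ∀ a b, ⟪fderiv ℝ (gradient u) x a, b⟫ = fderiv ℝ (fderiv ℝ u) x a b := by
    intro a b
    rw [← inner_fderiv hG]
    simp only [inner_gradient]
    rw [fderiv_clm_apply hd (differentiableAt_const _)]
    simp
  rw [key, real_inner_comm, key]
  exact ((hu.contDiffAt (x := x)).isSymmSndFDerivAt (by simp; norm_cast)).eq a b

lemma pointwise_est {N : ℕ} {p : ℝ} (hp : 1 < p) {u : EN N → ℝ} (hu : ContDiff ℝ (⊤ : ℕ∞) u)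
    (hne : ∀ x, gradient u x ≠ 0) {lam : ℝ} (hl : 1 ≤ lam) {η : EN N → ℝ}
    (hη : ContDiff ℝ (⊤ : ℕ∞) η) (hη0 : ∀ x, 0 ≤ η x) (c M : ℝ) (hc : c = min 1 (p-1))
    (hM : M = 1 + |p-2|) (x : EN N) :
    η x ^ 2 * ‖gradient (fun y => ‖gradient u y‖ ^ ((p + lam) / 2)) x‖ ^ 2 ≤
      (2 * ((p + lam) / 2) ^ 2 / (c * (1 + lam))) * 
       (∑ k : Fin N, ∑ i : Fin N,
        ⟪fderiv ℝ (fun y => ‖gradient u y‖ ^ (p - 2) • gradient u y) x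
          (EuclideanSpace.single k 1), EuclideanSpace.single i 1⟫ *
        ⟪fderiv ℝ (fun y => (η y ^ 2 * ‖gradient u y‖ ^ lam) • gradient u y) x
          (EuclideanSpace.single i 1), EuclideanSpace.single k 1⟫)
      + p ^ 2 * M ^ 2 / c ^ 2 * (‖gradient u x‖ ^ (p + lam) * ‖gradient η x‖ ^ 2) := by
  have hG : DifferentiableAt ℝ (gradient u) x := (gradient_contDiff hu).differentiable (by simp) x
  have hs := hessian_symm hu x
  set G := gradient u with hGdef
  set H := fderiv ℝ G x with hH
  set h := H (G x) with hh
  have hGh : ∀ v, ⟪G x, H v⟫ = ⟪h, v⟫ := fun v => by rw [← hs]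
  have hw : 0 < ‖G x‖ := norm_pos_iff.2 (hne x)
  set w := ‖G x‖ with hwd
  have e4 : w ^ (p - 2 - 2) = w ^ (p - 2) / w ^ 2 := by
    rw [Real.rpow_sub hw (p-2) 2]; norm_num
  have e5 : w ^ (lam - 2) = w ^ lam / w ^ 2 := by
    rw [Real.rpow_sub hw lam 2]; norm_num
  have hηd : HasFDerivAt η (innerSL ℝ (gradient η x)) x := by
    refine ((hη.differentiable (by simp) x).hasFDerivAt).congr_fderiv ?_
    ext v; simp [inner_gradient]
  -- derivative of V
  have hA : ∀ v, fderiv ℝ (fun y => ‖G y‖ ^ (p - 2) • G y) x v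
      = w ^ (p - 2) • H v + ((p - 2) * (w ^ (p - 2) / w ^ 2) * ⟪h, v⟫) • G x := by
    intro v
    have := ((norm_rpow_hasFDeriv G x hG (hne x) (p - 2)).smul hG.hasFDerivAt).fderiv
    have t : fderiv ℝ (fun y => ‖G y‖ ^ (p - 2) • G y) x = _ := this
    rw [t, ← e4]
    simp [hGh, ← hH, ← hwd]
  have hB : ∀ v, fderiv ℝ (fun y => (η y ^ 2 * ‖G y‖ ^ lam) • G y) x v
      = (η x ^ 2 * w ^ lam) • H v + (η x ^ 2 * lam * (w ^ lam / w ^ 2) * ⟪h, v⟫) • G x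
        + (2 * η x * w ^ lam * ⟪gradient η x, v⟫) • G x := by
    intro v
    have := (((hηd.pow 2).mul (norm_rpow_hasFDeriv G x hG (hne x) lam)).smul hG.hasFDerivAt).fderiv
    have t : fderiv ℝ (fun y => (η y ^ 2 * ‖G y‖ ^ lam) • G y) x = _ := this
    rw [t, ← e5, add_assoc, ← add_smul]
    simp only [add_apply, smul_apply,
      ContinuousLinearMap.smulRight_apply, ContinuousLinearMap.comp_apply, innerSL_apply_apply,
      smul_eq_mul, hGh, ← hH, ← hwd]
    congr 2
    simp
    ring
  rw [trace_calc H _ _ (G x) h (gradient η x) hs rfl _ _ _ _ _ hA hB]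
  have hS := hs_bound H (G x) h hs rfl
  set S := ∑ k : Fin N, ‖H (EuclideanSpace.single k 1)‖ ^ 2
  have alg := alg_ineq p lam w S ⟪G x, h⟫ ⟪h, gradient η x⟫ ⟪G x, gradient η x⟫ (η x)
    ‖gradient η x‖ ‖h‖ c M hc hM hp hl hw hS (hη0 x) (norm_nonneg _)
    (abs_real_inner_le_norm _ _) (abs_real_inner_le_norm _ _) (abs_real_inner_le_norm _ _)
  have hgr : ‖gradient (fun y => ‖G y‖ ^ ((p + lam) / 2)) x‖ ^ 2
      = ((p + lam) / 2) ^ 2 * (w ^ (p - 2) * w ^ lam * (‖h‖ ^ 2 / w ^ 2)) := by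
    have t := (norm_rpow_hasFDeriv G x hG (hne x) ((p + lam) / 2)).fderiv
    have t2 : (innerSL ℝ (G x)).comp H = innerSL ℝ h := by
      ext v; simp [hGh]
    rw [gradient, LinearIsometryEquiv.norm_map, t, ← hH, t2, norm_smul, innerSL_apply_norm, mul_pow,
      Real.norm_eq_abs, sq_abs, mul_pow, ← hwd]
    have : (w ^ ((p + lam) / 2 - 2)) ^ 2 = w ^ (p - 2) * w ^ lam / w ^ 2 := by
      rw [← Real.rpow_natCast, ← Real.rpow_mul hw.le, ← Real.rpow_add hw, ← Real.rpow_natCast w 2,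
        ← Real.rpow_sub hw]
      congr 1; push_cast; ring
    rw [this]; ring
  have e6 : w ^ (p + lam) = w ^ (p - 2) * w ^ lam * w ^ 2 := by
    rw [← Real.rpow_natCast w 2, ← Real.rpow_add hw, ← Real.rpow_add hw]
    congr 1; push_cast; ring
  rw [hgr, e6]
  have hP : 0 < w ^ (p - 2) := Real.rpow_pos_of_pos hw _
  have hQ : 0 < w ^ lam := Real.rpow_pos_of_pos hw _
  generalize w ^ (p - 2) = P at *
  generalize w ^ lam = Q at *
  have hc0 : 0 < c := by rw [hc]; exact lt_min one_pos (by linarith)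
  have hX : 0 < c * (1 + lam) := by positivity
  have hq : 4 * ((p + lam) / 2) ^ 2 * M ^ 2 / (c * (1 + lam)) ^ 2 ≤ p ^ 2 * M ^ 2 / c ^ 2 := by
    have : (p + lam) ≤ p * (1 + lam) := by nlinarith
    rw [div_le_div_iff₀ (by positivity) (by positivity)]
    calc 4 * ((p + lam) / 2) ^ 2 * M ^ 2 * c ^ 2 = (p + lam) ^ 2 * (M ^ 2 * c ^ 2) := by ring
      _ ≤ (p * (1 + lam)) ^ 2 * (M ^ 2 * c ^ 2) := by gcongr
      _ = _ := by ring
  set X := c * (1 + lam) with hXd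
  set q := (p + lam) / 2
  set z := ‖gradient η x‖
  have step2 := mul_le_mul_of_nonneg_left alg (by positivity : 0 ≤ 2 * q ^ 2 / X * (P * Q))
  have step3 := mul_le_mul_of_nonneg_right hq (by positivity : 0 ≤ P * Q * w ^ 2 * z ^ 2)
  have id1 : 2 * q ^ 2 / X * (P * Q) * (X / 2 * (η x ^ 2 * (‖h‖ ^ 2 / w ^ 2)) -
      2 * M ^ 2 / X * (w ^ 2 * z ^ 2)) = η x ^ 2 * (q ^ 2 * (P * Q * (‖h‖ ^ 2 / w ^ 2)))
      - 4 * q ^ 2 * M ^ 2 / X ^ 2 * (P * Q * w ^ 2 * z ^ 2) := by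
    field_simp; ring
  rw [id1] at step2
  refine (sub_le_iff_le_add.1 step2).trans (add_le_add (le_of_eq ?_) step3)
  field_simp
  ring

/-- Higher-integrability Caccioppoli estimate for `|∇u|^{(p+λ)/2}` for a smooth
p-harmonic function with nowhere vanishing gradient. -/
theorem caccioppoli_gradient_power
    (N : ℕ) (hN : 1 ≤ N) (p : ℝ) (hp : 1 < p) :
    ∃ C : ℝ, 0 < C ∧
      ∀ u : EuclideanSpace ℝ (Fin N) → ℝ,
        ContDiff ℝ (⊤ : ℕ∞) u →
        (∀ x, gradient u x ≠ 0) →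
        -- pointwise p-harmonicity: div(|∇u|^{p-2} ∇u) = 0
        (∀ x, ∑ i : Fin N,
            ⟪fderiv ℝ (fun y => ‖gradient u y‖ ^ (p - 2) • gradient u y) x
                (EuclideanSpace.single i 1),
              EuclideanSpace.single i 1⟫ = 0) →
        ∀ lam : ℝ, 1 ≤ lam → ∀ R σ : ℝ, 0 < R → 0 < σ →
          ∫ x in ball (0 : EuclideanSpace ℝ (Fin N)) R,
              ‖gradient (fun y => ‖gradient u y‖ ^ ((p + lam) / 2)) x‖ ^ 2
            ≤ C / σ ^ 2 *
              ∫ x in ball (0 : EuclideanSpace ℝ (Fin N)) (R + σ),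
                ‖gradient u x‖ ^ (p + lam) := by
  obtain ⟨K, hK, hKb⟩ := cutoff_bound
  obtain ⟨c, hc⟩ : ∃ c, c = min 1 (p - 1) := ⟨_, rfl⟩
  obtain ⟨M, hM⟩ : ∃ M, M = 1 + |p - 2| := ⟨_, rfl⟩
  have hc0 : 0 < c := by rw [hc]; exact lt_min one_pos (by linarith)
  have hM0 : 0 < M := by rw [hM]; positivity
  refine ⟨p ^ 2 * M ^ 2 / c ^ 2 * (2 * K) ^ 2, by positivity, ?_⟩
  intro u hu hne hdiv lam hl R σ hR hσ
  obtain ⟨η, hη, hηc, hη0, hη1, hηz, hηb⟩ := cutoff_exists N hK hKb R σ hR hσ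
  have hG := gradient_contDiff hu
  have hwq : ∀ q : ℝ, ContDiff ℝ (⊤ : ℕ∞) (fun y => ‖gradient u y‖ ^ q) := fun q =>
    (hG.norm ℝ hne).rpow_const_of_ne fun x => (norm_pos_iff.2 (hne x)).ne'
  have hV : ContDiff ℝ (⊤ : ℕ∞) (fun y => ‖gradient u y‖ ^ (p - 2) • gradient u y) :=
    (hwq _).smul hG
  have hΦ : ContDiff ℝ (⊤ : ℕ∞) (fun y => (η y ^ 2 * ‖gradient u y‖ ^ lam) • gradient u y) :=
    ((hη.pow 2).mul (hwq _)).smul hG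
  have hΦc : HasCompactSupport (fun y => (η y ^ 2 * ‖gradient u y‖ ^ lam) • gradient u y) := by
    refine hηc.mono fun x hx => ?_
    rw [Function.mem_support] at hx ⊢
    intro h0
    exact hx (by simp [h0])
  obtain ⟨hTi, hT0⟩ := ibp_zero _ _ (hV.of_le (by norm_cast)) (hΦ.of_le (by norm_cast)) hΦc hdiv
  have hpt := pointwise_est hp hu hne hl hη hη0 c M hc hM
  set T : EN N → ℝ := fun x => ∑ k : Fin N, ∑ i : Fin N,
        ⟪fderiv ℝ (fun y => ‖gradient u y‖ ^ (p - 2) • gradient u y) x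
          (EuclideanSpace.single k 1), EuclideanSpace.single i 1⟫ *
        ⟪fderiv ℝ (fun y => (η y ^ 2 * ‖gradient u y‖ ^ lam) • gradient u y) x
          (EuclideanSpace.single i 1), EuclideanSpace.single k 1⟫ with hT
  change ∫ x, T x = 0 at hT0
  set A := 2 * ((p + lam) / 2) ^ 2 / (c * (1 + lam))
  set B := p ^ 2 * M ^ 2 / c ^ 2 with hB
  have hB0 : 0 < B := by positivity
  set F : EN N → ℝ := fun x => ‖gradient (fun y => ‖gradient u y‖ ^ ((p + lam) / 2)) x‖ ^ 2 with hF
  set Wf : EN N → ℝ := fun x => ‖gradient u x‖ ^ (p + lam) with hW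
  have hWi : IntegrableOn Wf (ball (0 : EN N) (R + σ)) :=
    ((hwq (p + lam)).continuous.continuousOn.integrableOn_compact
      (isCompact_closedBall (0 : EN N) (R + σ))).mono_set ball_subset_closedBall
  rw [← integral_indicator measurableSet_ball, ← integral_indicator measurableSet_ball]
  have hWi' := hWi.integrable_indicator measurableSet_ball
  have hint : Integrable (fun x => A * T x + B * (2 * K) ^ 2 / σ ^ 2 *
      (ball (0 : EN N) (R + σ)).indicator Wf x) := (hTi.const_mul A).add (hWi'.const_mul _)
  have hle : ∫ x, (ball (0 : EN N) R).indicator F x ≤ ∫ x, (A * T x + B * (2 * K) ^ 2 / σ ^ 2 *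
      (ball (0 : EN N) (R + σ)).indicator Wf x) := by
    refine integral_mono_of_nonneg (Filter.Eventually.of_forall fun x => ?_) hint
      (Filter.Eventually.of_forall fun x => ?_)
    · exact Set.indicator_nonneg (fun x _ => by positivity) x
    · have h1 : (ball (0 : EN N) R).indicator F x ≤ η x ^ 2 * F x := by
        by_cases hx : x ∈ ball (0 : EN N) R
        · rw [Set.indicator_of_mem hx, hη1 x hx]; simp
        · rw [Set.indicator_of_notMem hx]; positivity
      have h2 : Wf x * ‖gradient η x‖ ^ 2 ≤ (2 * K) ^ 2 / σ ^ 2 *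
          (ball (0 : EN N) (R + σ)).indicator Wf x := by
        by_cases hx : x ∈ ball (0 : EN N) (R + σ)
        · rw [Set.indicator_of_mem hx, mul_comm, ← div_pow]
          have hw0 : 0 ≤ Wf x := by positivity
          gcongr
          exact hηb x
        · rw [Set.indicator_of_notMem hx, hηz x hx]; simp
      have h3 : B * (Wf x * ‖gradient η x‖ ^ 2) ≤ B * ((2 * K) ^ 2 / σ ^ 2 *
          (ball (0 : EN N) (R + σ)).indicator Wf x) := by gcongr
      have h4 : η x ^ 2 * F x ≤ A * T x + B * (Wf x * ‖gradient η x‖ ^ 2) := hpt x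
      simp only
      calc _ ≤ _ := h1
        _ ≤ _ := h4
        _ ≤ _ := add_le_add le_rfl h3
        _ = _ := by ring
  refine hle.trans (le_of_eq ?_)
  rw [integral_add (hTi.const_mul A) (hWi'.const_mul _), integral_const_mul, integral_const_mul, hT0]
  ring
end

section
/- Let N ≥ 1, p > 1, and let Ω ⊂ ℝ^N be a bounded open set. Let u, φ : ℝ^N → ℝ be continuous on the closure of Ω and C¹ on Ω, and suppose: (i) ∫_Ω |∇u(x)|^{p−2}⟨∇u(x), ∇ψ(x)⟩ dx ≥ 0 for every nonnegative C^∞ function ψ compactly supported in Ω; (ii) ∫_Ω |∇φ(x)|^{p−2}⟨∇φ(x), ∇ψ(x)⟩ dx = 0 for every C^∞ function ψ compactly supported in Ω; (iii) u(x) ≥ φ(x) for every x ∈ ∂Ω. Then u(x) ≥ φ(x) for every x ∈ Ω. -/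
open MeasureTheory Metric
open scoped RealInnerProductSpace


section aux

variable {N : ℕ}

/-- The nonlinearity `V a = |a|^(p-2) a`. -/
noncomputable def plapV (p : ℝ) (a : EuclideanSpace ℝ (Fin N)) : EuclideanSpace ℝ (Fin N) := ‖a‖ ^ (p - 2) • a

lemma plapV_norm {p : ℝ} (hp : 1 < p) (r : ℝ) (hr : 0 ≤ r) :
    r ^ (p - 2) * r = r ^ (p - 1) := by
  rcases hr.eq_or_lt with rfl | h
  · rw [mul_zero, Real.zero_rpow (by linarith)]
  · rw [← Real.rpow_add_one h.ne']; congr 1; ring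

lemma plapV_continuous {p : ℝ} (hp : 1 < p) : Continuous (plapV (N := N) p) := by
  rw [continuous_iff_continuousAt]
  intro a
  by_cases ha : a = 0
  · subst ha
    have h0 : plapV p (0 : EuclideanSpace ℝ (Fin N)) = 0 := by simp [plapV]
    rw [ContinuousAt, h0, tendsto_zero_iff_norm_tendsto_zero]
    have h1 : (fun x : EuclideanSpace ℝ (Fin N) => ‖plapV p x‖) = fun x => ‖x‖ ^ (p - 1) := by
      ext x
      rw [plapV, norm_smul, Real.norm_of_nonneg (by positivity), plapV_norm hp _ (norm_nonneg x)]
    rw [h1]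
    have : Continuous (fun x : EuclideanSpace ℝ (Fin N) => ‖x‖ ^ (p - 1)) :=
      continuous_norm.rpow_const (fun _ => Or.inr (by linarith))
    have h2 := this.tendsto (0 : EuclideanSpace ℝ (Fin N))
    simpa [Real.zero_rpow (by linarith : p - 1 ≠ 0)] using h2
  · unfold plapV
    exact (continuousAt_id.norm.rpow_const (Or.inl (by simpa using ha))).smul continuousAt_id

lemma plapV_mono {p : ℝ} (hp : 1 < p) (a b : EuclideanSpace ℝ (Fin N)) (hab : a ≠ b) :
    0 < ⟪plapV p a - plapV p b, a - b⟫ := by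
  have hA := plapV_norm hp _ (norm_nonneg a)
  have hB := plapV_norm hp _ (norm_nonneg b)
  have hα : 0 ≤ ‖a‖ ^ (p - 2) := by positivity
  have hβ : 0 ≤ ‖b‖ ^ (p - 2) := by positivity
  have hx := real_inner_le_norm a b
  have key : ⟪plapV p a - plapV p b, a - b⟫ =
      (‖a‖ ^ (p - 2) + ‖b‖ ^ (p - 2)) * (‖a‖ * ‖b‖ - ⟪a, b⟫)
      + (‖a‖ ^ (p - 1) - ‖b‖ ^ (p - 1)) * (‖a‖ - ‖b‖) := by
    rw [← hA, ← hB]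
    simp only [plapV, inner_sub_left, inner_sub_right, real_inner_smul_left,
      real_inner_self_eq_norm_sq, real_inner_comm b a]
    ring
  have h1 : 0 ≤ (‖a‖ ^ (p - 2) + ‖b‖ ^ (p - 2)) * (‖a‖ * ‖b‖ - ⟪a, b⟫) :=
    mul_nonneg (by linarith) (by linarith)
  rw [key]
  rcases lt_trichotomy ‖a‖ ‖b‖ with h | h | h
  · have := Real.rpow_lt_rpow (norm_nonneg a) h (by linarith : 0 < p - 1)
    nlinarith
  · have hb : 0 < ‖b‖ := by
      rw [norm_pos_iff]; rintro rfl
      rw [norm_zero, norm_eq_zero] at h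
      exact hab h
    have h3 : 0 < ‖a - b‖ ^ 2 := by
      have := norm_pos_iff.2 (sub_ne_zero.2 hab); positivity
    rw [norm_sub_sq_real] at h3
    have h4 : 0 < ‖b‖ ^ (p - 2) := by positivity
    rw [h] at h3 ⊢
    have h5 : 0 < ‖b‖ * ‖b‖ - ⟪a, b⟫ := by nlinarith
    have := mul_pos (add_pos h4 h4) h5
    linarith
  · have := Real.rpow_lt_rpow (norm_nonneg b) h (by linarith : 0 < p - 1)
    nlinarith

lemma gradient_dist (f g : (EuclideanSpace ℝ (Fin N)) → ℝ) (x : EuclideanSpace ℝ (Fin N)) :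
    ‖gradient f x - gradient g x‖ = ‖fderiv ℝ f x - fderiv ℝ g x‖ := by
  unfold gradient
  rw [← map_sub, LinearIsometryEquiv.norm_map]

lemma gradient_cont {f : (EuclideanSpace ℝ (Fin N)) → ℝ} (hf : ContDiff ℝ 1 f) : Continuous (gradient f) := by
  unfold gradient
  exact (LinearIsometryEquiv.continuous _).comp (hf.continuous_fderiv one_ne_zero)

lemma gradient_contOn {f : (EuclideanSpace ℝ (Fin N)) → ℝ} {Ω : Set (EuclideanSpace ℝ (Fin N))} (hΩ : IsOpen Ω) (hf : ContDiffOn ℝ 1 f Ω) :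
    ContinuousOn (gradient f) Ω := by
  unfold gradient
  exact (LinearIsometryEquiv.continuous _).comp_continuousOn
    (hf.continuousOn_fderiv_of_isOpen hΩ le_rfl)

lemma gradient_off {f : (EuclideanSpace ℝ (Fin N)) → ℝ} {x : EuclideanSpace ℝ (Fin N)} (hx : x ∉ tsupport f) : gradient f x = 0 := by
  have : fderiv ℝ f x = 0 := by
    by_contra h
    exact hx (support_fderiv_subset ℝ h)
  simp [gradient, this]

open scoped Convolution in
lemma mollify {η : (EuclideanSpace ℝ (Fin N)) → ℝ} (hη : ContDiff ℝ 1 η) (hc : HasCompactSupport η)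
    (h0 : ∀ x, 0 ≤ η x) {r : ℝ} (hr : 0 < r) {ε : ℝ} (hε : 0 < ε) :
    ∃ ψ : (EuclideanSpace ℝ (Fin N)) → ℝ, ContDiff ℝ (⊤ : ℕ∞) ψ ∧ (∀ x, 0 ≤ ψ x) ∧
      tsupport ψ ⊆ cthickening r (tsupport η) ∧ ∀ x, ‖gradient ψ x - gradient η x‖ ≤ ε := by
  have huc : UniformContinuous (fderiv ℝ η) :=
    (hc.fderiv ℝ).uniformContinuous_of_continuous (hη.continuous_fderiv one_ne_zero)
  obtain ⟨δ, hδ, hδ'⟩ := Metric.uniformContinuous_iff.1 huc ε hε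
  have hm : 0 < min r δ := lt_min hr hδ
  let ρ : ContDiffBump (0 : EuclideanSpace ℝ (Fin N)) := ⟨min r δ / 2, min r δ, by positivity, by linarith⟩
  have hρ : ρ.rOut = min r δ := rfl
  have hli : LocallyIntegrable η (volume : Measure (EuclideanSpace ℝ (Fin N))) := hη.continuous.locallyIntegrable
  refine ⟨ρ.normed volume ⋆[ContinuousLinearMap.lsmul ℝ ℝ, volume] η, ?_, ?_, ?_, ?_⟩
  · exact ρ.hasCompactSupport_normed.contDiff_convolution_left _ ρ.contDiff_normed hli
  · intro x
    rw [convolution_def]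
    refine integral_nonneg fun t => ?_
    simpa using mul_nonneg (ρ.nonneg_normed t) (h0 _)
  · refine closure_minimal ?_ isClosed_cthickening
    refine (support_convolution_subset _).trans ?_
    rw [ρ.support_normed_eq]
    rintro _ ⟨t, ht, y, hy, rfl⟩
    refine mem_cthickening_of_dist_le _ y _ _ (subset_tsupport _ hy) ?_
    rw [mem_ball_zero_iff, hρ] at ht
    simpa using ht.le.trans (min_le_left _ _)
  · intro x
    rw [gradient_dist]
    have hd := hc.hasFDerivAt_convolution_right (ContinuousLinearMap.lsmul ℝ ℝ)
      (μ := volume) (f := ρ.normed volume) ρ.continuous_normed.locallyIntegrable hη x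
    rw [hd.fderiv, ← dist_eq_norm]
    have h1 := ρ.dist_normed_convolution_le (μ := volume) (g := fderiv ℝ η) (x₀ := x) (ε := ε)
      (hη.continuous_fderiv one_ne_zero).aestronglyMeasurable
      (fun y hy => (hδ' (lt_of_lt_of_le (mem_ball.1 hy) (min_le_right _ _))).le)
    exact h1

lemma pair_cont {F : (EuclideanSpace ℝ (Fin N)) → EuclideanSpace ℝ (Fin N)} {Ω : Set (EuclideanSpace ℝ (Fin N))} (hΩ : IsOpen Ω) (hF : ContinuousOn F Ω)
    {η : (EuclideanSpace ℝ (Fin N)) → ℝ} (hη : ContDiff ℝ 1 η) (hs : tsupport η ⊆ Ω) :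
    Continuous (fun x => ⟪F x, gradient η x⟫) := by
  refine continuous_of_tsupport fun x hx => ?_
  have hsub : tsupport (fun x => ⟪F x, gradient η x⟫) ⊆ tsupport η := by
    refine closure_minimal (fun y hy => ?_) (isClosed_tsupport _)
    by_contra h
    exact hy (by simp [gradient_off h])
  exact (hF.continuousAt (hΩ.mem_nhds (hs (hsub hx)))).inner (𝕜 := ℝ)
    (gradient_cont hη).continuousAt

lemma pair_supp {F : (EuclideanSpace ℝ (Fin N)) → EuclideanSpace ℝ (Fin N)} {η : (EuclideanSpace ℝ (Fin N)) → ℝ} (hc : HasCompactSupport η) :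
    HasCompactSupport (fun x => ⟪F x, gradient η x⟫) :=
  HasCompactSupport.intro hc fun x hx => by simp [gradient_off hx]

lemma approx {F : (EuclideanSpace ℝ (Fin N)) → EuclideanSpace ℝ (Fin N)} {Ω : Set (EuclideanSpace ℝ (Fin N))} (hΩ : IsOpen Ω) (hF : ContinuousOn F Ω)
    {η : (EuclideanSpace ℝ (Fin N)) → ℝ} (hη : ContDiff ℝ 1 η) (hc : HasCompactSupport η) (hs : tsupport η ⊆ Ω)
    (h0 : ∀ x, 0 ≤ η x)
    (h : ∀ ψ : (EuclideanSpace ℝ (Fin N)) → ℝ,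
      ContDiff ℝ (⊤ : ℕ∞) ψ → HasCompactSupport ψ → tsupport ψ ⊆ Ω → (∀ x, 0 ≤ ψ x) →
      0 ≤ ∫ x in Ω, ⟪F x, gradient ψ x⟫) :
    0 ≤ ∫ x, ⟪F x, gradient η x⟫ := by
  obtain ⟨r, hr, hrΩ⟩ := IsCompact.exists_cthickening_subset_open hc hΩ hs
  set K := cthickening r (tsupport η) with hK
  have hKc : IsCompact K := IsCompact.cthickening hc
  obtain ⟨M, hM⟩ := hKc.exists_bound_of_continuousOn (hF.mono hrΩ)
  have hM' : ∀ x ∈ K, ‖F x‖ ≤ |M| := fun x hx => (hM x hx).trans (le_abs_self M)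
  have hηK : tsupport η ⊆ K := self_subset_cthickening _
  refine le_of_forall_pos_le_add fun e he => ?_
  set C := |M| * volume.real K with hC
  have hC0 : 0 ≤ C := by positivity
  obtain ⟨ψ, hψ, hψ0, hψs, hψd⟩ := mollify hη hc h0 hr (ε := e / (C + 1)) (by positivity)
  have hψc : HasCompactSupport ψ := hKc.of_isClosed_subset (isClosed_tsupport _) hψs
  have hψΩ := hψs.trans hrΩ
  have hψ1 : ContDiff ℝ 1 ψ := hψ.of_le (by exact_mod_cast le_top)
  have h1 := h ψ hψ hψc hψΩ hψ0
  rw [setIntegral_eq_integral_of_forall_compl_eq_zero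
    (fun x hx => by simp [gradient_off (fun hh => hx (hψΩ hh))])] at h1
  have i1 : Integrable (fun x => ⟪F x, gradient ψ x⟫) :=
    (pair_cont hΩ hF hψ1 hψΩ).integrable_of_hasCompactSupport (pair_supp hψc)
  have i2 : Integrable (fun x => ⟪F x, gradient η x⟫) :=
    (pair_cont hΩ hF hη hs).integrable_of_hasCompactSupport (pair_supp hc)
  have h2 : ‖(∫ x, ⟪F x, gradient ψ x⟫) - ∫ x, ⟪F x, gradient η x⟫‖ ≤ e := by
    rw [← integral_sub i1 i2]
    rw [← setIntegral_eq_integral_of_forall_compl_eq_zero (s := K)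
      (fun x hx => by
        simp [gradient_off (fun hh => hx (hψs hh)), gradient_off (fun hh => hx (hηK hh))])]
    refine (norm_setIntegral_le_of_norm_le_const (C := |M| * (e / (C + 1)))
      hKc.measure_lt_top (fun x hx => ?_)).trans ?_
    · rw [← inner_sub_right]
      exact (norm_inner_le_norm _ _).trans
        (mul_le_mul (hM' x hx) (hψd x) (norm_nonneg _) (abs_nonneg _))
    · have : |M| * (e / (C + 1)) * volume.real K = e * (C / (C + 1)) := by rw [hC]; ring
      rw [this]
      have : C / (C + 1) ≤ 1 := by rw [div_le_one (by positivity)]; linarith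
      nlinarith
  rw [Real.norm_eq_abs, abs_le] at h2
  linarith [h2.2]

lemma glue_deriv_pos {t : ℝ} (ht : 0 < t) : 0 < deriv expNegInvGlue t := by
  have h : HasDerivAt (fun s : ℝ => Real.exp (-s⁻¹)) (Real.exp (-t⁻¹) * -(-(t ^ 2)⁻¹)) t :=
    ((hasDerivAt_inv ht.ne').neg).exp
  have he : expNegInvGlue =ᶠ[nhds t] fun s : ℝ => Real.exp (-s⁻¹) := by
    filter_upwards [lt_mem_nhds ht] with s hs
    simp [expNegInvGlue, not_le.2 hs]
  rw [he.deriv_eq, h.deriv]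
  have : 0 < Real.exp (-t⁻¹) := Real.exp_pos _
  rw [neg_neg]; positivity

lemma glue_deriv_nonneg (t : ℝ) : 0 ≤ deriv expNegInvGlue t :=
  expNegInvGlue.monotone.deriv_nonneg

end aux

/-- Comparison principle: if `-Δ_p u ≥ 0 = -Δ_p φ` weakly in a bounded open set `Ω`
and `u ≥ φ` on `∂Ω`, then `u ≥ φ` in `Ω`. -/
theorem p_laplacian_comparison
    (N : ℕ) (hN : 1 ≤ N) (p : ℝ) (hp : 1 < p)
    (Ω : Set (EuclideanSpace ℝ (Fin N))) (hΩo : IsOpen Ω) (hΩb : Bornology.IsBounded Ω)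
    (u φ : EuclideanSpace ℝ (Fin N) → ℝ)
    (hu_cont : ContinuousOn u (closure Ω)) (hφ_cont : ContinuousOn φ (closure Ω))
    (hu_C1 : ContDiffOn ℝ 1 u Ω) (hφ_C1 : ContDiffOn ℝ 1 φ Ω)
    (hu_super : ∀ ψ : EuclideanSpace ℝ (Fin N) → ℝ,
      ContDiff ℝ (⊤ : ℕ∞) ψ → HasCompactSupport ψ → tsupport ψ ⊆ Ω → (∀ x, 0 ≤ ψ x) →
      0 ≤ ∫ x in Ω, ‖gradient u x‖ ^ (p - 2) * ⟪gradient u x, gradient ψ x⟫)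
    (hφ_harm : ∀ ψ : EuclideanSpace ℝ (Fin N) → ℝ,
      ContDiff ℝ (⊤ : ℕ∞) ψ → HasCompactSupport ψ → tsupport ψ ⊆ Ω →
      ∫ x in Ω, ‖gradient φ x‖ ^ (p - 2) * ⟪gradient φ x, gradient ψ x⟫ = 0)
    (hbdry : ∀ x ∈ frontier Ω, φ x ≤ u x) :
    ∀ x ∈ Ω, φ x ≤ u x := by
  intro x₀ hx₀
  by_contra hcon
  rw [not_le] at hcon
  obtain ⟨ε, hε, hε'⟩ := exists_between (sub_pos.2 hcon)
  set g := expNegInvGlue with hg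
  have hg1 : ContDiff ℝ 1 g := expNegInvGlue.contDiff (n := 1)
  set η : EuclideanSpace ℝ (Fin N) → ℝ := Ω.indicator (fun x => g (φ x - u x - ε)) with hηdef
  have hηΩ : ∀ x ∈ Ω, η x = g (φ x - u x - ε) := fun x hx => Set.indicator_of_mem hx _
  have h0 : ∀ x, 0 ≤ η x := fun x => Set.indicator_nonneg (fun y _ => expNegInvGlue.nonneg _) x
  -- support of η
  set K := closure Ω ∩ (fun x => φ x - u x) ⁻¹' Set.Ici ε with hK
  have hKcl : IsClosed K :=
    (hφ_cont.sub hu_cont).preimage_isClosed_of_isClosed isClosed_closure isClosed_Ici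
  have hKc : IsCompact K := isCompact_of_isClosed_isBounded hKcl
    (hΩb.closure.subset Set.inter_subset_left)
  have hKΩ : K ⊆ Ω := by
    rintro x ⟨hx, hx2⟩
    by_contra hxo
    have : x ∈ frontier Ω := by rw [hΩo.frontier_eq]; exact ⟨hx, hxo⟩
    have h1 := hbdry x this
    have h2 : ε ≤ φ x - u x := hx2
    linarith
  have hsK : tsupport η ⊆ K := by
    refine closure_minimal (fun x hx => ?_) hKcl
    have hxΩ : x ∈ Ω := by
      by_contra hxo
      exact hx (Set.indicator_of_notMem hxo _)
    refine ⟨subset_closure hxΩ, ?_⟩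
    have h1 : η x ≠ 0 := hx
    rw [hηΩ x hxΩ, hg, Ne, expNegInvGlue.zero_iff_nonpos, not_le] at h1
    show ε ≤ φ x - u x
    linarith
  have hc : HasCompactSupport η := hKc.of_isClosed_subset (isClosed_tsupport _) hsK
  have hs : tsupport η ⊆ Ω := hsK.trans hKΩ
  have hev : ∀ x ∈ Ω, η =ᶠ[nhds x] fun x => g (φ x - u x - ε) := fun x hx => by
    filter_upwards [hΩo.mem_nhds hx] with y hy using hηΩ y hy
  have hη : ContDiff ℝ 1 η := by
    rw [contDiff_iff_contDiffAt]
    intro x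
    by_cases hx : x ∈ tsupport η
    swap
    · exact contDiffAt_const.congr_of_eventuallyEq (notMem_tsupport_iff_eventuallyEq.1 hx)
    have hn := hΩo.mem_nhds (hs hx)
    exact ContDiffAt.congr_of_eventuallyEq
      (hg1.contDiffAt.comp x
        (((hφ_C1.contDiffAt hn).sub (hu_C1.contDiffAt hn)).sub contDiffAt_const))
      (hev x (hs hx))
  have hgrad : ∀ x ∈ Ω, gradient η x =
      deriv g (φ x - u x - ε) • (gradient φ x - gradient u x) := by
    intro x hx
    have hn := hΩo.mem_nhds hx
    have d1 : HasFDerivAt φ (fderiv ℝ φ x) x :=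
      ((hφ_C1.contDiffAt hn).differentiableAt one_ne_zero).hasFDerivAt
    have d2 : HasFDerivAt u (fderiv ℝ u x) x :=
      ((hu_C1.contDiffAt hn).differentiableAt one_ne_zero).hasFDerivAt
    have d3 := ((hg1.differentiable one_ne_zero) (φ x - u x - ε)).hasDerivAt.comp_hasFDerivAt x
      ((d1.sub d2).sub_const ε)
    have d4 : fderiv ℝ η x = deriv g (φ x - u x - ε) • (fderiv ℝ φ x - fderiv ℝ u x) :=
      (d3.congr_of_eventuallyEq (hev x hx)).fderiv
    unfold gradient
    rw [d4, ← map_sub, map_smul]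
  have cu : ContinuousOn (fun x => plapV p (gradient u x)) Ω :=
    (plapV_continuous hp).comp_continuousOn (gradient_contOn hΩo hu_C1)
  have cφ : ContinuousOn (fun x => plapV p (gradient φ x)) Ω :=
    (plapV_continuous hp).comp_continuousOn (gradient_contOn hΩo hφ_C1)
  have I1 := approx hΩo cu hη hc hs h0 (fun ψ a b c d => by
    simpa only [plapV, real_inner_smul_left] using hu_super ψ a b c d)
  have I2 := approx hΩo cφ.neg hη hc hs h0 (fun ψ a b c d => by
    have := hφ_harm ψ a b c
    simp only [plapV, real_inner_smul_left, inner_neg_left, integral_neg, Pi.neg_apply]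
    rw [this, neg_zero])
  have i1 : Integrable (fun x => ⟪plapV p (gradient u x), gradient η x⟫) :=
    (pair_cont hΩo cu hη hs).integrable_of_hasCompactSupport (pair_supp hc)
  have i2 : Integrable (fun x => ⟪plapV p (gradient φ x), gradient η x⟫) :=
    (pair_cont hΩo cφ hη hs).integrable_of_hasCompactSupport (pair_supp hc)
  set D : EuclideanSpace ℝ (Fin N) → ℝ :=
    fun x => ⟪plapV p (gradient φ x) - plapV p (gradient u x), gradient η x⟫ with hD
  have hDc : Continuous D := pair_cont hΩo (cφ.sub cu) hη hs
  have hDs : HasCompactSupport D := pair_supp hc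
  have hDΩ : ∀ x ∈ Ω, D x = deriv g (φ x - u x - ε) *
      ⟪plapV p (gradient φ x) - plapV p (gradient u x), gradient φ x - gradient u x⟫ := by
    intro x hx
    simp only [hD, hgrad x hx, real_inner_smul_right]
  have hD0 : 0 ≤ D := by
    intro x
    by_cases hx : x ∈ Ω
    · rw [hDΩ x hx]
      refine mul_nonneg (glue_deriv_nonneg _) ?_
      by_cases hab : gradient φ x = gradient u x
      · simp [hab]
      · exact (plapV_mono hp _ _ hab).le
    · have h1 : D x = 0 := by
        simp only [hD, gradient_off (fun hh => hx (hs hh)), inner_zero_right]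
      exact h1.ge
  have hDint : ∫ x, D x ≤ 0 := by
    have : ∫ x, D x = (∫ x, ⟪plapV p (gradient φ x), gradient η x⟫) -
        ∫ x, ⟪plapV p (gradient u x), gradient η x⟫ := by
      rw [← integral_sub i2 i1]
      simp only [hD, inner_sub_left]
    rw [this]
    simp only [inner_neg_left, integral_neg, Pi.neg_apply] at I2
    linarith
  have hDz : ∀ x, D x = 0 := by
    intro x
    by_contra hx
    exact absurd (hDc.integral_pos_of_hasCompactSupport_nonneg_nonzero hDs hD0 hx)
      (not_lt.2 hDint)
  have hgz : ∀ x, gradient η x = 0 := by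
    intro x
    by_cases hx : x ∈ Ω
    · have h1 := hDz x
      rw [hDΩ x hx] at h1
      rw [hgrad x hx]
      rcases mul_eq_zero.1 h1 with h | h
      · rw [h, zero_smul]
      · by_cases hab : gradient φ x = gradient u x
        · rw [hab, sub_self, smul_zero]
        · exact absurd h (plapV_mono hp _ _ hab).ne'
    · exact gradient_off (fun hh => hx (hs hh))
  have hfz : ∀ x, fderiv ℝ η x = 0 := by
    intro x
    have := hgz x
    unfold gradient at this
    simpa using this
  have hconst := is_const_of_fderiv_eq_zero (hη.differentiable one_ne_zero) hfz
  have : Nonempty (Fin N) := ⟨⟨0, hN⟩⟩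
  obtain ⟨y, hy⟩ : ∃ y, y ∉ tsupport η := by
    by_contra hall
    push Not at hall
    exact hc.ne_univ (Set.eq_univ_of_forall hall)
  have h1 : η x₀ = 0 := (hconst x₀ y).trans (image_eq_zero_of_notMem_tsupport hy)
  rw [hηΩ x₀ hx₀] at h1
  have h2 : 0 < g (φ x₀ - u x₀ - ε) := expNegInvGlue.pos_of_pos (by linarith)
  linarith
end

section
/- Let N ≥ 1, p > 1, let Ω ⊂ ℝ^N be an open set and f : Ω → ℝ continuous. Let u : Ω → ℝ be C¹ and a weak solution of −Δ_p u ≥ f in Ω, i.e. ∫_Ω |∇u(x)|^{p−2}⟨∇u(x), ∇ψ(x)⟩ dx ≥ ∫_Ω f(x)ψ(x) dx for every nonnegative C^∞ function ψ compactly supported in Ω. Suppose x₀ ∈ Ω and φ : Ω → ℝ is C² with ∇φ(x₀) ≠ 0 and u(x₀) − φ(x₀) = inf_{y ∈ Ω} (u(y) − φ(y)). Then −|∇φ(x₀)|^{p−2} ( Δφ(x₀) + (p−2) |∇φ(x₀)|^{−2} ⟨D²φ(x₀)·∇φ(x₀), ∇φ(x₀)⟩ ) ≥ f(x₀), where Δφ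 denotes the Laplacian (trace of the Hessian) and D²φ(x₀) the Hessian of φ at x₀. -/
open MeasureTheory Metric
open scoped RealInnerProductSpace

open scoped Convolution Pointwise in
lemma exists_smooth_approx {E : Type*} [NormedAddCommGroup E] [InnerProductSpace ℝ E]
    [FiniteDimensional ℝ E] [MeasurableSpace E] [BorelSpace E]
    (w : E → ℝ) (hw : ContDiff ℝ 1 w) (hc : HasCompactSupport w) (h0 : ∀ x, 0 ≤ w x)
    (δ : ℝ) (hδ : 0 < δ) (ε : ℝ) (hε : 0 < ε) :
    ∃ ψ : E → ℝ, ContDiff ℝ (⊤ : ℕ∞) ψ ∧ (∀ x, 0 ≤ ψ x) ∧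
      tsupport ψ ⊆ cthickening δ (tsupport w) ∧
      (∀ x, |ψ x - w x| ≤ ε) ∧ (∀ x, ‖fderiv ℝ ψ x - fderiv ℝ w x‖ ≤ ε) := by
  let μ : Measure E := Measure.addHaar
  have hdc : Continuous (fderiv ℝ w) := hw.continuous_fderiv one_ne_zero
  have u1 : UniformContinuous w := hc.uniformContinuous_of_continuous hw.continuous
  have u2 : UniformContinuous (fderiv ℝ w) :=
    (hc.fderiv ℝ).uniformContinuous_of_continuous hdc
  obtain ⟨d1, hd1, H1⟩ := Metric.uniformContinuous_iff.1 u1 ε hε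
  obtain ⟨d2, hd2, H2⟩ := Metric.uniformContinuous_iff.1 u2 ε hε
  let r := min δ (min d1 d2)
  have hr : 0 < r := by positivity
  let ρ : ContDiffBump (0 : E) := ⟨r / 2, r, by positivity, by linarith⟩
  have hρi : LocallyIntegrable (ρ.normed μ) μ := ρ.continuous_normed.locallyIntegrable
  refine ⟨(ρ.normed μ ⋆[ContinuousLinearMap.lsmul ℝ ℝ, μ] w), ?_, ?_, ?_, ?_, ?_⟩
  · exact ρ.hasCompactSupport_normed.contDiff_convolution_left _ ρ.contDiff_normed
      hw.continuous.locallyIntegrable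
  · intro x
    rw [convolution_def]
    refine integral_nonneg fun t => ?_
    simpa using mul_nonneg (ρ.nonneg_normed t) (h0 _)
  · refine closure_minimal ?_ isClosed_cthickening
    refine (support_convolution_subset_swap _).trans ?_
    rw [ρ.support_normed_eq]
    rintro _ ⟨a, ha, b, hb, rfl⟩
    refine mem_cthickening_of_dist_le _ a _ _ (subset_tsupport _ ha) ?_
    have : ‖b‖ < r := by simpa using hb
    simpa [dist_eq_norm] using this.le.trans (min_le_left _ _)
  · intro x
    rw [← Real.dist_eq]
    refine ρ.dist_normed_convolution_le hw.continuous.aestronglyMeasurable fun y hy => ?_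
    exact (H1 (lt_of_lt_of_le hy ((min_le_right _ _).trans (min_le_left _ _)))).le
  · intro x
    have h1 := hc.hasFDerivAt_convolution_right (ContinuousLinearMap.lsmul ℝ ℝ) hρi hw x
    rw [h1.fderiv, ← dist_eq_norm]
    have : (ContinuousLinearMap.lsmul ℝ ℝ : ℝ →L[ℝ] ℝ →L[ℝ] ℝ).precompR E
       = ContinuousLinearMap.lsmul ℝ ℝ := by
      ext; simp
    rw [this]
    refine ρ.dist_normed_convolution_le hdc.aestronglyMeasurable fun y hy => ?_
    exact (H2 (lt_of_lt_of_le hy ((min_le_right _ _).trans (min_le_right _ _)))).le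

lemma integral_div_eq_zero {N : ℕ} (W : EuclideanSpace ℝ (Fin N) → EuclideanSpace ℝ (Fin N))
    (hW : ContDiff ℝ 1 W) (hc : HasCompactSupport W) :
    ∫ x, (∑ i : Fin N, ⟪fderiv ℝ W x (EuclideanSpace.single i 1), EuclideanSpace.single i 1⟫) = 0 := by
  have hdc : Continuous (fderiv ℝ W) := hW.continuous_fderiv one_ne_zero
  have key : ∀ v : EuclideanSpace ℝ (Fin N), Integrable (fun x => fderiv ℝ W x v) := fun v => by
    refine Continuous.integrable_of_hasCompactSupport (by fun_prop) ?_
    exact (hc.fderiv ℝ).comp_left (g := fun L : _ →L[ℝ] _ => L v) (by simp)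
  rw [integral_finsetSum]
  · refine Finset.sum_eq_zero fun i _ => ?_
    have h1 : ∫ x, fderiv ℝ W x (EuclideanSpace.single i 1) = 0 := by
      have := integral_smul_fderiv_eq_neg_fderiv_smul_of_integrable (μ := volume) (𝕜 := ℝ)
        (f := fun _ => (1 : ℝ)) (g := W) (v := EuclideanSpace.single i 1) (by simp)
        (by simpa using key _) (by simpa using hW.continuous.integrable_of_hasCompactSupport hc)
        (fun _ _ => by simp) (fun x _ => (hW.differentiable one_ne_zero) x)
      simpa using this
    have h2 := (innerSL ℝ (EuclideanSpace.single i (1:ℝ))).integral_comp_comm (key (EuclideanSpace.single i 1))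
    rw [h1] at h2
    simp only [map_zero, innerSL_apply_apply] at h2
    simp_rw [real_inner_comm (EuclideanSpace.single i (1:ℝ))]
    rw [← h2]
  · intro i _
    exact (key _).inner_const _

lemma A_mono {E : Type*} [NormedAddCommGroup E] [InnerProductSpace ℝ E] (p : ℝ) (hp : 1 < p) (a b : E) :
    0 ≤ ⟪‖a‖ ^ (p-2) • a - ‖b‖^(p-2) • b, a - b⟫ := by
  have e : ∀ t : ℝ, 0 ≤ t → t ^ (p-2) * t = t ^ (p-1) := fun t ht => by
    rcases ht.eq_or_lt with rfl | ht
    · rw [Real.zero_rpow (by linarith : p - 1 ≠ 0)]; simp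
    · rw [← Real.rpow_add_one ht.ne']; congr 1; ring
  have h1 : ⟪‖a‖ ^ (p-2) • a - ‖b‖^(p-2) • b, a - b⟫ =
      ‖a‖^(p-2) * ‖a‖ * ‖a‖ + ‖b‖^(p-2) * ‖b‖ * ‖b‖ - (‖a‖^(p-2) + ‖b‖^(p-2)) * ⟪a, b⟫ := by
    simp only [inner_sub_left, inner_sub_right, real_inner_smul_left, real_inner_self_eq_norm_sq,
      real_inner_comm a b]
    ring
  rw [h1]
  have h2 := real_inner_le_norm a b
  have h3 : 0 ≤ ‖a‖^(p-2) + ‖b‖^(p-2) := by positivity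
  have h4 := mul_le_mul_of_nonneg_left h2 h3
  have h5 : 0 ≤ (‖a‖^(p-1) - ‖b‖^(p-1)) * (‖a‖ - ‖b‖) := by
    rcases le_total ‖a‖ ‖b‖ with h | h
    · have := Real.rpow_le_rpow (norm_nonneg _) h (by linarith : 0 ≤ p - 1)
      nlinarith
    · have := Real.rpow_le_rpow (norm_nonneg _) h (by linarith : 0 ≤ p - 1)
      nlinarith
  rw [← e _ (norm_nonneg a), ← e _ (norm_nonneg b)] at h5
  nlinarith

lemma A_cont {E : Type*} [NormedAddCommGroup E] [InnerProductSpace ℝ E] (p : ℝ) (hp : 1 < p) :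
    Continuous (fun a : E => ‖a‖ ^ (p-2) • a) := by
  rw [continuous_iff_continuousAt]
  intro a
  by_cases ha : a = 0
  · subst ha
    unfold ContinuousAt
    simp only [smul_zero]
    rw [tendsto_zero_iff_norm_tendsto_zero]
    have : Filter.Tendsto (fun a : E => ‖a‖ ^ (p-1)) (nhds 0) (nhds 0) := by
      have : Continuous (fun a : E => ‖a‖ ^ (p-1)) :=
        continuous_norm.rpow_const (fun _ => Or.inr (by linarith))
      simpa [Real.zero_rpow (by linarith : p - 1 ≠ 0)] using this.tendsto 0
    refine this.congr fun x => ?_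
    rw [norm_smul, Real.norm_of_nonneg (by positivity)]
    rcases (norm_nonneg x).eq_or_lt with h | h
    · rw [← h, Real.zero_rpow (by linarith : p - 1 ≠ 0)]; simp
    · rw [← Real.rpow_add_one h.ne']; congr 1; ring
  · have : ContinuousAt (fun a : E => ‖a‖ ^ (p-2)) a :=
      continuous_norm.continuousAt.rpow_const (Or.inl (by simpa using ha))
    exact this.smul continuousAt_id

lemma q_contDiff : ContDiff ℝ 1 (fun t : ℝ => (max t 0)^2) ∧
    ∀ t : ℝ, HasDerivAt (fun t : ℝ => (max t 0)^2) (2 * max t 0) t := by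
  have H : ∀ t : ℝ, HasDerivAt (fun t : ℝ => (max t 0)^2) (2 * max t 0) t := by
    intro t
    rcases lt_trichotomy t 0 with h | h | h
    · rw [max_eq_right h.le]
      refine (by simpa using hasDerivAt_const t (0:ℝ) : HasDerivAt (fun _ => (0:ℝ)) (2*0) t).congr_of_eventuallyEq ?_
      filter_upwards [gt_mem_nhds h] with s hs
      simp [max_eq_right hs.le]
    · subst h
      rw [hasDerivAt_iff_isLittleO]
      simp only [max_self, sub_zero]
      have : (fun x : ℝ => x^2) =o[nhds 0] fun x : ℝ => x := by
        simpa using Asymptotics.isLittleO_pow_pow (𝕜 := ℝ) (show 1 < 2 by norm_num)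
      refine Asymptotics.IsBigO.trans_isLittleO (Asymptotics.isBigO_of_le _ fun x => ?_) this
      have : max x 0 ^ 2 ≤ x^2 := by
        rcases le_total x 0 with h | h
        · simp [max_eq_right h]; positivity
        · simp [max_eq_left h]
      simpa using this
    · rw [max_eq_left h.le]
      refine (by simpa using hasDerivAt_pow 2 t : HasDerivAt (fun s : ℝ => s^2) (2*t) t).congr_of_eventuallyEq ?_
      filter_upwards [lt_mem_nhds h] with s hs
      simp [max_eq_left hs.le]
  refine ⟨?_, H⟩
  rw [contDiff_one_iff_deriv]
  refine ⟨fun t => (H t).differentiableAt, ?_⟩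
  rw [show deriv (fun t : ℝ => (max t 0)^2) = fun t => 2 * max t 0 from funext fun t => (H t).deriv]
  fun_prop

lemma weak_C1 {E : Type*} [NormedAddCommGroup E] [InnerProductSpace ℝ E]
    [FiniteDimensional ℝ E] [MeasurableSpace E] [BorelSpace E] (μ : Measure E) [IsFiniteMeasureOnCompacts μ]
    (Ω : Set E) (hΩ : IsOpen Ω) (f : E → ℝ) (hf : ContinuousOn f Ω) (V : E → E)
    (hV : ContinuousOn V Ω)
    (H : ∀ ψ : E → ℝ, ContDiff ℝ (⊤ : ℕ∞) ψ → HasCompactSupport ψ → tsupport ψ ⊆ Ω →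
      (∀ x, 0 ≤ ψ x) → ∫ x in Ω, f x * ψ x ∂μ ≤ ∫ x in Ω, fderiv ℝ ψ x (V x) ∂μ)
    (w : E → ℝ) (hw : ContDiff ℝ 1 w) (hc : HasCompactSupport w) (hs : tsupport w ⊆ Ω)
    (h0 : ∀ x, 0 ≤ w x) :
    ∫ x in Ω, f x * w x ∂μ ≤ ∫ x in Ω, fderiv ℝ w x (V x) ∂μ := by
  obtain ⟨δ, hδ, hK⟩ := IsCompact.exists_cthickening_subset_open hc hΩ hs
  set K := cthickening δ (tsupport w) with hKdef
  have hKc : IsCompact K := IsCompact.cthickening hc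
  have hKm : MeasurableSet K := hKc.measurableSet
  have hwK : tsupport w ⊆ K := self_subset_cthickening _
  have red1 : ∀ ψ : E → ℝ, tsupport ψ ⊆ K →
      ∫ x in Ω, f x * ψ x ∂μ = ∫ x in K, f x * ψ x ∂μ := fun ψ hψ => by
    refine setIntegral_eq_of_subset_of_forall_sdiff_eq_zero hΩ.measurableSet hK fun x hx => ?_
    rw [image_eq_zero_of_notMem_tsupport (fun h => hx.2 (hψ h)), mul_zero]
  have red2 : ∀ ψ : E → ℝ, tsupport ψ ⊆ K →
      ∫ x in Ω, fderiv ℝ ψ x (V x) ∂μ = ∫ x in K, fderiv ℝ ψ x (V x) ∂μ := fun ψ hψ => by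
    refine setIntegral_eq_of_subset_of_forall_sdiff_eq_zero hΩ.measurableSet hK fun x hx => ?_
    rw [image_eq_zero_of_notMem_tsupport
        (fun h => hx.2 (hψ (tsupport_fderiv_subset ℝ h)))]; simp
  have i1 : ∀ ψ : E → ℝ, Continuous ψ → IntegrableOn (fun x => f x * ψ x) K μ := fun ψ hψ =>
    ((hf.mono hK).mul hψ.continuousOn).integrableOn_compact hKc
  have i2 : ∀ ψ : E → ℝ, ContDiff ℝ 1 ψ → IntegrableOn (fun x => fderiv ℝ ψ x (V x)) K μ :=
    fun ψ hψ => ((hψ.continuous_fderiv one_ne_zero).continuousOn.clm_apply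
      (hV.mono hK)).integrableOn_compact hKc
  obtain ⟨M1, hM1⟩ := hKc.exists_bound_of_continuousOn (hf.mono hK)
  obtain ⟨M2, hM2⟩ := hKc.exists_bound_of_continuousOn (hV.mono hK)
  set M := max (max M1 M2) 0
  have hM0 : 0 ≤ M := le_max_right _ _
  have hM1' : ∀ x ∈ K, |f x| ≤ M := fun x hx => (hM1 x hx).trans ((le_max_left _ _).trans (le_max_left _ _))
  have hM2' : ∀ x ∈ K, ‖V x‖ ≤ M := fun x hx => (hM2 x hx).trans ((le_max_right _ _).trans (le_max_left _ _))
  have hfin : μ K ≠ ⊤ := hKc.measure_lt_top.ne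
  refine le_of_forall_pos_le_add fun e he => ?_
  set vK := μ.real K with hvK
  have hv0 : 0 ≤ vK := measureReal_nonneg
  set ε := e / (2 * (M * vK) + 1) with hεdef
  have hden : 0 < 2 * (M * vK) + 1 := by positivity
  have hε : 0 < ε := by positivity
  have hεe : 2 * (ε * M * vK) ≤ e := by
    have : ε * (2 * (M * vK) + 1) = e := by rw [hεdef]; field_simp
    nlinarith
  obtain ⟨ψ, hψ, ψ0, ψs, a1, a2⟩ := exists_smooth_approx w hw hc h0 δ hδ ε hε
  have hψ1 : ContDiff ℝ 1 ψ := hψ.of_le (by exact_mod_cast le_top)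
  have main := H ψ hψ (hKc.of_isClosed_subset (isClosed_tsupport _) ψs) (ψs.trans hK) ψ0
  rw [red1 ψ ψs, red2 ψ ψs] at main
  rw [red1 w hwK, red2 w hwK]
  have ic : IntegrableOn (fun _ : E => ε * M) K μ := integrableOn_const hfin
  have b1 : ∫ x in K, f x * w x ∂μ ≤ ∫ x in K, (f x * ψ x + ε * M) ∂μ := by
    refine setIntegral_mono_on (i1 w hw.continuous) ((i1 ψ hψ.continuous).add ic) hKm fun x hx => ?_
    have h1 : |f x * (ψ x - w x)| ≤ M * ε := by
      rw [abs_mul]; exact mul_le_mul (hM1' x hx) (a1 x) (abs_nonneg _) hM0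
    have := (abs_le.1 h1).1
    linarith
  have b2 : ∫ x in K, fderiv ℝ ψ x (V x) ∂μ ≤ ∫ x in K, (fderiv ℝ w x (V x) + ε * M) ∂μ := by
    refine setIntegral_mono_on (i2 ψ hψ1) ((i2 w hw).add ic) hKm fun x hx => ?_
    have h1 : ‖(fderiv ℝ ψ x - fderiv ℝ w x) (V x)‖ ≤ ε * M :=
      (ContinuousLinearMap.le_opNorm _ _).trans
        (mul_le_mul (a2 x) (hM2' x hx) (norm_nonneg _) hε.le)
    have := (abs_le.1 h1).2
    rw [sub_apply] at this
    linarith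
  rw [integral_add (i1 ψ hψ.continuous) ic, setIntegral_const, smul_eq_mul] at b1
  rw [integral_add (i2 w hw) ic, setIntegral_const, smul_eq_mul] at b2
  nlinarith

lemma fderiv_A {E : Type*} [NormedAddCommGroup E] [InnerProductSpace ℝ E] (p : ℝ) (G : E → E) (x : E)
    (L : E →L[ℝ] E) (hG : HasFDerivAt G L x) (h : G x ≠ 0) (v : E) :
    fderiv ℝ (fun y => ‖G y‖^(p-2) • G y) x v =
      ‖G x‖^(p-2) • L v + ((p-2) * ‖G x‖^(p-2) / ‖G x‖^2 * ⟪G x, L v⟫) • G x := by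
  have hn : 0 < ‖G x‖ := norm_pos_iff.2 h
  have h1 : HasFDerivAt (fun y => ‖G y‖^2) (2 • (innerSL ℝ (G x)).comp L) x := hG.norm_sq
  have h2 := h1.rpow_const (p := (p-2)/2) (Or.inl (by positivity))
  have e : ∀ y, (‖G y‖^2) ^ ((p-2)/2) = ‖G y‖^(p-2) := fun y => by
    rw [← Real.rpow_natCast, ← Real.rpow_mul (norm_nonneg _)]; congr 1; push_cast; ring
  simp only [e] at h2
  have h3 := h2.fun_smul hG
  rw [h3.fderiv]
  have e2 : (‖G x‖^2) ^ ((p-2)/2 - 1) = ‖G x‖^(p-2) / ‖G x‖^2 := by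
    rw [Real.rpow_sub_one (by positivity), e]
  simp [e2]
  congr 1
  ring

lemma div_A {N : ℕ} (p : ℝ) (G : EuclideanSpace ℝ (Fin N) → EuclideanSpace ℝ (Fin N)) (x : EuclideanSpace ℝ (Fin N))
    (L : EuclideanSpace ℝ (Fin N) →L[ℝ] EuclideanSpace ℝ (Fin N)) (hG : HasFDerivAt G L x) (h : G x ≠ 0) :
    ∑ i : Fin N, ⟪fderiv ℝ (fun y => ‖G y‖^(p-2) • G y) x (EuclideanSpace.single i 1), EuclideanSpace.single i 1⟫ =
    ‖G x‖ ^ (p - 2) *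
        ((∑ i : Fin N, ⟪L (EuclideanSpace.single i 1),
            EuclideanSpace.single i 1⟫) +
          (p - 2) *
            ⟪L (G x), G x⟫ /
              ‖G x‖ ^ 2) := by
  simp only [fderiv_A p G x L hG h, inner_add_left, real_inner_smul_left, Finset.sum_add_distrib, ← Finset.mul_sum]
  have key : ∑ i : Fin N, ⟪G x, L (EuclideanSpace.single i 1)⟫ * ⟪G x, EuclideanSpace.single i 1⟫ = ⟪L (G x), G x⟫ := by
    have hb := (EuclideanSpace.basisFun (Fin N) ℝ).sum_repr (G x)
    simp only [EuclideanSpace.basisFun_repr, EuclideanSpace.basisFun_apply] at hb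
    have hL := congrArg L hb
    rw [map_sum] at hL
    rw [← hL, sum_inner]
    refine Finset.sum_congr rfl fun i _ => ?_
    rw [map_smul, real_inner_smul_left, EuclideanSpace.inner_single_right, real_inner_comm]
    simp [mul_comm]
  simp only [mul_assoc, ← Finset.mul_sum]
  rw [key]
  ring

/-- Integration by parts against a vector field which is only `C¹` on an open set `U`. -/
lemma parts {N : ℕ} (U : Set (EuclideanSpace ℝ (Fin N))) (hU : IsOpen U)
    (F : EuclideanSpace ℝ (Fin N) → EuclideanSpace ℝ (Fin N)) (hF : ContDiffOn ℝ 1 F U)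
    (w : EuclideanSpace ℝ (Fin N) → ℝ) (hw : ContDiff ℝ 1 w) (hc : HasCompactSupport w)
    (hs : tsupport w ⊆ U) :
    ∫ x, (w x * (∑ i : Fin N, ⟪fderiv ℝ F x (EuclideanSpace.single i 1), EuclideanSpace.single i 1⟫)
      + fderiv ℝ w x (F x)) = 0 := by
  have h1 : ∀ x ∈ U, ContDiffAt ℝ 1 F x := fun x hx => hF.contDiffAt (hU.mem_nhds hx)
  have hz : ∀ x, x ∉ U → (fun y => w y • F y) =ᶠ[nhds x] fun _ => 0 := fun x hx => by
    have := notMem_tsupport_iff_eventuallyEq.1 (fun h => hx (hs h))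
    filter_upwards [this] with y hy
    simp [hy]
  have hW : ContDiff ℝ 1 (fun x => w x • F x) := by
    rw [contDiff_iff_contDiffAt]
    intro x
    by_cases hx : x ∈ U
    · exact hw.contDiffAt.smul (h1 x hx)
    · exact contDiffAt_const.congr_of_eventuallyEq (hz x hx)
  have hWc : HasCompactSupport (fun x => w x • F x) := hc.smul_right
  rw [← integral_div_eq_zero _ hW hWc]
  refine integral_congr_ae (Filter.Eventually.of_forall fun x => ?_)
  dsimp only
  by_cases hx : x ∈ U
  · have hw' := (hw.differentiable one_ne_zero x).hasFDerivAt
    have hF' := ((h1 x hx).differentiableAt one_ne_zero).hasFDerivAt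
    have e := (hw'.fun_smul hF').fderiv
    rw [e]
    have hb := (EuclideanSpace.basisFun (Fin N) ℝ).sum_repr (F x)
    simp only [EuclideanSpace.basisFun_repr, EuclideanSpace.basisFun_apply] at hb
    have hL := congrArg (fderiv ℝ w x) hb
    rw [map_sum] at hL
    rw [← hL, Finset.mul_sum, ← Finset.sum_add_distrib]
    refine Finset.sum_congr rfl fun i _ => ?_
    simp [inner_add_left, real_inner_smul_left, EuclideanSpace.inner_single_right, mul_comm]
  · have h2 : x ∉ tsupport w := fun h => hx (hs h)
    rw [(hz x hx).fderiv_eq, image_eq_zero_of_notMem_tsupport h2,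
      image_eq_zero_of_notMem_tsupport (fun h => h2 (tsupport_fderiv_subset ℝ h))]
    simp

/-- Viscosity-type property of weak supersolutions of `-Δ_p u ≥ f`: if a C² test
function `φ` with nonvanishing gradient touches `u` from below at `x₀` (i.e. `u - φ`
attains its infimum over `Ω` at `x₀`), then `-Δ_p φ(x₀) ≥ f(x₀)`. -/
theorem weak_supersolution_viscosity
    (N : ℕ) (hN : 1 ≤ N) (p : ℝ) (hp : 1 < p)
    (Ω : Set (EuclideanSpace ℝ (Fin N))) (hΩo : IsOpen Ω)
    (f : EuclideanSpace ℝ (Fin N) → ℝ) (hf : ContinuousOn f Ω)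
    (u : EuclideanSpace ℝ (Fin N) → ℝ) (hu : ContDiffOn ℝ 1 u Ω)
    (hweak : ∀ ψ : EuclideanSpace ℝ (Fin N) → ℝ,
      ContDiff ℝ (⊤ : ℕ∞) ψ → HasCompactSupport ψ → tsupport ψ ⊆ Ω → (∀ x, 0 ≤ ψ x) →
      ∫ x in Ω, f x * ψ x ≤
        ∫ x in Ω, ‖gradient u x‖ ^ (p - 2) * ⟪gradient u x, gradient ψ x⟫)
    (x₀ : EuclideanSpace ℝ (Fin N)) (hx₀ : x₀ ∈ Ω)
    (φ : EuclideanSpace ℝ (Fin N) → ℝ) (hφ : ContDiffOn ℝ 2 φ Ω)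
    (hgrad : gradient φ x₀ ≠ 0)
    (hmin : ∀ y ∈ Ω, u x₀ - φ x₀ ≤ u y - φ y) :
    f x₀ ≤
      -(‖gradient φ x₀‖ ^ (p - 2) *
        ((∑ i : Fin N, ⟪fderiv ℝ (gradient φ) x₀ (EuclideanSpace.single i 1),
            EuclideanSpace.single i 1⟫) +
          (p - 2) *
            ⟪fderiv ℝ (gradient φ) x₀ (gradient φ x₀), gradient φ x₀⟫ /
              ‖gradient φ x₀‖ ^ 2)) := by
  classical
  -- the perturbed gradient
  let G : EuclideanSpace ℝ (Fin N) → EuclideanSpace ℝ (Fin N) :=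
    fun x => gradient φ x - (4 * ‖x - x₀‖ ^ 2) • (x - x₀)
  let F : EuclideanSpace ℝ (Fin N) → EuclideanSpace ℝ (Fin N) := fun x => ‖G x‖ ^ (p - 2) • G x
  let V : EuclideanSpace ℝ (Fin N) → EuclideanSpace ℝ (Fin N) :=
    fun x => ‖gradient u x‖ ^ (p - 2) • gradient u x
  let D : EuclideanSpace ℝ (Fin N) → ℝ := fun x =>
    ∑ i : Fin N, ⟪fderiv ℝ F x (EuclideanSpace.single i 1), EuclideanSpace.single i 1⟫
  have hgφ : ContDiffOn ℝ 1 (gradient φ) Ω := by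
    have : ContDiffOn ℝ 1 (fderiv ℝ φ) Ω := hφ.fderiv_of_isOpen hΩo (by norm_num)
    exact (InnerProductSpace.toDual ℝ (EuclideanSpace ℝ (Fin N))).symm.contDiff.comp_contDiffOn this
  have hgu : ContinuousOn (gradient u) Ω := by
    have : ContinuousOn (fderiv ℝ u) Ω := hu.continuousOn_fderiv_of_isOpen hΩo (by norm_num)
    exact (InnerProductSpace.toDual ℝ (EuclideanSpace ℝ (Fin N))).symm.continuous.comp_continuousOn this
  have hP : ContDiff ℝ 1 (fun x : EuclideanSpace ℝ (Fin N) => (4 * ‖x - x₀‖ ^ 2) • (x - x₀)) :=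
    (contDiff_const.mul ((contDiff_id.sub contDiff_const).norm_sq ℝ)).smul
      (contDiff_id.sub contDiff_const)
  have hG : ContDiffOn ℝ 1 G Ω := hgφ.sub hP.contDiffOn
  have hG0 : G x₀ = gradient φ x₀ := by simp [G]
  have hGd : HasFDerivAt G (fderiv ℝ (gradient φ) x₀) x₀ := by
    have h1 : HasFDerivAt (gradient φ) (fderiv ℝ (gradient φ) x₀) x₀ :=
      ((hgφ.contDiffAt (hΩo.mem_nhds hx₀)).differentiableAt one_ne_zero).hasFDerivAt
    have h2 : HasFDerivAt (fun x : EuclideanSpace ℝ (Fin N) => (4 * ‖x - x₀‖ ^ 2) • (x - x₀))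
        (0 : EuclideanSpace ℝ (Fin N) →L[ℝ] EuclideanSpace ℝ (Fin N)) x₀ := by
      have hs : HasFDerivAt (fun x : EuclideanSpace ℝ (Fin N) => x - x₀) (ContinuousLinearMap.id ℝ _) x₀ :=
        (hasFDerivAt_id x₀).sub_const x₀
      have := (hs.norm_sq.const_mul 4).fun_smul hs
      simpa using this
    have h3 := h1.fun_sub h2
    rw [sub_zero] at h3
    exact h3
  have hV : ContinuousOn V Ω := (A_cont p hp).comp_continuousOn hgu
  -- the good ball
  have hΩG : IsOpen (Ω ∩ G ⁻¹' {0}ᶜ) := hG.continuousOn.isOpen_inter_preimage hΩo isOpen_compl_singleton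
  set U := Ω ∩ G ⁻¹' {0}ᶜ with hUdef
  have hx₀U : x₀ ∈ U := ⟨hx₀, by simpa [hG0] using hgrad⟩
  have hF : ContDiffOn ℝ 1 F U := by
    intro x hx
    have hGx : ContDiffWithinAt ℝ 1 G U x := (hG x hx.1).mono Set.inter_subset_left
    have hne : G x ≠ 0 := hx.2
    exact ((hGx.norm ℝ hne).rpow_const_of_ne (norm_ne_zero_iff.2 hne)).smul hGx
  have hD : ContinuousOn D U := by
    have : ContinuousOn (fderiv ℝ F) U := hF.continuousOn_fderiv_of_isOpen hΩG (by norm_num)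
    exact continuousOn_finsetSum _ fun i _ =>
      (this.clm_apply continuousOn_const).inner continuousOn_const
  have hD0 := div_A p G x₀ _ hGd (by rw [hG0]; exact hgrad)
  rw [hG0] at hD0
  rw [← hD0]
  change f x₀ ≤ - D x₀
  by_contra hcon
  have hfD : ContinuousOn (fun x => f x + D x) U := (hf.mono Set.inter_subset_left).add hD
  have hO : IsOpen (U ∩ (fun x => f x + D x) ⁻¹' Set.Ioi 0) := hfD.isOpen_inter_preimage hΩG isOpen_Ioi
  have hx₀O : x₀ ∈ U ∩ (fun x => f x + D x) ⁻¹' Set.Ioi 0 :=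
    ⟨hx₀U, by simp only [Set.mem_preimage, Set.mem_Ioi]; linarith⟩
  obtain ⟨r, hr, hball⟩ := Metric.nhds_basis_closedBall.mem_iff.1 (hO.mem_nhds hx₀O)
  have hbU : closedBall x₀ r ⊆ U := fun x hx => (hball hx).1
  have hbΩ : closedBall x₀ r ⊆ Ω := fun x hx => (hbU hx).1
  -- the test function
  let h : EuclideanSpace ℝ (Fin N) → ℝ :=
    fun x => φ x - (‖x - x₀‖ ^ 2) ^ 2 - u x + (u x₀ - φ x₀) + r ^ 4
  have hh1 : ∀ x ∈ Ω, h x ≤ r ^ 4 - ‖x - x₀‖ ^ 4 := fun x hx => by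
    have := hmin x hx
    simp only [h]; nlinarith
  let w : EuclideanSpace ℝ (Fin N) → ℝ := fun x => if x ∈ Ω then (max (h x) 0) ^ 2 else 0
  have hwout : ∀ x, x ∉ closedBall x₀ r → w x = 0 := fun x hx => by
    by_cases hxΩ : x ∈ Ω
    · have h1 : r < ‖x - x₀‖ := by simpa [dist_eq_norm] using hx
      have h2 : r ^ 4 ≤ ‖x - x₀‖ ^ 4 := pow_le_pow_left₀ hr.le h1.le 4
      have h3 : h x ≤ 0 := by linarith [hh1 x hxΩ]
      simp [w, max_eq_right h3]
    · simp [w, hxΩ]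
  have hsw : tsupport w ⊆ closedBall x₀ r :=
    closure_minimal (fun x hx => by by_contra hc; exact hx (hwout x hc)) isClosed_closedBall
  have hwc : HasCompactSupport w :=
    (isCompact_closedBall x₀ r).of_isClosed_subset (isClosed_tsupport _) hsw
  have hw0 : ∀ x, 0 ≤ w x := fun x => by
    simp only [w]; split_ifs <;> positivity
  have hweq : ∀ x ∈ Ω, w =ᶠ[nhds x] fun y => (max (h y) 0) ^ 2 := fun x hx => by
    filter_upwards [hΩo.mem_nhds hx] with y hy
    simp [w, hy]
  have hhC : ContDiffOn ℝ 1 h Ω := by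
    have hq : ContDiff ℝ 1 (fun x : EuclideanSpace ℝ (Fin N) => (‖x - x₀‖ ^ 2) ^ 2) :=
      ((contDiff_id.sub contDiff_const).norm_sq ℝ).pow 2
    exact ((((hφ.of_le (by norm_num)).sub hq.contDiffOn).sub hu).add contDiffOn_const).add
      contDiffOn_const
  have hwC : ContDiff ℝ 1 w := by
    rw [contDiff_iff_contDiffAt]
    intro x
    by_cases hx : x ∈ Ω
    · refine ContDiffAt.congr_of_eventuallyEq ?_ (hweq x hx)
      exact q_contDiff.1.contDiffAt.comp x (hhC.contDiffAt (hΩo.mem_nhds hx))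
    · have : x ∉ tsupport w := fun h => hx (hbΩ (hsw h))
      exact contDiffAt_const.congr_of_eventuallyEq (notMem_tsupport_iff_eventuallyEq.1 this)
  have hdh : ∀ x ∈ Ω, ∀ v, fderiv ℝ h x v = ⟪G x - gradient u x, v⟫ := fun x hx v => by
    have d1 := ((hφ.contDiffAt (hΩo.mem_nhds hx)).differentiableAt two_ne_zero).hasFDerivAt
    have d2 := ((hu.contDiffAt (hΩo.mem_nhds hx)).differentiableAt one_ne_zero).hasFDerivAt
    have hs : HasFDerivAt (fun x : EuclideanSpace ℝ (Fin N) => x - x₀) (ContinuousLinearMap.id ℝ _) x :=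
      (hasFDerivAt_id x).sub_const x₀
    have d3 := (hs.norm_sq).pow 2
    have d4 := (((d1.fun_sub d3).fun_sub d2).add_const (u x₀ - φ x₀)).add_const (r ^ 4)
    rw [show fderiv ℝ h x = _ from d4.fderiv]
    simp only [G, inner_sub_left, real_inner_smul_left, inner_gradient_left]
    simp [inner_sub_left]
    ring
  have hdw : ∀ x ∈ Ω, ∀ v, fderiv ℝ w x v = 2 * max (h x) 0 * ⟪G x - gradient u x, v⟫ := fun x hx v => by
    rw [(hweq x hx).fderiv_eq]
    have := ((q_contDiff.2 (h x)).comp_hasFDerivAt x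
      ((hhC.contDiffAt (hΩo.mem_nhds hx)).differentiableAt one_ne_zero).hasFDerivAt).fderiv
    rw [show fderiv ℝ (fun y => (max (h y) 0) ^ 2) x = _ from this]
    simp [hdh x hx v]
  have main := weak_C1 volume Ω hΩo f hf V hV (fun ψ a b c d => by
    refine (hweak ψ a b c d).trans (le_of_eq ?_)
    congr 1
    ext x
    simp only [V, map_smul, smul_eq_mul, inner_gradient_right]
    simp) w hwC hwc (hsw.trans hbΩ) hw0
  have ibp := parts U hΩG F hF w hwC hwc (hsw.trans hbU)
  change ∫ x, (w x * D x + fderiv ℝ w x (F x)) = 0 at ibp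
  have z1 : ∀ x, x ∉ closedBall x₀ r → w x = 0 := hwout
  have z2 : ∀ x, x ∉ closedBall x₀ r → fderiv ℝ w x = 0 := fun x hx =>
    image_eq_zero_of_notMem_tsupport (fun h => hx (hsw (tsupport_fderiv_subset ℝ h)))
  set B := closedBall x₀ r with hB
  have hBc : IsCompact B := isCompact_closedBall x₀ r
  rw [← setIntegral_eq_integral_of_forall_compl_eq_zero (s := B)
    (fun x hx => by simp [z1 x hx, z2 x hx])] at ibp
  have e1 : ∫ x in Ω, f x * w x = ∫ x in B, f x * w x := by
    refine setIntegral_eq_of_subset_of_forall_sdiff_eq_zero hΩo.measurableSet hbΩ fun x hx => ?_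
    simp [z1 x hx.2]
  have e2 : ∫ x in Ω, fderiv ℝ w x (V x) = ∫ x in B, fderiv ℝ w x (V x) := by
    refine setIntegral_eq_of_subset_of_forall_sdiff_eq_zero hΩo.measurableSet hbΩ fun x hx => ?_
    simp [z2 x hx.2]
  rw [e1, e2] at main
  have cdw : Continuous (fderiv ℝ w) := hwC.continuous_fderiv one_ne_zero
  have c1 : ContinuousOn (fun x => f x * w x) B := (hf.mono hbΩ).mul hwC.continuous.continuousOn
  have c2 : ContinuousOn (fun x => w x * D x) B := hwC.continuous.continuousOn.mul (hD.mono hbU)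
  have c3 : ContinuousOn (fun x => fderiv ℝ w x (V x)) B := cdw.continuousOn.clm_apply (hV.mono hbΩ)
  have c4 : ContinuousOn (fun x => fderiv ℝ w x (F x)) B :=
    cdw.continuousOn.clm_apply (hF.continuousOn.mono hbU)
  have i1 := c1.integrableOn_compact (μ := volume) hBc
  have i2 := c2.integrableOn_compact (μ := volume) hBc
  have i3 := c3.integrableOn_compact (μ := volume) hBc
  have i4 := c4.integrableOn_compact (μ := volume) hBc
  rw [integral_add i2 i4] at ibp
  have mono : ∫ x in B, fderiv ℝ w x (V x) ≤ ∫ x in B, fderiv ℝ w x (F x) := by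
    refine setIntegral_mono_on i3 i4 hBc.measurableSet fun x hx => ?_
    rw [hdw x (hbΩ hx), hdw x (hbΩ hx)]
    refine mul_le_mul_of_nonneg_left ?_ (by positivity)
    have := A_mono p hp (G x) (gradient u x)
    rw [← sub_nonneg, ← inner_sub_right, real_inner_comm]
    exact this
  have hle : ∫ x in B, (f x * w x + w x * D x) ≤ 0 := by
    rw [integral_add i1 i2]; linarith
  -- positivity
  have hpos : 0 < ∫ x in B, (f x * w x + w x * D x) := by
    rw [setIntegral_pos_iff_support_of_nonneg_ae]
    · have hop : IsOpen (ball x₀ r ∩ {x | 0 < w x}) :=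
        isOpen_ball.inter (isOpen_lt continuous_const hwC.continuous)
      have hmem : x₀ ∈ ball x₀ r ∩ {x | 0 < w x} := by
        refine ⟨mem_ball_self hr, ?_⟩
        have : h x₀ = r ^ 4 := by simp [h]
        simp only [Set.mem_ofPred_eq, w, hx₀, if_true, this]
        positivity
      refine (hop.measure_pos volume ⟨x₀, hmem⟩).trans_le (measure_mono fun x hx => ?_)
      have hxB : x ∈ B := ball_subset_closedBall hx.1
      refine ⟨?_, hxB⟩
      have h1 : 0 < f x + D x := (hball hxB).2
      have h2 : 0 < w x := hx.2
      have : 0 < f x * w x + w x * D x := by nlinarith [mul_pos h1 h2]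
      exact this.ne'
    · filter_upwards [ae_restrict_mem hBc.measurableSet] with x hxB
      have h1 : 0 < f x + D x := (hball hxB).2
      have := mul_nonneg h1.le (hw0 x)
      simp only [Pi.zero_apply]; nlinarith
    · exact i1.add i2
  linarith
end

section
/- Let N ≥ 1 and p > 1 with N ≠ p, and set λ = (p−N)/(p−1). Let u : ℝ^N → ℝ be a nonnegative C¹ function satisfying ∫_{ℝ^N} |∇u(x)|^{p−2}⟨∇u(x), ∇φ(x)⟩ dx ≥ 0 for every nonnegative C^∞ compactly supported φ : ℝ^N → ℝ, and set m(r) = inf_{|x| ≤ r} u(x). Then for all 0 < r₁ < r < r₂ one has m(r) ≥ [ m(r₁)(r^λ − r₂^λ) + m(r₂)(r₁^λ − r^λ) ] / (r₁^λ − r₂^λ). -/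
open MeasureTheory Metric
open scoped RealInnerProductSpace
open Filter Topology

set_option linter.unusedSectionVars false

section aux
variable {E : Type*} [NormedAddCommGroup E] [InnerProductSpace ℝ E]

/-- Derivative of a power of the norm away from the origin. -/
lemma aux_hasFDerivAt_norm_rpow (s : ℝ) {x : E} (hx : x ≠ 0) :
    HasFDerivAt (fun y : E => ‖y‖ ^ s) ((s * ‖x‖ ^ (s - 2)) • innerSL ℝ x) x := by
  have h1 := (hasStrictFDerivAt_norm_sq x).hasFDerivAt
  have hx0 : 0 < ‖x‖ := norm_pos_iff.mpr hx
  have h2 := h1.rpow_const (p := s / 2) (Or.inl (by positivity))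
  have e1 : (fun y : E => (‖y‖ ^ 2) ^ (s / 2)) = fun y : E => ‖y‖ ^ s := by
    funext y
    rw [← Real.rpow_natCast, ← Real.rpow_mul (norm_nonneg y)]
    congr 1
    push_cast
    ring
  have e2 : (‖x‖ ^ 2) ^ (s / 2 - 1) = ‖x‖ ^ (s - 2) := by
    rw [← Real.rpow_natCast, ← Real.rpow_mul (norm_nonneg x)]
    congr 1
    push_cast
    ring
  rw [e1, e2] at h2
  convert h2 using 1
  ext v
  simp
  ring

lemma aux_norm_rpow_mul (p : ℝ) (hp : 1 < p) (x : E) :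
    ‖x‖ ^ (p - 2) * ‖x‖ = ‖x‖ ^ (p - 1) := by
  rcases eq_or_ne x 0 with rfl | hx
  · have : p - 1 ≠ 0 := by linarith
    simp [Real.zero_rpow this]
  · have hx0 : 0 < ‖x‖ := norm_pos_iff.mpr hx
    rw [show p - 1 = (p - 2) + 1 by ring, Real.rpow_add_one hx0.ne']

/-- The field `ξ ↦ |ξ|^{p-2} ξ` is continuous. -/
lemma aux_continuous_field (p : ℝ) (hp : 1 < p) :
    Continuous (fun x : E => ‖x‖ ^ (p - 2) • x) := by
  rw [continuous_iff_continuousAt]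
  intro x
  rcases eq_or_ne x 0 with rfl | hx
  · rw [ContinuousAt, smul_zero, tendsto_zero_iff_norm_tendsto_zero]
    have e : (fun x : E => ‖‖x‖ ^ (p - 2) • x‖) = fun x => ‖x‖ ^ (p - 1) := by
      funext x
      rw [norm_smul, Real.norm_of_nonneg (Real.rpow_nonneg (norm_nonneg x) _),
        aux_norm_rpow_mul p hp]
    rw [e]
    have hc : Continuous (fun x : E => ‖x‖ ^ (p - 1)) :=
      continuous_norm.rpow_const (fun _ => Or.inr (by linarith))
    have := hc.tendsto 0
    rwa [norm_zero, Real.zero_rpow (by linarith)] at this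
  · exact (continuousAt_id.norm.rpow_const (Or.inl (norm_ne_zero_iff.mpr hx))).smul continuousAt_id

/-- Strict monotonicity of the field `ξ ↦ |ξ|^{p-2} ξ`. -/
lemma aux_monotone (p : ℝ) (hp : 1 < p) (x y : E) :
    0 ≤ ⟪x - y, ‖x‖ ^ (p - 2) • x - ‖y‖ ^ (p - 2) • y⟫ ∧
    (⟪x - y, ‖x‖ ^ (p - 2) • x - ‖y‖ ^ (p - 2) • y⟫ = 0 → x = y) := by
  have hX := aux_norm_rpow_mul p hp x
  have hY := aux_norm_rpow_mul p hp y
  have ha : 0 ≤ ‖x‖ ^ (p - 2) := Real.rpow_nonneg (norm_nonneg x) _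
  have hb : 0 ≤ ‖y‖ ^ (p - 2) := Real.rpow_nonneg (norm_nonneg y) _
  have key : ⟪x - y, ‖x‖ ^ (p - 2) • x - ‖y‖ ^ (p - 2) • y⟫ =
      (‖x‖ ^ (p - 1) - ‖y‖ ^ (p - 1)) * (‖x‖ - ‖y‖)
      + (‖x‖ ^ (p - 2) + ‖y‖ ^ (p - 2)) * (‖x‖ * ‖y‖ - ⟪x, y⟫) := by
    rw [← hX, ← hY]
    simp only [inner_sub_left, inner_sub_right, inner_smul_right, real_inner_self_eq_norm_sq,
      real_inner_comm x y]
    ring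
  have h1 : 0 ≤ (‖x‖ ^ (p - 1) - ‖y‖ ^ (p - 1)) * (‖x‖ - ‖y‖) := by
    rcases le_total ‖x‖ ‖y‖ with h | h
    · exact mul_nonneg_of_nonpos_of_nonpos
        (sub_nonpos.mpr (Real.rpow_le_rpow (norm_nonneg _) h (by linarith))) (by linarith)
    · exact mul_nonneg
        (sub_nonneg.mpr (Real.rpow_le_rpow (norm_nonneg _) h (by linarith))) (by linarith)
  have h2 : 0 ≤ ‖x‖ * ‖y‖ - ⟪x, y⟫ := sub_nonneg.mpr (real_inner_le_norm x y)
  have h3 := mul_nonneg (add_nonneg ha hb) h2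
  rw [key]
  refine ⟨by linarith, fun h => ?_⟩
  have e1 : (‖x‖ ^ (p - 1) - ‖y‖ ^ (p - 1)) * (‖x‖ - ‖y‖) = 0 := by linarith
  have e2 : (‖x‖ ^ (p - 2) + ‖y‖ ^ (p - 2)) * (‖x‖ * ‖y‖ - ⟪x, y⟫) = 0 := by linarith
  have hn : ‖x‖ = ‖y‖ := by
    rcases mul_eq_zero.mp e1 with h | h
    · exact (Real.rpow_left_inj (norm_nonneg _) (norm_nonneg _) (by linarith)).mp
        (sub_eq_zero.mp h)
    · linarith
  rcases eq_or_ne x 0 with rfl | hx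
  · rw [norm_zero] at hn
    exact (norm_eq_zero.mp hn.symm).symm
  · have hx0 : 0 < ‖x‖ := norm_pos_iff.mpr hx
    have hpos : 0 < ‖x‖ ^ (p - 2) := Real.rpow_pos_of_pos hx0 _
    have h4 : ‖x‖ * ‖y‖ - ⟪x, y⟫ = 0 := by
      rcases mul_eq_zero.mp e2 with h | h
      · linarith
      · exact h
    have h5 : ‖x - y‖ ^ 2 = 0 := by
      rw [norm_sub_sq_real, show ⟪x, y⟫ = ‖x‖ * ‖y‖ by linarith, hn]
      ring
    exact sub_eq_zero.mp (norm_eq_zero.mp (pow_eq_zero_iff two_ne_zero |>.mp h5))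

end aux

section approx
variable {E : Type*} [NormedAddCommGroup E] [InnerProductSpace ℝ E] [FiniteDimensional ℝ E]
  [MeasurableSpace E] [BorelSpace E]

/-- Smooth approximation of `C¹` test functions. -/
lemma aux_smooth_approx (φ : E → ℝ) (hφ : ContDiff ℝ 1 φ) (hc : HasCompactSupport φ)
    (h0 : ∀ x, 0 ≤ φ x) (ε : ℝ) (hε : 0 < ε) :
    ∃ ψ : E → ℝ, ContDiff ℝ (⊤ : ℕ∞) ψ ∧ HasCompactSupport ψ ∧ (∀ x, 0 ≤ ψ x) ∧
      (∀ x, ‖fderiv ℝ ψ x - fderiv ℝ φ x‖ ≤ ε) ∧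
      (∀ x, x ∉ cthickening 1 (tsupport φ) → fderiv ℝ ψ x = 0) := by
  have hcd : Continuous (fderiv ℝ φ) := hφ.continuous_fderiv one_ne_zero
  have huc : UniformContinuous (fderiv ℝ φ) :=
    (hc.fderiv (𝕜 := ℝ)).uniformContinuous_of_continuous hcd
  obtain ⟨δ, hδ, hd⟩ := Metric.uniformContinuous_iff.mp huc ε hε
  set d := min δ 1 with hdd
  have hd0 : 0 < d := lt_min hδ one_pos
  let b : ContDiffBump (0 : E) := ⟨d / 2, d, by positivity, by linarith⟩
  let ψ : E → ℝ := convolution (b.normed volume) φ (ContinuousLinearMap.lsmul ℝ ℝ) volume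
  have hder : ∀ x, HasFDerivAt ψ (convolution (b.normed volume) (fderiv ℝ φ)
      (ContinuousLinearMap.lsmul ℝ ℝ) volume x) x := by
    intro x
    exact hc.hasFDerivAt_convolution_right (ContinuousLinearMap.lsmul ℝ ℝ)
      (b.continuous_normed.locallyIntegrable) hφ x
  refine ⟨ψ, ?_, ?_, ?_, ?_, ?_⟩
  · exact b.hasCompactSupport_normed.contDiff_convolution_left _ b.contDiff_normed
      hφ.continuous.locallyIntegrable
  · exact b.hasCompactSupport_normed.convolution _ hc
  · intro x
    exact integral_nonneg fun t => mul_nonneg (b.nonneg_normed t) (h0 _)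
  · intro x
    rw [(hder x).fderiv, ← dist_eq_norm]
    refine b.dist_normed_convolution_le hcd.aestronglyMeasurable fun y hy => ?_
    exact (hd (lt_of_lt_of_le (mem_ball.mp hy) (min_le_left _ _))).le
  · intro x hx
    rw [(hder x).fderiv]
    have hy0 : ∀ y ∈ ball x b.rOut, fderiv ℝ φ y = 0 := by
      intro y hy
      by_contra hne
      apply hx
      have : y ∈ tsupport φ := support_fderiv_subset ℝ hne
      refine mem_cthickening_of_dist_le x y 1 _ this ?_
      rw [dist_comm]
      exact (lt_of_lt_of_le (mem_ball.mp hy) (min_le_right _ _)).le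
    have := b.normed_convolution_eq_right (μ := volume) (g := fderiv ℝ φ) (x₀ := x)
      (fun y hy => by rw [hy0 y hy, hy0 x (mem_ball_self b.rOut_pos)])
    rw [this, hy0 x (mem_ball_self b.rOut_pos)]

/-- The weak inequality extends to `C¹` compactly supported test functions. -/
lemma aux_C1_test (F : E → E) (hF : Continuous F)
    (H : ∀ φ : E → ℝ, ContDiff ℝ (⊤ : ℕ∞) φ → HasCompactSupport φ → (∀ x, 0 ≤ φ x) →
      0 ≤ ∫ x, fderiv ℝ φ x (F x))
    (φ : E → ℝ) (hφ : ContDiff ℝ 1 φ) (hc : HasCompactSupport φ) (h0 : ∀ x, 0 ≤ φ x) :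
    0 ≤ ∫ x, fderiv ℝ φ x (F x) := by
  set K := cthickening 1 (tsupport φ) with hK
  have hKc : IsCompact K := IsCompact.cthickening hc
  have hint : ∀ ψ : E → ℝ, ContDiff ℝ 1 ψ → HasCompactSupport ψ →
      Integrable (fun x => fderiv ℝ ψ x (F x)) := by
    intro ψ h1 h2
    have hcd : Continuous (fderiv ℝ ψ) := h1.continuous_fderiv one_ne_zero
    refine (hcd.clm_apply hF).integrable_of_hasCompactSupport ?_
    refine (h2.fderiv (𝕜 := ℝ)).mono ?_
    intro x hx h
    apply hx
    simp [h]
  have hFi : IntegrableOn (fun x => ‖F x‖) K := hF.norm.continuousOn.integrableOn_compact hKc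
  have hFi' : Integrable (K.indicator fun x => ‖F x‖) :=
    (integrable_indicator_iff hKc.measurableSet).mpr hFi
  set C := ∫ x, K.indicator (fun x => ‖F x‖) x with hC
  have hbound : ∀ ε > 0, -(ε * C) ≤ ∫ x, fderiv ℝ φ x (F x) := by
    intro ε hε
    obtain ⟨ψ, h1, h2, h3, h4, h5⟩ := aux_smooth_approx φ hφ hc h0 ε hε
    have hψ1 : ContDiff ℝ 1 ψ := h1.of_le (by exact_mod_cast le_top)
    have e := H ψ h1 h2 h3
    have e2 : ∫ x, fderiv ℝ ψ x (F x) - fderiv ℝ φ x (F x) ≤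
        ∫ x, ε * K.indicator (fun x => ‖F x‖) x := by
      refine integral_mono ((hint ψ hψ1 h2).sub (hint φ hφ hc)) (hFi'.const_mul ε) ?_
      intro x
      by_cases hx : x ∈ K
      · simp only [Set.indicator_of_mem hx]
        rw [← sub_apply]
        exact (le_abs_self _).trans (ContinuousLinearMap.le_of_opNorm_le _ (h4 x) _)
      · have : fderiv ℝ φ x = 0 := by
          by_contra hne
          exact hx (self_subset_cthickening _ (support_fderiv_subset ℝ hne))
        simp [Set.indicator_of_notMem hx, h5 x hx, this]
    rw [integral_sub (hint ψ hψ1 h2) (hint φ hφ hc), integral_const_mul] at e2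
    linarith
  have hC0 : 0 ≤ C := integral_nonneg fun x => Set.indicator_nonneg (fun _ _ => norm_nonneg _) x
  refine le_of_forall_pos_le_add fun ε hε => ?_
  have := hbound (ε / (C + 1)) (by positivity)
  have h6 : ε / (C + 1) * C ≤ ε := by
    rw [div_mul_eq_mul_div, div_le_iff₀ (by positivity)]
    nlinarith
  linarith

end approx

/-- The field `|x|^{-N} x` is divergence free away from the origin. -/
lemma aux_div_free (N : ℕ) (φ : EuclideanSpace ℝ (Fin N) → ℝ) (hφ : ContDiff ℝ 1 φ)
    (hc : HasCompactSupport φ) (h0 : φ =ᶠ[𝓝 0] 0) :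
    ∫ x, fderiv ℝ φ x (‖x‖ ^ (-(N : ℝ)) • x) = 0 := by
  set g : EuclideanSpace ℝ (Fin N) → ℝ := fun x => φ x * ‖x‖ ^ (-(N : ℝ)) with hg
  have hg0 : g =ᶠ[𝓝 0] 0 := by
    filter_upwards [h0] with x hx
    simp [hg, hx]
  have hgC : ContDiff ℝ 1 g := by
    rw [contDiff_iff_contDiffAt]
    intro x
    rcases eq_or_ne x 0 with rfl | hx
    · exact contDiffAt_const.congr_of_eventuallyEq hg0
    · exact hφ.contDiffAt.mul ((contDiffAt_norm ℝ hx).rpow_const_of_ne (norm_ne_zero_iff.mpr hx))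
  have hgc : HasCompactSupport g := hc.mul_right
  have hgd : Continuous (fderiv ℝ g) := hgC.continuous_fderiv one_ne_zero
  have hpt : ∀ x, fderiv ℝ φ x (‖x‖ ^ (-(N : ℝ)) • x) = fderiv ℝ g x x + N * g x := by
    intro x
    rcases eq_or_ne x 0 with rfl | hx
    · simp [hg0.eq_of_nhds]
    · have hx0 : 0 < ‖x‖ := norm_pos_iff.mpr hx
      have h1 := ((hφ.differentiable one_ne_zero x).hasFDerivAt.mul
        (aux_hasFDerivAt_norm_rpow (-(N : ℝ)) hx)).fderiv
      have h2 : fderiv ℝ g x = _ := h1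
      rw [h2]
      have h3 : ‖x‖ ^ (-(N : ℝ)) = ‖x‖ ^ (-(N : ℝ) - 2) * ‖x‖ ^ 2 := by
        rw [← Real.rpow_natCast, ← Real.rpow_add hx0]
        congr 1
        push_cast
        ring
      simp [hg, -Real.rpow_neg_natCast]
      rw [h3]
      ring
  simp_rw [hpt]
  have hcoord : ∀ i : Fin N, Integrable (fun x => x i * fderiv ℝ g x (EuclideanSpace.single i 1)) ∧
      ∫ x, x i * fderiv ℝ g x (EuclideanSpace.single i 1) = - ∫ x, g x := by
    intro i
    have hfd : ∀ x : EuclideanSpace ℝ (Fin N),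
        fderiv ℝ (fun x : EuclideanSpace ℝ (Fin N) => x i) x (EuclideanSpace.single i 1) = 1 := by
      intro x
      have : HasFDerivAt (fun x : EuclideanSpace ℝ (Fin N) => x i)
        (EuclideanSpace.proj i : EuclideanSpace ℝ (Fin N) →L[ℝ] ℝ) x :=
        (EuclideanSpace.proj i : EuclideanSpace ℝ (Fin N) →L[ℝ] ℝ).hasFDerivAt
      rw [this.fderiv]
      simp
    have hci : Continuous (fun x : EuclideanSpace ℝ (Fin N) => x i) := by fun_prop
    have hi1 : Integrable (fun x => x i * fderiv ℝ g x (EuclideanSpace.single i 1)) := by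
      refine (hci.mul (hgd.clm_apply continuous_const)).integrable_of_hasCompactSupport ?_
      exact HasCompactSupport.mul_left (hgc.fderiv_apply (𝕜 := ℝ) _)
    refine ⟨hi1, ?_⟩
    rw [integral_mul_fderiv_eq_neg_fderiv_mul_of_integrable]
    · simp_rw [hfd, one_mul]
    · simp_rw [hfd, one_mul]
      exact hgC.continuous.integrable_of_hasCompactSupport hgc
    · exact hi1
    · exact (hci.mul hgC.continuous).integrable_of_hasCompactSupport hgc.mul_left
    · intro x _
      fun_prop
    · intro x _
      exact hgC.differentiable one_ne_zero x
  have hsum : ∀ x, fderiv ℝ g x x = ∑ i, x i * fderiv ℝ g x (EuclideanSpace.single i 1) := by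
    intro x
    have hx : x = ∑ i, x i • EuclideanSpace.single i (1 : ℝ) := by
      have := (EuclideanSpace.basisFun (Fin N) ℝ).sum_repr x
      simpa using this.symm
    conv_lhs => rw [hx]
    rw [map_sum]
    simp only [map_smul, smul_eq_mul]
    rw [← hx]
  have hgi : Integrable g := hgC.continuous.integrable_of_hasCompactSupport hgc
  simp_rw [hsum]
  rw [integral_add (integrable_finsetSum _ fun i _ => (hcoord i).1) (hgi.const_mul _),
    integral_finsetSum _ fun i _ => (hcoord i).1, integral_const_mul]
  simp [hcoord]

/-- Comparison of a supersolution with the radial `p`-harmonic function `a + b |x|^λ`. -/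
lemma aux_comparison (N : ℕ) (p : ℝ) (hp : 1 < p) (lam : ℝ)
    (hlam : (lam - 1) * (p - 1) = 1 - N)
    (u : EuclideanSpace ℝ (Fin N) → ℝ) (hu : ContDiff ℝ 1 u)
    (H : ∀ φ : EuclideanSpace ℝ (Fin N) → ℝ, ContDiff ℝ 1 φ → HasCompactSupport φ →
      (∀ x, 0 ≤ φ x) → 0 ≤ ∫ x, fderiv ℝ φ x (‖gradient u x‖ ^ (p - 2) • gradient u x))
    (a b r₁ r₂ : ℝ) (hr₁ : 0 < r₁)
    (h₁ : ∀ x, ‖x‖ = r₁ → a + b * ‖x‖ ^ lam ≤ u x)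
    (h₂ : ∀ x, ‖x‖ = r₂ → a + b * ‖x‖ ^ lam ≤ u x)
    (x : EuclideanSpace ℝ (Fin N)) (hx₁ : r₁ < ‖x‖) (hx₂ : ‖x‖ < r₂) :
    a + b * ‖x‖ ^ lam ≤ u x := by
  refine le_of_forall_pos_le_add fun ε hε => ?_
  set w : EuclideanSpace ℝ (Fin N) → ℝ := fun y => a + b * ‖y‖ ^ lam - ε - u y with hw
  set S : Set (EuclideanSpace ℝ (Fin N)) := {y | r₁ < ‖y‖ ∧ ‖y‖ < r₂} with hS
  have hSo : IsOpen S :=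
    (isOpen_lt continuous_const continuous_norm).inter (isOpen_lt continuous_norm continuous_const)
  set φ : EuclideanSpace ℝ (Fin N) → ℝ := S.indicator (fun y => Real.smoothTransition (w y))
    with hφdef
  set F : EuclideanSpace ℝ (Fin N) → EuclideanSpace ℝ (Fin N) :=
    fun y => ‖gradient u y‖ ^ (p - 2) • gradient u y with hFdef
  have hgradc : Continuous (gradient u) := by
    have : Continuous (fderiv ℝ u) := hu.continuous_fderiv one_ne_zero
    exact (InnerProductSpace.toDual ℝ (EuclideanSpace ℝ (Fin N))).symm.continuous.comp this
  have hF : Continuous F := (aux_continuous_field p hp).comp hgradc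
  -- local description of `w` and `φ`
  have hwC : ∀ y, y ≠ 0 → ContDiffAt ℝ 1 w y := by
    intro y hy
    exact ((contDiffAt_const.add (contDiffAt_const.mul
      ((contDiffAt_norm ℝ hy).rpow_const_of_ne (norm_ne_zero_iff.mpr hy)))).sub
      contDiffAt_const).sub hu.contDiffAt
  have hSne : ∀ y ∈ S, y ≠ 0 := by
    rintro y hy rfl
    have := hy.1
    rw [norm_zero] at this
    linarith
  have hin : ∀ y ∈ S, φ =ᶠ[𝓝 y] fun y => Real.smoothTransition (w y) := by
    intro y hy
    filter_upwards [hSo.mem_nhds hy] with z hz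
    simp [hφdef, Set.indicator_of_mem hz]
  have hneg : ∀ y, ‖y‖ = r₁ ∨ ‖y‖ = r₂ → y ≠ 0 → φ =ᶠ[𝓝 y] 0 := by
    intro y hy hy0
    have hwy : w y < 0 := by
      have : a + b * ‖y‖ ^ lam ≤ u y := hy.elim (h₁ y) (h₂ y)
      simp only [hw]
      linarith
    filter_upwards [(hwC y hy0).continuousAt.eventually_lt continuousAt_const hwy] with z hz
    by_cases hzS : z ∈ S
    · simp [hφdef, Set.indicator_of_mem hzS, Real.smoothTransition.zero_of_nonpos hz.le]
    · simp [hφdef, Set.indicator_of_notMem hzS]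
  have hout : ∀ y, y ∉ S → φ =ᶠ[𝓝 y] 0 := by
    intro y hy
    have hr₂ : 0 < r₂ := by linarith
    rcases lt_trichotomy ‖y‖ r₁ with h | h | h
    · filter_upwards [continuous_norm.continuousAt.eventually_lt continuousAt_const h] with z hz
      exact Set.indicator_of_notMem (fun hzS => lt_asymm hz hzS.1) _
    · refine hneg y (Or.inl h) ?_
      rintro rfl
      rw [norm_zero] at h
      linarith
    · rcases lt_trichotomy ‖y‖ r₂ with h' | h' | h'
      · exact absurd ⟨h, h'⟩ hy
      · refine hneg y (Or.inr h') ?_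
        rintro rfl
        rw [norm_zero] at h'
        linarith
      · filter_upwards [continuousAt_const.eventually_lt continuous_norm.continuousAt h'] with z hz
        exact Set.indicator_of_notMem (fun hzS => lt_asymm hz hzS.2) _
  have h0S : (0 : EuclideanSpace ℝ (Fin N)) ∉ S := fun h => hSne 0 h rfl
  have hφC : ContDiff ℝ 1 φ := by
    rw [contDiff_iff_contDiffAt]
    intro y
    by_cases hy : y ∈ S
    · refine ContDiffAt.congr_of_eventuallyEq ?_ (hin y hy)
      exact (Real.smoothTransition.contDiffAt (n := 1)).comp y (hwC y (hSne y hy))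
    · exact contDiffAt_const.congr_of_eventuallyEq (hout y hy)
  have hφc : HasCompactSupport φ := by
    refine HasCompactSupport.intro (isCompact_closedBall (0 : EuclideanSpace ℝ (Fin N)) r₂) ?_
    intro y hy
    refine Set.indicator_of_notMem (fun hyS => hy ?_) _
    rw [mem_closedBall_zero_iff]
    exact hyS.2.le
  have hφ0 : ∀ y, 0 ≤ φ y := fun y =>
    Set.indicator_nonneg (fun _ _ => Real.smoothTransition.nonneg _) y
  have hDc : Continuous (fderiv ℝ φ) := hφC.continuous_fderiv one_ne_zero
  -- the field of the radial function
  set c : ℝ := |b * lam| ^ (p - 2) * (b * lam) with hcdef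
  set V : EuclideanSpace ℝ (Fin N) → EuclideanSpace ℝ (Fin N) :=
    fun y => ‖y‖ ^ (-(N : ℝ)) • y with hV
  have hI1 : 0 ≤ ∫ y, fderiv ℝ φ y (F y) := H φ hφC hφc hφ0
  have hI2 : ∫ y, fderiv ℝ φ y (V y) = 0 := aux_div_free N φ hφC hφc (hout 0 h0S)
  have hDout : ∀ y, y ∉ S → fderiv ℝ φ y = 0 := by
    intro y hy
    rw [(hout y hy).fderiv_eq]
    simp
  have hc1 : Continuous (fun y => fderiv ℝ φ y (F y)) := hDc.clm_apply hF
  have hc2 : Continuous (fun y => fderiv ℝ φ y (V y)) := by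
    rw [continuous_iff_continuousAt]
    intro y
    rcases eq_or_ne y 0 with rfl | hy
    · have : (fun y => fderiv ℝ φ y (V y)) =ᶠ[𝓝 0] fun _ => 0 := by
        filter_upwards [(hout 0 h0S).fderiv (𝕜 := ℝ)] with z hz
        rw [hz]
        simp
      exact continuousAt_const.congr this.symm
    · exact hDc.continuousAt.clm_apply ((continuousAt_id.norm.rpow_const
        (Or.inl (norm_ne_zero_iff.mpr hy))).smul continuousAt_id)
  have hcs : ∀ G : EuclideanSpace ℝ (Fin N) → EuclideanSpace ℝ (Fin N),
      HasCompactSupport (fun y => fderiv ℝ φ y (G y)) := by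
    intro G
    refine (hφc.fderiv (𝕜 := ℝ)).mono ?_
    intro y hy h
    apply hy
    simp [h]
  have hi1 := hc1.integrable_of_hasCompactSupport (μ := volume) (hcs F)
  have hi2 := hc2.integrable_of_hasCompactSupport (μ := volume) (hcs V)
  -- pointwise inequality
  have hpt : ∀ y, 0 ≤ c * fderiv ℝ φ y (V y) - fderiv ℝ φ y (F y) ∧
      (c * fderiv ℝ φ y (V y) - fderiv ℝ φ y (F y) = 0 → fderiv ℝ φ y = 0) := by
    intro y
    by_cases hy : y ∈ S
    · have hy0 := hSne y hy
      have hny : 0 < ‖y‖ := norm_pos_iff.mpr hy0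
      set ξ : EuclideanSpace ℝ (Fin N) := (b * lam * ‖y‖ ^ (lam - 2)) • y with hξ
      have hdw : HasFDerivAt w (innerSL ℝ (ξ - gradient u y)) y := by
        have e1 := (((aux_hasFDerivAt_norm_rpow lam hy0).const_mul b).const_add a).sub_const ε
        have e2 := e1.sub (hu.differentiable one_ne_zero y).hasFDerivAt
        refine HasFDerivAt.congr_fderiv (f := w) e2 ?_
        ext v
        rw [← toDual_gradient]
        simp [hξ, inner_sub_left, inner_smul_left]
        ring
      have hdφ : fderiv ℝ φ y =
          deriv Real.smoothTransition (w y) • innerSL ℝ (ξ - gradient u y) := by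
        rw [(hin y hy).fderiv_eq]
        have := ((Real.smoothTransition.contDiff (n := 1)).differentiable one_ne_zero
          (w y)).hasDerivAt
        exact (this.comp_hasFDerivAt y hdw).fderiv
      have hη : 0 ≤ deriv Real.smoothTransition (w y) := Real.smoothTransition.monotone.deriv_nonneg
      have hVξ : c • V y = ‖ξ‖ ^ (p - 2) • ξ := by
        have e1 : ‖ξ‖ = |b * lam| * ‖y‖ ^ (lam - 1) := by
          rw [hξ, norm_smul, norm_mul, Real.norm_eq_abs,
            Real.norm_of_nonneg (Real.rpow_nonneg (norm_nonneg y) _), mul_assoc,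
            ← Real.rpow_add_one hny.ne']
          congr 2
          ring
        rw [e1, Real.mul_rpow (abs_nonneg _) (Real.rpow_nonneg hny.le _), hξ, hV, smul_smul,
          smul_smul, ← Real.rpow_mul hny.le]
        have e2 : ‖y‖ ^ (-(N : ℝ)) = ‖y‖ ^ ((lam - 1) * (p - 2)) * ‖y‖ ^ (lam - 2) := by
          rw [← Real.rpow_add hny]
          congr 1
          linarith
        rw [e2, hcdef]
        congr 1
        ring
      have hval : c * fderiv ℝ φ y (V y) - fderiv ℝ φ y (F y) =
          deriv Real.smoothTransition (w y) * ⟪ξ - gradient u y,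
            ‖ξ‖ ^ (p - 2) • ξ - ‖gradient u y‖ ^ (p - 2) • gradient u y⟫ := by
        rw [← smul_eq_mul, ← map_smul, hVξ, ← map_sub, hdφ]
        rfl
      have hm := aux_monotone p hp ξ (gradient u y)
      rw [hval]
      refine ⟨mul_nonneg hη hm.1, fun h => ?_⟩
      rw [hdφ]
      rcases mul_eq_zero.mp h with h | h
      · rw [h, zero_smul]
      · rw [hm.2 h, sub_self, map_zero, smul_zero]
    · rw [hDout y hy]
      simp
  have hzero : (fun y => c * fderiv ℝ φ y (V y) - fderiv ℝ φ y (F y)) = 0 := by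
    have hi := (hi2.const_mul c).sub hi1
    have hint : ∫ y, (c * fderiv ℝ φ y (V y) - fderiv ℝ φ y (F y)) = 0 := by
      refine le_antisymm ?_ (integral_nonneg fun y => (hpt y).1)
      rw [integral_sub (hi2.const_mul c) hi1, integral_const_mul, hI2]
      linarith
    have hae := (integral_eq_zero_iff_of_nonneg (fun y => (hpt y).1) hi).mp hint
    exact (((continuous_const.mul hc2).sub hc1).ae_eq_iff_eq volume continuous_const).mp hae
  have hD0 : ∀ y, fderiv ℝ φ y = 0 := fun y => (hpt y).2 (congrFun hzero y)
  have hconst := is_const_of_fderiv_eq_zero (hφC.differentiable one_ne_zero) hD0 x 0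
  rw [(hout 0 h0S).eq_of_nhds] at hconst
  have hxS : x ∈ S := ⟨hx₁, hx₂⟩
  rw [(hin x hxS).eq_of_nhds] at hconst
  have := Real.smoothTransition.zero_iff_nonpos.mp hconst
  simp only [hw] at this
  linarith

/-- Hadamard three-spheres type inequality for p-superharmonic functions, `N ≠ p`. -/
theorem hadamard_inequality_ne
    (N : ℕ) (hN : 1 ≤ N) (p : ℝ) (hp : 1 < p) (hNp : (N : ℝ) ≠ p)
    (lam : ℝ) (hlam : lam = (p - N) / (p - 1))
    (u : EuclideanSpace ℝ (Fin N) → ℝ)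
    (hu : ContDiff ℝ 1 u) (hu_nonneg : ∀ x, 0 ≤ u x)
    (hsuper : ∀ φ : EuclideanSpace ℝ (Fin N) → ℝ,
      ContDiff ℝ (⊤ : ℕ∞) φ → HasCompactSupport φ → (∀ x, 0 ≤ φ x) →
      0 ≤ ∫ x, ‖gradient u x‖ ^ (p - 2) * ⟪gradient u x, gradient φ x⟫)
    (m : ℝ → ℝ)
    (hm : ∀ r : ℝ, m r = sInf (u '' closedBall (0 : EuclideanSpace ℝ (Fin N)) r)) :
    ∀ r₁ r r₂ : ℝ, 0 < r₁ → r₁ < r → r < r₂ →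
      (m r₁ * (r ^ lam - r₂ ^ lam) + m r₂ * (r₁ ^ lam - r ^ lam)) /
          (r₁ ^ lam - r₂ ^ lam) ≤ m r := by
  intro r₁ r r₂ hr₁ h1r hr2
  have hp1 : p - 1 ≠ 0 := by linarith
  have hr : 0 < r := hr₁.trans h1r
  have hr₂ : 0 < r₂ := hr.trans hr2
  have hlam0 : lam ≠ 0 := by
    rw [hlam]
    exact div_ne_zero (sub_ne_zero.mpr hNp.symm) hp1
  have hlam' : (lam - 1) * (p - 1) = 1 - N := by
    rw [hlam]
    field_simp
    ring
  have hbdd : ∀ s, BddBelow (u '' closedBall (0 : EuclideanSpace ℝ (Fin N)) s) := by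
    intro s
    refine ⟨0, ?_⟩
    rintro _ ⟨x, _, rfl⟩
    exact hu_nonneg x
  have hle : ∀ s x, ‖x‖ ≤ s → m s ≤ u x := by
    intro s x hx
    rw [hm]
    exact csInf_le (hbdd s) ⟨x, mem_closedBall_zero_iff.mpr hx, rfl⟩
  have hge : ∀ s, 0 < s → ∀ t, (∀ x, ‖x‖ ≤ s → t ≤ u x) → t ≤ m s := by
    intro s hs t ht
    rw [hm]
    refine le_csInf ⟨u 0, 0, mem_closedBall_self hs.le, rfl⟩ ?_
    rintro _ ⟨x, hx, rfl⟩
    exact ht x (mem_closedBall_zero_iff.mp hx)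
  have hm12 : m r₂ ≤ m r₁ := hge r₁ hr₁ _ fun x hx => hle r₂ x (by linarith)
  have hFc : Continuous (fun x => ‖gradient u x‖ ^ (p - 2) • gradient u x) := by
    have h : Continuous (fderiv ℝ u) := hu.continuous_fderiv one_ne_zero
    have hg : Continuous (gradient u) :=
      (InnerProductSpace.toDual ℝ (EuclideanSpace ℝ (Fin N))).symm.continuous.comp h
    exact (aux_continuous_field p hp).comp hg
  have H := aux_C1_test (fun x => ‖gradient u x‖ ^ (p - 2) • gradient u x) hFc (by
    intro φ a1 a2 a3
    refine (hsuper φ a1 a2 a3).trans (le_of_eq ?_)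
    congr 1
    funext x
    rw [← toDual_gradient, InnerProductSpace.toDual_apply_apply, inner_smul_right,
      real_inner_comm])
  -- monotonicity of powers
  have hanti : ∃ b : ℝ, b * (r₁ ^ lam - r₂ ^ lam) = m r₁ - m r₂ ∧ r₁ ^ lam - r₂ ^ lam ≠ 0 ∧
      ∀ s t, 0 < s → s ≤ t → b * t ^ lam ≤ b * s ^ lam := by
    refine ⟨(m r₁ - m r₂) / (r₁ ^ lam - r₂ ^ lam), ?_⟩
    rcases lt_or_gt_of_ne hlam0 with h | h
    · have hd : 0 < r₁ ^ lam - r₂ ^ lam :=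
        sub_pos.mpr (Real.rpow_lt_rpow_of_neg hr₁ (h1r.trans hr2) h)
      refine ⟨div_mul_cancel₀ _ hd.ne', hd.ne', fun s t hs hst => ?_⟩
      exact mul_le_mul_of_nonneg_left (Real.rpow_le_rpow_of_nonpos hs hst h.le)
        (div_nonneg (by linarith) hd.le)
    · have hd : r₁ ^ lam - r₂ ^ lam < 0 :=
        sub_neg.mpr (Real.rpow_lt_rpow hr₁.le (h1r.trans hr2) h)
      refine ⟨div_mul_cancel₀ _ hd.ne, hd.ne, fun s t hs hst => ?_⟩
      exact mul_le_mul_of_nonpos_left (Real.rpow_le_rpow hs.le hst h.le)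
        (div_nonpos_of_nonneg_of_nonpos (by linarith) hd.le)
  obtain ⟨b, hb, hd, hmono⟩ := hanti
  have hval : (m r₁ * (r ^ lam - r₂ ^ lam) + m r₂ * (r₁ ^ lam - r ^ lam)) /
      (r₁ ^ lam - r₂ ^ lam) = (m r₁ - b * r₁ ^ lam) + b * r ^ lam := by
    rw [div_eq_iff hd]
    linear_combination (r₁ ^ lam - r ^ lam) * hb
  have hcomp := aux_comparison N p hp lam hlam' u hu H (m r₁ - b * r₁ ^ lam) b r₁ r₂ hr₁
    (fun x hx => by
      rw [hx]
      linarith [hle r₁ x hx.le])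
    (fun x hx => by
      rw [hx]
      linarith [hle r₂ x hx.le])
  rw [hval]
  refine hge r hr _ fun x hx => ?_
  rcases le_or_gt ‖x‖ r₁ with h | h
  · linarith [hle r₁ x h, hmono r₁ r hr₁ h1r.le]
  · linarith [hcomp x h (by linarith), hmono ‖x‖ r (by linarith) hx]
end
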